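/- arXiv:1612.07314 — 4 statements merged into one kernel-verified Lean document; each statement's English description precedes it below -/
import Mathlib

section
/- Borsuk–Ulam theorem: for every natural number d and every continuous map f : S^d → ℝ^d there exists a point x ∈ S^d such that f(-x) = f(x). -/
/-! ### Chains modulo two on lists of points -/

namespace OrderedChain

/-- Augmented ordered chains modulo two: formal sums of lists of points. -/
abbrev Chain (α : Type*) := List α →₀ ZMod 2

variable {α β : Type*}

/-- The cone with apex `a`. -/
noncomputable def cone (a : α) : Chain α →ₗ[ZMod 2] Chain α :=
  Finsupp.lmapDomain (ZMod 2) (ZMod 2) (List.cons a)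

@[simp]
lemma cone_single (a : α) (l : List α) (r : ZMod 2) :
    cone a (Finsupp.single l r) = Finsupp.single (a :: l) r := by
  simp [cone]

/-- The chain map induced by a map of points. -/
noncomputable def push (ν : α → β) : Chain α →ₗ[ZMod 2] Chain β :=
  Finsupp.lmapDomain (ZMod 2) (ZMod 2) (List.map ν)

@[simp]
lemma push_single (ν : α → β) (l : List α) (r : ZMod 2) :
    push ν (Finsupp.single l r) = Finsupp.single (l.map ν) r := by
  simp [push]

lemma push_cone (ν : α → β) (a : α) (c : Chain α) :
    push ν (cone a c) = cone (ν a) (push ν c) := by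
  suffices h : push ν ∘ₗ cone a = cone (ν a) ∘ₗ push ν from LinearMap.congr_fun h c
  ext l : 2
  simp

lemma push_push_of_involutive {ν : α → α} (hν : Function.Involutive ν) (c : Chain α) :
    push ν (push ν c) = c := by
  suffices h : push ν ∘ₗ push ν = LinearMap.id from LinearMap.congr_fun h c
  ext l : 2
  simp [hν.comp_self]

/-- The boundary of a single list. -/
noncomputable def bdryList : List α → Chain α
  | [] => 0
  | a :: l => Finsupp.single l 1 + cone a (bdryList l)

/-- The boundary operator, the sum of all deletions of one entry. -/
noncomputable def bdry : Chain α →ₗ[ZMod 2] Chain α :=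
  Finsupp.linearCombination (ZMod 2) bdryList

@[simp]
lemma bdry_single_nil : bdry (Finsupp.single ([] : List α) 1) = 0 := by
  simp [bdry, bdryList]

lemma bdry_single_cons (a : α) (l : List α) :
    bdry (Finsupp.single (a :: l) 1) =
      Finsupp.single l 1 + cone a (bdry (Finsupp.single l 1)) := by
  simp [bdry, bdryList]

lemma bdry_cone (a : α) (c : Chain α) : bdry (cone a c) = c + cone a (bdry c) := by
  suffices h : bdry ∘ₗ cone a = LinearMap.id + cone a ∘ₗ bdry from LinearMap.congr_fun h c
  ext l : 2
  simp [bdry_single_cons]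

lemma bdry_bdry (c : Chain α) : bdry (bdry c) = 0 := by
  suffices h : bdry ∘ₗ bdry = (0 : Chain α →ₗ[ZMod 2] Chain α) from LinearMap.congr_fun h c
  ext l : 2
  simp only [LinearMap.comp_apply, Finsupp.lsingle_apply, LinearMap.zero_apply]
  induction l with
  | nil => simp
  | cons a l ih =>
    rw [bdry_single_cons, map_add, bdry_cone, ih, map_zero, add_zero, ZModModule.add_self]

lemma bdry_push (ν : α → β) (c : Chain α) : bdry (push ν c) = push ν (bdry c) := by
  suffices h : bdry ∘ₗ push ν = push ν ∘ₗ bdry from LinearMap.congr_fun h c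
  ext l : 2
  simp only [LinearMap.comp_apply, Finsupp.lsingle_apply]
  induction l with
  | nil => simp
  | cons a l ih =>
    simp only [push_single, List.map_cons] at ih ⊢
    rw [bdry_single_cons, bdry_single_cons, ih, map_add, push_cone, push_single]

lemma cone_mem_supported {a : α} {s t : Set (List α)} (h : ∀ l ∈ s, a :: l ∈ t)
    {c : Chain α} (hc : c ∈ Finsupp.supported (ZMod 2) (ZMod 2) s) :
    cone a c ∈ Finsupp.supported (ZMod 2) (ZMod 2) t := by
  rw [Finsupp.supported_eq_span_single] at hc
  induction hc using Submodule.span_induction with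
  | mem x hx =>
    obtain ⟨l, hl, rfl⟩ := hx
    rw [cone_single]
    exact Finsupp.single_mem_supported _ _ (h l hl)
  | zero => simp
  | add x y _ _ hx hy => rw [map_add]; exact add_mem hx hy
  | smul r x _ hx => rw [map_smul]; exact Submodule.smul_mem _ _ hx

lemma map_mem_supported (T : Chain α →ₗ[ZMod 2] Chain β) {s : Set (List α)} {t : Set (List β)}
    (h : ∀ l ∈ s, T (Finsupp.single l 1) ∈ Finsupp.supported (ZMod 2) (ZMod 2) t)
    {c : Chain α} (hc : c ∈ Finsupp.supported (ZMod 2) (ZMod 2) s) :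
    T c ∈ Finsupp.supported (ZMod 2) (ZMod 2) t := by
  rw [Finsupp.supported_eq_span_single] at hc
  have : Submodule.span (ZMod 2) ((fun l => Finsupp.single l 1) '' s) ≤
      (Finsupp.supported (ZMod 2) (ZMod 2) t).comap T := by
    rw [Submodule.span_le]
    rintro _ ⟨l, hl, rfl⟩
    exact h l hl
  exact this hc

lemma bdry_single_mem_supported (l : List α) :
    bdry (Finsupp.single l 1) ∈
      Finsupp.supported (ZMod 2) (ZMod 2) {l' | l'.Sublist l ∧ l'.length + 1 = l.length} := by
  induction l with
  | nil => simp
  | cons a l ih =>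
    rw [bdry_single_cons]
    refine add_mem (Finsupp.single_mem_supported _ _ ⟨List.sublist_cons_self a l, rfl⟩)
      (cone_mem_supported ?_ ih)
    rintro l' ⟨h₁, h₂⟩
    exact ⟨h₁.cons_cons a, by simp [h₂]⟩

/-! ### Products of coboundaries -/

/-- The cup product of the coboundaries of a list of functions, evaluated on a list of points. -/
def cupList : List (α → ZMod 2) → List α → ZMod 2
  | [], [_] => 1
  | h :: hs, v :: w :: l => (h v + h w) * cupList hs (w :: l)
  | _, _ => 0

/-- The cup product of a function with the coboundaries of a list of functions, evaluated on a
list of points. -/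
def primList (h : α → ZMod 2) (hs : List (α → ZMod 2)) : List α → ZMod 2
  | [] => 0
  | v :: l => h v * cupList hs (v :: l)

/-- The linear extension of `cupList`. -/
noncomputable def cup (hs : List (α → ZMod 2)) : Chain α →ₗ[ZMod 2] ZMod 2 :=
  Finsupp.linearCombination (ZMod 2) (cupList hs)

/-- The linear extension of `primList`. -/
noncomputable def prim (h : α → ZMod 2) (hs : List (α → ZMod 2)) : Chain α →ₗ[ZMod 2] ZMod 2 :=
  Finsupp.linearCombination (ZMod 2) (primList h hs)

@[simp]
lemma cup_single (hs : List (α → ZMod 2)) (l : List α) :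
    cup hs (Finsupp.single l 1) = cupList hs l := by
  simp [cup]

@[simp]
lemma prim_single (h : α → ZMod 2) (hs : List (α → ZMod 2)) (l : List α) :
    prim h hs (Finsupp.single l 1) = primList h hs l := by
  simp [prim]

@[simp]
lemma cupList_nil_right (hs : List (α → ZMod 2)) : cupList hs [] = 0 := by
  cases hs <;> rfl

lemma cone_apply_nil (a : α) (c : Chain α) : cone a c [] = 0 := by
  suffices h : Finsupp.lapply [] ∘ₗ cone a = (0 : Chain α →ₗ[ZMod 2] ZMod 2) from
    LinearMap.congr_fun h c
  ext l : 2
  simp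

lemma cup_nil (c : Chain α) : cup [] c = bdry c [] := by
  suffices h : cup [] = Finsupp.lapply [] ∘ₗ (bdry : Chain α →ₗ[ZMod 2] Chain α) from
    LinearMap.congr_fun h c
  ext l : 2
  match l with
  | [] => simp
  | [v] => simp [bdry_single_cons, cupList]
  | v :: w :: l => simp [bdry_single_cons, cupList, cone_apply_nil]

lemma prim_cone (h : α → ZMod 2) (hs : List (α → ZMod 2)) (a : α) (c : Chain α) :
    prim h hs (cone a c) = h a * cup hs (cone a c) := by
  suffices H : prim h hs ∘ₗ cone a = h a • (cup hs ∘ₗ cone a) from LinearMap.congr_fun H c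
  ext l : 2
  simp [primList]

lemma cup_cons_of_cocycle (h : α → ZMod 2) (hs : List (α → ZMod 2))
    (H : ∀ c, cup hs (bdry c) = 0) (c : Chain α) : cup (h :: hs) c = prim h hs (bdry c) := by
  suffices h : cup (h :: hs) = prim h hs ∘ₗ bdry from LinearMap.congr_fun h c
  ext l : 2
  match l with
  | [] => simp
  | [v] => simp [bdry_single_cons, cupList, primList]
  | v :: w :: l =>
    have key := H (Finsupp.single (v :: w :: l) 1)
    rw [bdry_single_cons, map_add, cup_single] at key
    simp only [LinearMap.comp_apply, Finsupp.lsingle_apply]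
    rw [bdry_single_cons, map_add, prim_cone, prim_single, cup_single,
      ← CharTwo.add_eq_zero.1 key]
    simp only [cupList, primList]
    ring

lemma cup_bdry (hs : List (α → ZMod 2)) (c : Chain α) : cup hs (bdry c) = 0 := by
  induction hs generalizing c with
  | nil => rw [cup_nil, bdry_bdry]; rfl
  | cons h hs ih => rw [cup_cons_of_cocycle h hs ih, bdry_bdry, map_zero]

lemma cup_cons (h : α → ZMod 2) (hs : List (α → ZMod 2)) (c : Chain α) :
    cup (h :: hs) c = prim h hs (bdry c) :=
  cup_cons_of_cocycle h hs (cup_bdry hs) c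

lemma cupList_map {ν : α → α} (hs : List (α → ZMod 2)) (hν : ∀ h ∈ hs, ∀ v, h (ν v) = h v + 1)
    (l : List α) : cupList hs (l.map ν) = cupList hs l := by
  induction hs generalizing l with
  | nil =>
    match l with
    | [] => rfl
    | [v] => rfl
    | v :: w :: l => rfl
  | cons h hs ih =>
    match l with
    | [] => rfl
    | [v] => rfl
    | v :: w :: l =>
      have := ih (fun h hh => hν h (List.mem_cons_of_mem _ hh)) (w :: l)
      simp only [List.map_cons] at this
      simp only [List.map_cons, cupList, this, hν h List.mem_cons_self]
      congr 1
      linear_combination CharTwo.add_self_eq_zero (1 : ZMod 2)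

lemma prim_add_push {ν : α → α} (h : α → ZMod 2) (hs : List (α → ZMod 2))
    (hh : ∀ v, h (ν v) = h v + 1) (hν : ∀ h ∈ hs, ∀ v, h (ν v) = h v + 1) (c : Chain α) :
    prim h hs (c + push ν c) = cup hs c := by
  suffices H : prim h hs ∘ₗ (LinearMap.id + push ν) = cup hs from LinearMap.congr_fun H c
  ext l : 2
  match l with
  | [] => simp [primList]
  | v :: l =>
    have := cupList_map hs hν (v :: l)
    simp only [List.map_cons] at this
    simp only [LinearMap.comp_apply, Finsupp.lsingle_apply, LinearMap.add_apply,
      LinearMap.id_apply, map_add, push_single, prim_single, cup_single, List.map_cons, primList,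
      this, hh]
    linear_combination cupList hs (v :: l) * CharTwo.add_self_eq_zero (h v)

/-- A sequence of chains filling the hemispheres of spheres of increasing dimension detects the
cup product of equally many coboundaries of antisymmetric functions. -/
lemma cup_eq_one {ν : α → α} (c : ℕ → Chain α) (h₀ : bdry (c 0) = Finsupp.single [] 1)
    (hc : ∀ k, bdry (c (k + 1)) = c k + push ν (c k)) (hs : List (α → ZMod 2))
    (hν : ∀ h ∈ hs, ∀ v, h (ν v) = h v + 1) : cup hs (c hs.length) = 1 := by
  induction hs with
  | nil => simp [cup_nil, h₀]
  | cons h hs ih =>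
    have hν' : ∀ h ∈ hs, ∀ v, h (ν v) = h v + 1 := fun h hh => hν h (List.mem_cons_of_mem _ hh)
    rw [cup_cons, List.length_cons, hc, prim_add_push h hs (hν h List.mem_cons_self) hν', ih hν']

lemma exists_ne_of_cupList_ne_zero {hs : List (α → ZMod 2)} {l : List α}
    (H : cupList hs l ≠ 0) : ∀ h ∈ hs, ∃ v ∈ l, ∃ w ∈ l, h v ≠ h w := by
  induction hs generalizing l with
  | nil => simp
  | cons h hs ih =>
    match l with
    | [] => simp at H
    | [v] => simp [cupList] at H
    | v :: w :: l =>
      rw [cupList] at H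
      intro g hg
      rcases List.mem_cons.1 hg with rfl | hg
      · refine ⟨v, by simp, w, by simp, fun e => H ?_⟩
        rw [e, CharTwo.add_self_eq_zero, zero_mul]
      · obtain ⟨x, hx, y, hy, hxy⟩ := ih (right_ne_zero_of_mul H) g hg
        exact ⟨x, List.mem_cons_of_mem _ hx, y, List.mem_cons_of_mem _ hy, hxy⟩

/-! ### Subdivision -/

/-- The subdivision of chains of lists of length `n`, with `b l` as the new vertex in `l`. -/
noncomputable def subdiv (b : List α → α) : ℕ → Chain α →ₗ[ZMod 2] Chain α
  | 0 => LinearMap.id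
  | n + 1 => Finsupp.linearCombination (ZMod 2)
      fun l => cone (b l) (subdiv b n (bdry (Finsupp.single l 1)))

lemma subdiv_succ_single (b : List α → α) (n : ℕ) (l : List α) :
    subdiv b (n + 1) (Finsupp.single l 1) =
      cone (b l) (subdiv b n (bdry (Finsupp.single l 1))) := by
  simp [subdiv]

lemma bdry_subdiv (b : List α → α) (n : ℕ) (c : Chain α) :
    bdry (subdiv b (n + 1) c) = subdiv b n (bdry c) := by
  suffices h : bdry ∘ₗ subdiv b (n + 1) = subdiv b n ∘ₗ bdry from LinearMap.congr_fun h c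
  induction n generalizing c with
  | zero =>
    ext l : 2
    simp only [LinearMap.comp_apply, Finsupp.lsingle_apply]
    rw [subdiv_succ_single, bdry_cone]
    simp [subdiv, bdry_bdry]
  | succ n ih =>
    ext l : 2
    simp only [LinearMap.comp_apply, Finsupp.lsingle_apply]
    rw [subdiv_succ_single, bdry_cone, ← LinearMap.comp_apply bdry, ih 0, LinearMap.comp_apply,
      bdry_bdry, map_zero, map_zero, add_zero]

lemma subdiv_push {ν : α → α} {b : List α → α}
    (hb : ∀ l, l ≠ [] → b (l.map ν) = ν (b l)) (n : ℕ) (c : Chain α) :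
    subdiv b n (push ν c) = push ν (subdiv b n c) := by
  induction n generalizing c with
  | zero => rfl
  | succ n ih =>
    suffices h : subdiv b (n + 1) ∘ₗ push ν = push ν ∘ₗ subdiv b (n + 1) from
      LinearMap.congr_fun h c
    ext l : 2
    simp only [LinearMap.comp_apply, Finsupp.lsingle_apply]
    rw [push_single, subdiv_succ_single, subdiv_succ_single, push_cone, ← ih, ← bdry_push,
      push_single]
    rcases eq_or_ne l [] with rfl | hl
    · simp
    · rw [hb l hl]

/-! ### The cross-polytope -/

/-- The chain of the upper hemisphere of the `k`-dimensional cross-polytope. -/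
noncomputable def hemi (ν : α → α) (e : ℕ → α) : ℕ → Chain α
  | 0 => Finsupp.single [e 0] 1
  | k + 1 => cone (e (k + 1)) (hemi ν e k + push ν (hemi ν e k))

lemma bdry_hemi_zero (ν : α → α) (e : ℕ → α) : bdry (hemi ν e 0) = Finsupp.single [] 1 := by
  simp [hemi, bdry_single_cons]

lemma bdry_hemi_succ {ν : α → α} (hν : Function.Involutive ν) (e : ℕ → α) (k : ℕ) :
    bdry (hemi ν e (k + 1)) = hemi ν e k + push ν (hemi ν e k) := by
  suffices h : ∀ k, bdry (hemi ν e k + push ν (hemi ν e k)) = 0 by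
    rw [hemi, bdry_cone, h, map_zero, add_zero]
  intro k
  induction k with
  | zero =>
    rw [map_add, bdry_push, bdry_hemi_zero, push_single, List.map_nil, ZModModule.add_self]
  | succ k ih =>
    have : bdry (hemi ν e (k + 1)) = hemi ν e k + push ν (hemi ν e k) := by
      rw [hemi, bdry_cone, ih, map_zero, add_zero]
    rw [map_add, bdry_push, this, map_add, push_push_of_involutive hν,
      add_comm (push ν _), ZModModule.add_self]

/-- The iterated subdivision of the hemisphere of the `k`-dimensional cross-polytope. -/
noncomputable def fineHemi (ν : α → α) (b : List α → α) (e : ℕ → α) (m k : ℕ) : Chain α :=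
  (subdiv b (k + 1))^[m] (hemi ν e k)

lemma bdry_iterate_subdiv (b : List α → α) (m n : ℕ) (c : Chain α) :
    bdry ((subdiv b (n + 1))^[m] c) = (subdiv b n)^[m] (bdry c) :=
  Function.Semiconj.iterate_right (f := bdry) (bdry_subdiv b n) m c

lemma bdry_fineHemi_zero (ν : α → α) (b : List α → α) (e : ℕ → α) (m : ℕ) :
    bdry (fineHemi ν b e m 0) = Finsupp.single [] 1 := by
  rw [fineHemi, bdry_iterate_subdiv, bdry_hemi_zero]
  exact Function.iterate_fixed rfl m

lemma bdry_fineHemi_succ {ν : α → α} (hν : Function.Involutive ν) {b : List α → α}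
    (hb : ∀ l, l ≠ [] → b (l.map ν) = ν (b l)) (e : ℕ → α) (m k : ℕ) :
    bdry (fineHemi ν b e m (k + 1)) = fineHemi ν b e m k + push ν (fineHemi ν b e m k) := by
  rw [fineHemi, bdry_iterate_subdiv, bdry_hemi_succ hν, fineHemi, iterate_map_add]
  congr 1
  exact (Function.Semiconj.iterate_right (f := push ν)
    (fun c => (subdiv_push hb (k + 1) c).symm) m _).symm

/-- Antisymmetric functions all change sign on a common list of the subdivided hemisphere. -/
lemma exists_mem_support_fineHemi {ν : α → α} (hν : Function.Involutive ν) {b : List α → α}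
    (hb : ∀ l, l ≠ [] → b (l.map ν) = ν (b l)) (e : ℕ → α) (m : ℕ) {d : ℕ}
    (h : Fin d → α → ZMod 2) (hh : ∀ i v, h i (ν v) = h i v + 1) :
    ∃ l ∈ (fineHemi ν b e m d).support, ∀ i, ∃ v ∈ l, ∃ w ∈ l, h i v ≠ h i w := by
  have key := cup_eq_one (ν := ν) (fineHemi ν b e m) (bdry_fineHemi_zero ν b e m)
    (bdry_fineHemi_succ hν hb e m) (List.ofFn h) (by
      intro g hg
      obtain ⟨i, rfl⟩ := (List.mem_ofFn' _ _).1 hg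
      exact hh i)
  rw [List.length_ofFn, cup, Finsupp.linearCombination_apply, Finsupp.sum] at key
  obtain ⟨l, hl, hne⟩ := Finset.exists_ne_zero_of_sum_ne_zero (key ▸ one_ne_zero)
  refine ⟨l, hl, fun i => ?_⟩
  exact exists_ne_of_cupList_ne_zero (right_ne_zero_of_mul hne) (h i)
    ((List.mem_ofFn' _ _).2 ⟨i, rfl⟩)

/-! ### Mesh estimates

Points carry a sign in `ZMod 2`, so that the antipodal map has no fixed point. -/

variable {E : Type*} [NormedAddCommGroup E]

/-- The antipodal map on signed points. -/
def antipode (x : E × ZMod 2) : E × ZMod 2 := (-x.1, x.2 + 1)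

lemma antipode_involutive : Function.Involutive (antipode : E × ZMod 2 → E × ZMod 2) := by
  rintro ⟨x, s⟩
  simp only [antipode, neg_neg, add_assoc, CharTwo.add_self_eq_zero, add_zero]

variable [NormedSpace ℝ E]

/-- The barycenter of a list of signed points, with the sign of the first one. -/
noncomputable def bary (l : List (E × ZMod 2)) : E × ZMod 2 :=
  ((l.length : ℝ)⁻¹ • (l.map Prod.fst).sum, (l.map Prod.snd).headD 0)

lemma bary_map_antipode (l : List (E × ZMod 2)) (hl : l ≠ []) :
    bary (l.map antipode) = antipode (bary l) := by
  have h : ∀ l : List (E × ZMod 2),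
      ((l.map antipode).map Prod.fst).sum = -(l.map Prod.fst).sum := by
    intro l
    induction l with
    | nil => simp
    | cons a l ih => rw [List.map_cons, List.map_cons, List.sum_cons, ih]; simp [antipode, add_comm]
  match l, hl with
  | a :: l, _ =>
    refine Prod.ext ?_ ?_
    · simp only [bary, h, antipode, List.length_map, smul_neg]
    · simp [bary, antipode]

/-- Lists of `n` signed points in `K` at mutual distances at most `D`. -/
def smallLists (n : ℕ) (K : Set E) (D : ℝ) : Set (List (E × ZMod 2)) :=
  {l | l.length = n ∧ (∀ x ∈ l, x.1 ∈ K) ∧ ∀ x ∈ l, ∀ y ∈ l, dist x.1 y.1 ≤ D}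

lemma inv_length_smul_sum_mem {K : Set E} (hK : Convex ℝ K) (l : List E) (hl : l ≠ [])
    (h : ∀ x ∈ l, x ∈ K) : (l.length : ℝ)⁻¹ • l.sum ∈ K := by
  have hpos : (0 : ℝ) < l.length := by exact_mod_cast List.length_pos_iff.2 hl
  have : (l.length : ℝ)⁻¹ • l.sum = ∑ i : Fin l.length, (l.length : ℝ)⁻¹ • l[i] := by
    rw [← Finset.smul_sum]
    exact congrArg _ (Fin.sum_univ_getElem l).symm
  rw [this]
  refine hK.sum_mem (fun _ _ => by positivity) ?_ fun i _ => h _ (List.getElem_mem _)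
  simp [hpos.ne']

lemma dist_inv_length_smul_sum_le {l : List E} {D : ℝ} {x : E} (hx : x ∈ l)
    (h : ∀ y ∈ l, dist x y ≤ D) {N : ℕ} (hN : l.length ≤ N + 1) :
    dist x ((l.length : ℝ)⁻¹ • l.sum) ≤ N / (N + 1) * D := by
  obtain ⟨n, hn⟩ : ∃ n, l.length = n + 1 :=
    Nat.exists_eq_succ_of_ne_zero (List.length_pos_of_mem hx).ne'
  have hD : 0 ≤ D := dist_nonneg.trans (h x hx)
  obtain ⟨j, hj, rfl⟩ := List.getElem_of_mem hx
  have h1 : l[j] - (l.length : ℝ)⁻¹ • l.sum =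
      (l.length : ℝ)⁻¹ • ∑ i : Fin l.length, (l[j] - l[i]) := by
    have hsum : ∑ i : Fin l.length, l[i] = l.sum := Fin.sum_univ_getElem l
    rw [Finset.sum_sub_distrib, hsum, smul_sub]
    simp only [Finset.sum_const, Finset.card_univ, Fintype.card_fin]
    rw [← Nat.cast_smul_eq_nsmul ℝ, smul_smul, inv_mul_cancel₀, one_smul]
    rw [hn]; positivity
  have h2 : ‖∑ i : Fin l.length, (l[j] - l[i])‖ ≤ n * D := by
    rw [← Finset.add_sum_erase _ _ (Finset.mem_univ (⟨j, hj⟩ : Fin l.length))]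
    simp only [Fin.getElem_fin, sub_self, zero_add]
    refine (norm_sum_le_of_le (n := fun _ => D) _ fun i _ => ?_).trans ?_
    · rw [← dist_eq_norm]; exact h _ (List.getElem_mem _)
    · simp [Finset.card_erase_of_mem, hn]
  rw [dist_eq_norm, h1, norm_smul, norm_inv, Real.norm_natCast]
  calc (l.length : ℝ)⁻¹ * ‖∑ i : Fin l.length, (l[j] - l[i])‖
      ≤ (l.length : ℝ)⁻¹ * (n * D) := by gcongr
    _ = n / (n + 1) * D := by rw [hn]; push_cast; ring
    _ ≤ N / (N + 1) * D := by
      have : n ≤ N := by omega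
      have : (n : ℝ) ≤ N := by exact_mod_cast this
      gcongr ?_ * D
      rw [div_le_div_iff₀ (by positivity) (by positivity)]
      linarith

lemma subdiv_single_mem_supported {N n : ℕ} (hn : n ≤ N + 1) {K : Set E} (hK : Convex ℝ K) {D : ℝ}
    {l : List (E × ZMod 2)} (hl : l ∈ smallLists n K D) :
    subdiv bary n (Finsupp.single l 1) ∈
      Finsupp.supported (ZMod 2) (ZMod 2) (smallLists n K (N / (N + 1) * D)) := by
  induction n generalizing K l with
  | zero =>
    obtain ⟨h, -⟩ := hl
    obtain rfl := List.length_eq_zero_iff.1 h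
    exact Finsupp.single_mem_supported _ _ (by simp [smallLists])
  | succ n ih =>
    obtain ⟨h₁, h₂, h₃⟩ := hl
    have hne : l.map Prod.fst ≠ [] := by
      rw [Ne, List.map_eq_nil_iff]; rintro rfl; simp at h₁
    obtain ⟨a, ha⟩ := List.exists_mem_of_ne_nil l (by rintro rfl; simp at h₁)
    have hD : 0 ≤ D := dist_nonneg.trans (h₃ a ha a ha)
    have hb : (bary l).1 = (((l.map Prod.fst).length : ℝ))⁻¹ • (l.map Prod.fst).sum := by
      simp [bary]
    set r : ℝ := N / (N + 1) * D with hr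
    have hr₀ : 0 ≤ r := by positivity
    set K' : Set E := K ∩ Metric.closedBall (bary l).1 r with hK'
    have hbK : (bary l).1 ∈ K := by
      rw [hb]
      exact inv_length_smul_sum_mem hK _ hne (by simpa using fun x s h => h₂ (x, s) h)
    have hball : ∀ x ∈ l, x.1 ∈ K' := by
      refine fun x hx => ⟨h₂ x hx, ?_⟩
      rw [Metric.mem_closedBall, hb]
      refine dist_inv_length_smul_sum_le (List.mem_map_of_mem hx) ?_ (by simpa [h₁] using hn)
      intro y hy
      obtain ⟨z, hz, rfl⟩ := List.mem_map.1 hy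
      exact h₃ x hx z hz
    rw [subdiv_succ_single]
    refine cone_mem_supported (s := smallLists n K' r) ?_
      (map_mem_supported _ ?_ (bdry_single_mem_supported l))
    · rintro l' ⟨g₁, g₂, g₃⟩
      refine ⟨by simp [g₁], ?_, ?_⟩
      · simp only [List.mem_cons, forall_eq_or_imp]
        exact ⟨hbK, fun x hx => (g₂ x hx).1⟩
      · simp only [List.mem_cons, forall_eq_or_imp, dist_self]
        refine ⟨⟨hr₀, fun x hx => ?_⟩, fun x hx => ⟨(g₂ x hx).2, g₃ x hx⟩⟩
        rw [dist_comm]; exact (g₂ x hx).2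
    · rintro l' ⟨g₁, g₂⟩
      exact ih (by omega) (hK.inter (convex_closedBall _ _))
        ⟨by omega, fun x hx => hball x (g₁.subset hx),
          fun x hx y hy => h₃ x (g₁.subset hx) y (g₁.subset hy)⟩

lemma iterate_subdiv_mem_supported {ι : Type*} {N : ℕ} {K : ι → Set E} (hK : ∀ i, Convex ℝ (K i))
    {D : ℝ} {c : Chain (E × ZMod 2)}
    (hc : c ∈ Finsupp.supported (ZMod 2) (ZMod 2) (⋃ i, smallLists (N + 1) (K i) D)) (m : ℕ) :
    (subdiv bary (N + 1))^[m] c ∈ Finsupp.supported (ZMod 2) (ZMod 2)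
      (⋃ i, smallLists (N + 1) (K i) ((N / (N + 1) : ℝ) ^ m * D)) := by
  induction m with
  | zero => simpa using hc
  | succ m ih =>
    rw [Function.iterate_succ_apply']
    refine map_mem_supported _ (fun l hl => ?_) ih
    obtain ⟨i, hi⟩ := Set.mem_iUnion.1 hl
    rw [pow_succ', mul_assoc]
    exact Finsupp.supported_mono (Set.subset_iUnion_of_subset i subset_rfl)
      (subdiv_single_mem_supported le_rfl (hK i) hi)

lemma hemi_mem_supported (e : ℕ → E) (k : ℕ) :
    hemi antipode (fun i => (e i, 0)) k ∈ Finsupp.supported (ZMod 2) (ZMod 2)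
      {l | l.length = k + 1 ∧ ∃ σ : ℕ → ℝ, (∀ i, |σ i| = 1) ∧
        ∀ x ∈ l, ∃ i ≤ k, x.1 = σ i • e i} := by
  induction k with
  | zero =>
    refine Finsupp.single_mem_supported _ _ ⟨rfl, 1, by simp, ?_⟩
    simp
  | succ k ih =>
    refine cone_mem_supported (s := {l | l.length = k + 1 ∧ ∃ σ : ℕ → ℝ, (∀ i, |σ i| = 1) ∧
        ∀ x ∈ l, ∃ i ≤ k, x.1 = σ i • e i}) ?_ (add_mem ih (map_mem_supported _ ?_ ih))
    · rintro l ⟨hl, σ, hσ, H⟩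
      refine ⟨by simp [hl], Function.update σ (k + 1) 1, fun i => ?_, ?_⟩
      · rcases eq_or_ne i (k + 1) with rfl | hi
        · simp
        · simp [hi, hσ]
      · simp only [List.mem_cons, forall_eq_or_imp]
        refine ⟨⟨k + 1, le_rfl, by simp⟩, fun x hx => ?_⟩
        obtain ⟨i, hi, h⟩ := H x hx
        exact ⟨i, by omega, by rw [Function.update_of_ne (by omega), h]⟩
    · rintro l ⟨hl, σ, hσ, H⟩
      rw [push_single]
      refine Finsupp.single_mem_supported _ _ ⟨by simp [hl], -σ, by simpa using hσ, ?_⟩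
      intro x hx
      obtain ⟨y, hy, rfl⟩ := List.mem_map.1 hx
      obtain ⟨i, hi, h⟩ := H y hy
      exact ⟨i, hi, by simp [antipode, h]⟩

/-- The facet of the cross-polytope with sign vector `σ`. -/
def facet (n : ℕ) (σ : Fin n → ℝ) : Set (EuclideanSpace ℝ (Fin n)) :=
  {x | ‖x‖ ≤ 1 ∧ ∑ i, σ i * x i = 1}

lemma convex_facet (n : ℕ) (σ : Fin n → ℝ) : Convex ℝ (facet n σ) := by
  rintro x ⟨hx, hx'⟩ y ⟨hy, hy'⟩ a b ha hb hab
  refine ⟨?_, ?_⟩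
  · simpa using convex_closedBall (0 : EuclideanSpace ℝ (Fin n)) 1 (by simpa using hx)
      (by simpa using hy) ha hb hab
  · have : ∑ i, σ i * (a • x + b • y) i = a * ∑ i, σ i * x i + b * ∑ i, σ i * y i := by
      rw [Finset.mul_sum, Finset.mul_sum, ← Finset.sum_add_distrib]
      refine Finset.sum_congr rfl fun i _ => ?_
      simp
      ring
    rw [this, hx', hy', mul_one, mul_one, hab]

lemma smul_single_mem_facet {n : ℕ} {σ : Fin n → ℝ} (hσ : ∀ i, |σ i| = 1) (i : Fin n) :
    σ i • EuclideanSpace.single i (1 : ℝ) ∈ facet n σ := by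
  constructor
  · rw [norm_smul, Real.norm_eq_abs, hσ]
    simp
  · rw [Finset.sum_eq_single i]
    · simp [← abs_mul_abs_self (σ i), hσ]
    · intro j _ hj
      simp [hj]
    · simp

lemma mem_smallLists_facet {n : ℕ} {σ : Fin n → ℝ} {l : List (EuclideanSpace ℝ (Fin n) × ZMod 2)}
    (hl : l.length = n) (h : ∀ x ∈ l, x.1 ∈ facet n σ) : l ∈ smallLists n (facet n σ) 2 := by
  refine ⟨hl, h, fun x hx y hy => ?_⟩
  rw [dist_eq_norm]
  linarith [norm_sub_le x.1 y.1, (h x hx).1, (h y hy).1]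

lemma exists_hemi_mem_supported_iUnion (d : ℕ) :
    ∃ e : ℕ → EuclideanSpace ℝ (Fin (d + 1)),
      hemi antipode (fun i => (e i, 0)) d ∈ Finsupp.supported (ZMod 2) (ZMod 2)
        (⋃ σ : {σ : Fin (d + 1) → ℝ // ∀ i, |σ i| = 1},
          smallLists (d + 1) (facet (d + 1) σ) 2) := by
  refine ⟨fun i => EuclideanSpace.single (Fin.ofNat (d + 1) i) 1, ?_⟩
  have hsub : {l : List (EuclideanSpace ℝ (Fin (d + 1)) × ZMod 2) | l.length = d + 1 ∧
      ∃ σ : ℕ → ℝ, (∀ i, |σ i| = 1) ∧ ∀ x ∈ l, ∃ i ≤ d,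
        x.1 = σ i • EuclideanSpace.single (Fin.ofNat (d + 1) i) 1} ⊆
      ⋃ σ : {σ : Fin (d + 1) → ℝ // ∀ i, |σ i| = 1},
        smallLists (d + 1) (facet (d + 1) σ) 2 := by
    rintro l ⟨hl, σ, hσ, H⟩
    rw [Set.mem_iUnion]
    refine ⟨⟨fun i => σ i, fun i => hσ i⟩, mem_smallLists_facet hl fun x hx => ?_⟩
    obtain ⟨i, hi, h⟩ := H x hx
    have hval : ((Fin.ofNat (d + 1) i : Fin (d + 1)) : ℕ) = i := Nat.mod_eq_of_lt (by omega)
    have := smul_single_mem_facet (σ := fun i : Fin (d + 1) => σ i) (fun i => hσ i)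
      (Fin.ofNat (d + 1) i)
    rwa [hval, ← h] at this
  exact Finsupp.supported_mono hsub (hemi_mem_supported _ d)

/-- Any antisymmetric functions on signed points all change sign on a common small list in a
facet of the cross-polytope. -/
lemma exists_smallLists_forall_ne (d m : ℕ)
    (h : Fin d → EuclideanSpace ℝ (Fin (d + 1)) × ZMod 2 → ZMod 2)
    (hh : ∀ i v, h i (antipode v) = h i v + 1) :
    ∃ σ : Fin (d + 1) → ℝ, (∀ i, |σ i| = 1) ∧
      ∃ l ∈ smallLists (d + 1) (facet (d + 1) σ) ((d / (d + 1) : ℝ) ^ m * 2),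
        ∀ i, ∃ v ∈ l, ∃ w ∈ l, h i v ≠ h i w := by
  obtain ⟨e, hc⟩ := exists_hemi_mem_supported_iUnion d
  obtain ⟨l, hl, H⟩ := exists_mem_support_fineHemi antipode_involutive bary_map_antipode
    (fun i => (e i, 0)) m h hh
  have hfine := iterate_subdiv_mem_supported (N := d) (D := 2)
    (K := fun σ : {σ : Fin (d + 1) → ℝ // ∀ i, |σ i| = 1} => facet (d + 1) σ)
    (fun σ => convex_facet (d + 1) σ.1) hc m
  rw [Finsupp.mem_supported] at hfine
  rw [fineHemi, ← Finset.mem_coe] at hl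
  obtain ⟨⟨σ, hσ⟩, hl'⟩ := Set.mem_iUnion.1 (hfine hl)
  exact ⟨σ, hσ, l, hl', H⟩

/-- The points of the Euclidean unit ball outside the open cross-polytope. -/
def shell (n : ℕ) : Set (EuclideanSpace ℝ (Fin n)) := {x | ‖x‖ ≤ 1 ∧ 1 ≤ ∑ i, |x i|}

lemma isCompact_shell (n : ℕ) : IsCompact (shell n) := by
  have : shell n = Metric.closedBall 0 1 ∩ {x | 1 ≤ ∑ i, |x i|} := by
    ext x; simp [shell]
  rw [this]
  refine (isCompact_closedBall _ _).inter_right (isClosed_le continuous_const ?_)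
  fun_prop

lemma facet_subset_shell {n : ℕ} {σ : Fin n → ℝ} (hσ : ∀ i, |σ i| = 1) :
    facet n σ ⊆ shell n := by
  rintro x ⟨hx, h⟩
  refine ⟨hx, h ▸ Finset.sum_le_sum fun i _ => ?_⟩
  calc σ i * x i ≤ |σ i * x i| := le_abs_self _
    _ = |x i| := by rw [abs_mul, hσ, one_mul]

lemma ne_zero_of_mem_shell {n : ℕ} {x : EuclideanSpace ℝ (Fin n)} (hx : x ∈ shell n) : x ≠ 0 := by
  rintro rfl
  have := hx.2
  simp at this
  linarith

open Filter Topology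

/-- An odd map that is continuous away from the origin has a zero away from the origin. -/
theorem exists_ne_zero_forall_eq_zero (d : ℕ) (g : Fin d → EuclideanSpace ℝ (Fin (d + 1)) → ℝ)
    (hodd : ∀ i x, g i (-x) = -g i x) (hg : ∀ i x, x ≠ 0 → ContinuousAt (g i) x) :
    ∃ x, x ≠ 0 ∧ ∀ i, g i x = 0 := by
  classical
  let h : Fin d → EuclideanSpace ℝ (Fin (d + 1)) × ZMod 2 → ZMod 2 := fun i v =>
    if 0 < g i v.1 then 1 else if g i v.1 < 0 then 0 else v.2
  have hh : ∀ i v, h i (antipode v) = h i v + 1 := by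
    intro i v
    rcases lt_trichotomy (g i v.1) 0 with H | H | H
    · simp [h, antipode, hodd, H, H.le]
    · simp [h, antipode, hodd, H]
    · simp [h, antipode, hodd, H, H.le, CharTwo.add_self_eq_zero]
  have hne : ∀ i v w, h i v ≠ h i w → g i v.1 * g i w.1 ≤ 0 := by
    intro i v w H
    by_contra! hpos
    rcases mul_pos_iff.1 hpos with ⟨h₁, h₂⟩ | ⟨h₁, h₂⟩
    · exact H (by simp [h, h₁, h₂])
    · exact H (by simp [h, h₁, h₂, h₁.not_gt, h₂.not_gt])
  have key : ∀ m : ℕ, ∃ x ∈ shell (d + 1), ∀ i, ∃ v w : EuclideanSpace ℝ (Fin (d + 1)),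
      dist v x ≤ (d / (d + 1) : ℝ) ^ m * 2 ∧ dist w x ≤ (d / (d + 1) : ℝ) ^ m * 2 ∧
        g i v * g i w ≤ 0 := by
    intro m
    obtain ⟨σ, hσ, l, ⟨hl₁, hl₂, hl₃⟩, H⟩ := exists_smallLists_forall_ne d m h hh
    obtain ⟨a, ha⟩ := List.exists_mem_of_ne_nil l (by rintro rfl; simp at hl₁)
    refine ⟨a.1, facet_subset_shell hσ (hl₂ a ha), fun i => ?_⟩
    obtain ⟨v, hv, w, hw, hvw⟩ := H i
    exact ⟨v.1, w.1, hl₃ v hv a ha, hl₃ w hw a ha, hne i v w hvw⟩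
  choose x hx v w hv hw hvw using key
  obtain ⟨y, hy, φ, hφ, hlim⟩ := (isCompact_shell (d + 1)).tendsto_subseq hx
  have hy₀ := ne_zero_of_mem_shell hy
  refine ⟨y, hy₀, fun i => ?_⟩
  have hr : Tendsto (fun m : ℕ => (d / (d + 1) : ℝ) ^ φ m * 2) atTop (𝓝 0) := by
    have : Tendsto (fun m : ℕ => (d / (d + 1) : ℝ) ^ m) atTop (𝓝 0) :=
      tendsto_pow_atTop_nhds_zero_of_lt_one (by positivity)
        (by rw [div_lt_one (by positivity)]; linarith)
    simpa using (this.comp hφ.tendsto_atTop).mul_const 2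
  have hclose : ∀ u : ℕ → EuclideanSpace ℝ (Fin (d + 1)),
      (∀ m, dist (u m) (x m) ≤ (d / (d + 1) : ℝ) ^ m * 2) → Tendsto (u ∘ φ) atTop (𝓝 y) := by
    intro u hu
    refine (tendsto_iff_of_dist ?_).1 hlim
    refine squeeze_zero (fun _ => dist_nonneg) (fun m => ?_) hr
    rw [dist_comm]
    exact hu (φ m)
  have hlimit : Tendsto (fun m => g i (v (φ m) i) * g i (w (φ m) i)) atTop
      (𝓝 (g i y * g i y)) :=
    ((hg i y hy₀).tendsto.comp (hclose (fun m => v m i) fun m => hv m i)).mul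
      ((hg i y hy₀).tendsto.comp (hclose (fun m => w m i) fun m => hw m i))
  have := le_of_tendsto' hlimit fun m => hvw (φ m) i
  exact mul_self_eq_zero.1 (le_antisymm this (mul_self_nonneg _))

end OrderedChain

/-- **Borsuk–Ulam theorem**: for every natural number `d` and every continuous map
`f : S^d → ℝ^d` there exists a point `x ∈ S^d` with `f (-x) = f x`. -/
theorem borsuk_ulam (d : ℕ)
    (f : (Metric.sphere (0 : EuclideanSpace ℝ (Fin (d + 1))) 1) → EuclideanSpace ℝ (Fin d))
    (hf : Continuous f) :
    ∃ x : (Metric.sphere (0 : EuclideanSpace ℝ (Fin (d + 1))) 1), f (-x) = f x := by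
  classical
  let p : Metric.sphere (0 : EuclideanSpace ℝ (Fin (d + 1))) 1 :=
    ⟨EuclideanSpace.single 0 1, by simp⟩
  let proj : EuclideanSpace ℝ (Fin (d + 1)) →
      Metric.sphere (0 : EuclideanSpace ℝ (Fin (d + 1))) 1 :=
    fun x => if hx : x = 0 then p else ⟨‖x‖⁻¹ • x, by simp [norm_smul, hx]⟩
  have hproj : ∀ x (hx : x ≠ 0), (proj x : EuclideanSpace ℝ (Fin (d + 1))) = ‖x‖⁻¹ • x := by
    intro x hx
    simp [proj, hx]
  have hneg : ∀ x, x ≠ 0 → proj (-x) = -proj x := by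
    intro x hx
    ext1
    rw [hproj _ (neg_ne_zero.2 hx), coe_neg_sphere, hproj x hx, norm_neg, smul_neg]
  have hcont : ∀ x, x ≠ 0 → ContinuousAt proj x := by
    intro x hx
    rw [Topology.IsInducing.subtypeVal.continuousAt_iff]
    refine ContinuousAt.congr (f := fun x => ‖x‖⁻¹ • x) ?_ ?_
    · exact (continuousAt_id.norm.inv₀ (norm_ne_zero_iff.2 hx)).smul continuousAt_id
    · filter_upwards [isOpen_ne.mem_nhds hx] with y hy using (hproj y hy).symm
  obtain ⟨x, hx, H⟩ := OrderedChain.exists_ne_zero_forall_eq_zero d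
    (fun i x => f (proj x) i - f (proj (-x)) i) (by intro i x; simp) (by
      intro i x hx
      have h1 : ContinuousAt (fun x => f (proj x)) x := hf.continuousAt.comp (hcont x hx)
      have h2 : ContinuousAt (fun x => f (proj (-x))) x :=
        hf.continuousAt.comp ((hcont (-x) (neg_ne_zero.2 hx)).comp continuous_neg.continuousAt)
      exact ((EuclideanSpace.proj (𝕜 := ℝ) i).continuous.continuousAt.comp h1).sub
        ((EuclideanSpace.proj (𝕜 := ℝ) i).continuous.continuousAt.comp h2))
  refine ⟨proj x, ?_⟩
  rw [← hneg x hx]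
  ext i
  exact (sub_eq_zero.1 (H i)).symm
end

section
/- Borsuk–Ulam theorem for the ball: Let d ≥ 1 and let f : EuclideanSpace ℝ (Fin d) → EuclideanSpace ℝ (Fin d) be continuous on the closed unit ball Metric.closedBall 0 1 and odd on the boundary sphere, i.e. f(-x) = -f(x) for every x with ‖x‖ = 1. Then there exists a point x ∈ Metric.closedBall 0 1 such that f(x) = 0. -/
open MvPolynomial

theorem exists_algHom_real_of_odd_finrank (B : Type*) [CommRing B] [Algebra ℝ B]
    [Module.Finite ℝ B] (h : Odd (Module.finrank ℝ B)) : Nonempty (B →ₐ[ℝ] ℝ) := by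
  induction hn : Module.finrank ℝ B using Nat.strong_induction_on generalizing B with
  | _ n ih =>
  have : Nontrivial B := Module.nontrivial_of_finrank_pos (R := ℝ) h.pos
  by_cases hB : IsField B
  · let _ := hB.toField
    rcases Real.nonempty_algEquiv_or B with ⟨⟨e⟩⟩ | ⟨⟨e⟩⟩
    · exact ⟨e.toAlgHom⟩
    · rw [e.toLinearEquiv.finrank_eq, Complex.finrank_real_complex] at h
      exact absurd h (by decide)
  · obtain ⟨a, ha0, ha⟩ := Ring.exists_not_isUnit_of_not_isField hB
    let L : B →ₗ[B] B := LinearMap.mulLeft B a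
    have hsum := (L.restrictScalars ℝ).finrank_range_add_finrank_ker
    have hr : Module.finrank ℝ (B ⧸ L.range) + Module.finrank ℝ (L.restrictScalars ℝ).range
        = Module.finrank ℝ B := by
      rw [← Submodule.finrank_quotient_add_finrank (L.restrictScalars ℝ).range]
      exact congrArg (· + _) ((Submodule.Quotient.restrictScalarsEquiv ℝ L.range)).finrank_eq.symm
    have hk : Module.finrank ℝ (B ⧸ L.ker) + Module.finrank ℝ (L.restrictScalars ℝ).ker
        = Module.finrank ℝ B := by
      rw [← Submodule.finrank_quotient_add_finrank (L.restrictScalars ℝ).ker]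
      exact congrArg (· + _) ((Submodule.Quotient.restrictScalarsEquiv ℝ L.ker)).finrank_eq.symm
    have hr0 : Module.finrank ℝ (L.restrictScalars ℝ).range ≠ 0 := by
      rw [Ne, Submodule.finrank_eq_zero, LinearMap.range_eq_bot]
      intro h0
      exact ha0 (by simpa [L] using LinearMap.congr_fun h0 1)
    have hk0 : Module.finrank ℝ (B ⧸ L.range) ≠ 0 := by
      intro h0
      have : Subsingleton (B ⧸ L.range) := Module.finrank_zero_iff.mp h0
      have htop : L.range = ⊤ := Submodule.Quotient.subsingleton_iff.mp this
      obtain ⟨b, hb⟩ : (1 : B) ∈ L.range := htop ▸ Submodule.mem_top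
      exact ha (IsUnit.of_mul_eq_one b (by simpa [L] using hb))
    have key (I : Ideal B) (hI : Odd (Module.finrank ℝ (B ⧸ I)))
        (hlt : Module.finrank ℝ (B ⧸ I) < n) : Nonempty (B →ₐ[ℝ] ℝ) := by
      obtain ⟨g⟩ := ih _ hlt (B ⧸ I) hI rfl
      exact ⟨g.comp (Ideal.Quotient.mkₐ ℝ I)⟩
    rcases Nat.even_or_odd (Module.finrank ℝ (B ⧸ L.range)) with he | ho
    · refine key L.ker ?_ ?_
      · grind
      · omega
    · exact key L.range ho (by omega)

section
variable {σ : Type*} [Fintype σ]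

/-- The product `∏ i, X i ^ (m i % D) * F i ^ (m i / D)`, obtained from the monomial `m`
by replacing each `X i ^ D` with `F i`. -/
noncomputable def substMonomial {R : Type*} [CommSemiring R] (D : ℕ) (F : σ → MvPolynomial σ R)
    (m : σ →₀ ℕ) : MvPolynomial σ R :=
  ∏ i, (X i ^ (m i % D) * F i ^ (m i / D))

theorem totalDegree_substMonomial_le {R : Type*} [CommSemiring R] [Nontrivial R] {D : ℕ}
    {F : σ → MvPolynomial σ R} (hF : ∀ i, (F i).totalDegree ≤ D) (m : σ →₀ ℕ) :
    (substMonomial D F m).totalDegree ≤ m.degree := by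
  rw [substMonomial, Finsupp.degree_eq_sum]
  refine (totalDegree_finsetProd _ _).trans (Finset.sum_le_sum fun i _ => ?_)
  calc _ ≤ m i % D + m i / D * D := by
        refine (totalDegree_mul _ _).trans (add_le_add (totalDegree_X_pow _ _).le ?_)
        exact (totalDegree_pow _ _).trans (Nat.mul_le_mul_left _ (hF i))
    _ = m i := Nat.mod_add_div' _ _

theorem substMonomial_X_pow {R : Type*} [CommSemiring R] (D : ℕ) (m : σ →₀ ℕ) :
    substMonomial D (fun i => (X i ^ D : MvPolynomial σ R)) m = monomial m 1 := by
  rw [monomial_eq, Finsupp.prod_fintype _ _ (by simp), C_1, one_mul, substMonomial]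
  refine Finset.prod_congr rfl fun i _ => ?_
  rw [← pow_mul, ← pow_add, Nat.mod_add_div]

theorem map_substMonomial {R S : Type*} [CommSemiring R] [CommSemiring S] (g : R →+* S) (D : ℕ)
    (F : σ → MvPolynomial σ R) (m : σ →₀ ℕ) :
    map g (substMonomial D F m) = substMonomial D (fun i => map g (F i)) m := by
  simp [substMonomial, map_prod]

theorem substMonomial_add_single {R : Type*} [CommSemiring R] {D : ℕ} (hD : 0 < D)
    (F : σ → MvPolynomial σ R) (m : σ →₀ ℕ) (i : σ) :
    substMonomial D F (m + Finsupp.single i D) = F i * substMonomial D F m := by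
  classical
  rw [substMonomial, substMonomial, ← Finset.mul_prod_erase _ _ (Finset.mem_univ i),
    ← Finset.mul_prod_erase _ _ (Finset.mem_univ i), Finset.prod_congr rfl (g := fun j =>
      (X j ^ (m j % D) * F j ^ (m j / D)))]
  · simp [Nat.add_div_right _ hD, pow_succ]
    ring
  · intro j hj
    simp [(Finset.ne_of_mem_erase hj).symm]

/-- The linear endomorphism of the polynomial ring which sends each monomial to its image under
`substMonomial`. -/
noncomputable def substMonomialLinear (D : ℕ) (F : σ → MvPolynomial σ ℝ) :
    MvPolynomial σ ℝ →ₗ[ℝ] MvPolynomial σ ℝ :=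
  (basisMonomials σ ℝ).constr ℝ (substMonomial D F)

theorem substMonomialLinear_monomial (D : ℕ) (F : σ → MvPolynomial σ ℝ) (m : σ →₀ ℕ) (c : ℝ) :
    substMonomialLinear D F (monomial m c) = c • substMonomial D F m := by
  have : monomial m c = c • basisMonomials σ ℝ m := by simp [smul_monomial]
  rw [this, map_smul, substMonomialLinear, Module.Basis.constr_basis]

theorem coeff_substMonomialLinear (D : ℕ) (F : σ → MvPolynomial σ ℝ) (s : Finset (σ →₀ ℕ))
    (p : MvPolynomial σ ℝ) (hp : p.support ⊆ s) (k : σ →₀ ℕ) :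
    coeff k (substMonomialLinear D F p) = ∑ m ∈ s, coeff k (substMonomial D F m) * coeff m p := by
  conv_lhs => rw [p.as_sum, map_sum, coeff_sum]
  rw [Finset.sum_subset hp (by
    intro m _ hm
    simp [notMem_support_iff.mp hm])]
  refine Finset.sum_congr rfl fun m _ => ?_
  rw [substMonomialLinear_monomial, coeff_smul, smul_eq_mul, mul_comm]

theorem countable_setOf_not_bijective (D : ℕ) (f : σ → MvPolynomial σ ℝ)
    (hf : ∀ i, (f i).totalDegree ≤ D) :
    {s : ℝ | ¬ Function.Bijective
      (substMonomialLinear D fun i => X i ^ D + C s * f i)}.Countable := by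
  classical
  let F (s : ℝ) (i : σ) : MvPolynomial σ ℝ := X i ^ D + C s * f i
  let G (i : σ) : MvPolynomial σ (Polynomial ℝ) := X i ^ D + C Polynomial.X * map Polynomial.C (f i)
  have hFG (s : ℝ) : (fun i => map (Polynomial.evalRingHom s) (G i)) = F s := by
    funext i
    have : (Polynomial.evalRingHom s).comp Polynomial.C = RingHom.id ℝ := by ext; simp
    simp [F, G, map_map, this, MvPolynomial.map_id]
  have hFD (s : ℝ) (i : σ) : (F s i).totalDegree ≤ D := by
    refine (totalDegree_add _ _).trans (max_le (totalDegree_X_pow _ _).le ?_)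
    refine (totalDegree_mul _ _).trans ?_
    simpa using hf i
  let S (M : ℕ) : Finset (σ →₀ ℕ) := (Finsupp.finite_of_degree_le (σ := σ) M).toFinset
  have hS (M : ℕ) (m : σ →₀ ℕ) : m ∈ S M ↔ m.degree ≤ M := by simp [S]
  have hsupp (M : ℕ) (p : MvPolynomial σ ℝ) (hp : p.totalDegree ≤ M) : p.support ⊆ S M := by
    intro m hm
    rw [hS, Finsupp.degree_apply]
    exact (le_totalDegree hm).trans hp
  let A (M : ℕ) : Matrix (S M) (S M) (Polynomial ℝ) :=
    Matrix.of fun k m => coeff k.1 (substMonomial D G m.1)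
  let A' (s : ℝ) (M : ℕ) : Matrix (S M) (S M) ℝ :=
    Matrix.of fun k m => coeff k.1 (substMonomial D (F s) m.1)
  have hA (s : ℝ) (M : ℕ) : (A M).map (Polynomial.evalRingHom s) = A' s M := by
    ext k m
    simp only [A, A', Matrix.map_apply, Matrix.of_apply]
    rw [← hFG s, ← map_substMonomial, coeff_map]
  have hdet (s : ℝ) (M : ℕ) : (A M).det.eval s = (A' s M).det := by
    rw [← hA, ← Polynomial.coe_evalRingHom, RingHom.map_det, RingHom.mapMatrix_apply]
  have hA0 (M : ℕ) : A' 0 M = 1 := by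
    ext k m
    have : F 0 = fun i => X i ^ D := by funext i; simp [F]
    simp only [A', Matrix.of_apply, this, substMonomial_X_pow, coeff_monomial, Matrix.one_apply,
      Subtype.ext_iff, eq_comm]
  have hne (M : ℕ) : (A M).det ≠ 0 := by
    intro h0
    have := hdet 0 M
    rw [h0, hA0, Matrix.det_one, Polynomial.eval_zero] at this
    exact zero_ne_one this
  refine Set.Countable.mono (s₂ := ⋃ M, {s | (A M).det.IsRoot s}) ?_
    (Set.countable_iUnion fun M => (Polynomial.finite_setOfPred_isRoot (hne M)).countable)
  intro s hs
  by_contra hroot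
  simp only [Set.mem_iUnion, Set.mem_ofPred_eq, Polynomial.IsRoot, not_exists, hdet] at hroot
  refine hs ⟨(injective_iff_map_eq_zero _).mpr fun p hp => ?_, fun q => ?_⟩
  · have hv : (A' s p.totalDegree).mulVec (fun m => coeff m.1 p) = 0 := by
      funext k
      have := coeff_substMonomialLinear D (F s) _ p (hsupp _ p le_rfl) k.1
      rw [show substMonomialLinear D (F s) p = 0 from hp, coeff_zero, ← Finset.sum_coe_sort] at this
      exact this.symm
    have hv0 := Matrix.eq_zero_of_mulVec_eq_zero (hroot _) hv
    ext m
    by_contra hm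
    exact hm (congr_fun hv0 ⟨m, hsupp _ p le_rfl (mem_support_iff.mpr hm)⟩)
  · set M := q.totalDegree
    obtain ⟨v, hv⟩ := Matrix.mulVec_surjective_iff_isUnit.mpr
      ((Matrix.isUnit_iff_isUnit_det _).mpr (isUnit_iff_ne_zero.mpr (hroot M)))
      (fun k => coeff k.1 q)
    refine ⟨∑ m : S M, monomial m.1 (v m), ?_⟩
    rw [map_sum]
    change ∑ m : S M, substMonomialLinear D (F s) (monomial m.1 (v m)) = q
    simp only [substMonomialLinear_monomial]
    ext k
    by_cases hk : k ∈ S M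
    · rw [coeff_sum, ← congr_fun hv ⟨k, hk⟩]
      simp [Matrix.mulVec, dotProduct, A', mul_comm]
    · have hlt : M < k.degree := by rw [hS] at hk; omega
      rw [Finsupp.degree_apply] at hlt
      rw [coeff_eq_zero_of_totalDegree_lt (f := q) hlt]
      refine coeff_eq_zero_of_totalDegree_lt (lt_of_le_of_lt ?_ hlt)
      refine totalDegree_finsetSum_le fun m _ => (totalDegree_smul_le _ _).trans ?_
      exact (totalDegree_substMonomial_le (hFD s) _).trans ((hS M _).mp m.2)

theorem exists_eval_eq_zero_of_bijective {D : ℕ} (hD : Odd D) (F : σ → MvPolynomial σ ℝ)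
    (hF : Function.Bijective (substMonomialLinear D F)) : ∃ x : σ → ℝ, ∀ i, eval x (F i) = 0 := by
  classical
  let e := LinearEquiv.ofBijective _ hF
  have he (p) : e p = substMonomialLinear D F p := rfl
  let I : Ideal (MvPolynomial σ ℝ) := Ideal.span (Set.range F)
  let small (a : σ → Fin D) : σ →₀ ℕ := Finsupp.equivFunOnFinite.symm fun i => a i
  let c : MvPolynomial σ ℝ →ₗ[ℝ] ((σ → Fin D) → ℝ) := LinearMap.pi fun a => lcoeff ℝ (small a)
  have hc (p a) : c p a = coeff (small a) p := rfl
  let φ : MvPolynomial σ ℝ →ₗ[ℝ] ((σ → Fin D) → ℝ) := c ∘ₗ e.symm.toLinearMap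
  have hsmall : Function.Injective small := by
    intro a b hab
    funext i
    exact Fin.ext (DFunLike.congr_fun hab i)
  have hφ : Function.Surjective φ := by
    refine Function.Surjective.comp (g := c) (fun v => ?_) e.symm.surjective
    refine ⟨∑ a, monomial (small a) (v a), ?_⟩
    funext b
    simp [hc, coeff_sum, coeff_monomial, hsmall.eq_iff]
  have hker : φ.ker = I.restrictScalars ℝ := by
    apply le_antisymm
    · intro p hp
      obtain ⟨q, rfl⟩ := e.surjective p
      have hq : c q = 0 := by simpa [φ] using hp
      rw [Submodule.restrictScalars_mem, he, q.as_sum, map_sum]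
      refine Ideal.sum_mem _ fun m hm => ?_
      rw [substMonomialLinear_monomial]
      refine Submodule.smul_of_tower_mem _ _ ?_
      obtain ⟨i, hi⟩ : ∃ i, D ≤ m i := by
        by_contra! hlt
        have : small (fun i => ⟨m i, hlt i⟩) = m := by ext; rfl
        exact mem_support_iff.mp hm (this ▸ congr_fun hq fun i => ⟨m i, hlt i⟩)
      rw [← tsub_add_cancel_of_le (Finsupp.single_le_iff.mpr hi),
        substMonomial_add_single hD.pos]
      exact I.mul_mem_right _ (Ideal.subset_span ⟨i, rfl⟩)
    · intro p hp
      rw [Submodule.restrictScalars_mem, Ideal.mem_span_range_iff_exists_fun] at hp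
      obtain ⟨g, rfl⟩ := hp
      refine Submodule.sum_mem _ fun i _ => ?_
      obtain ⟨q, hq⟩ := e.surjective (g i)
      have hmul : e (q * monomial (Finsupp.single i D) 1) = e q * F i := by
        clear hq
        induction q using MvPolynomial.induction_on' with
        | monomial m a =>
          rw [monomial_mul, mul_one, he, he, substMonomialLinear_monomial,
            substMonomialLinear_monomial, substMonomial_add_single hD.pos, smul_mul_assoc, mul_comm]
        | add p q hp hq => rw [add_mul, map_add, map_add, add_mul, hp, hq]
      rw [← hq, ← hmul, LinearMap.mem_ker]
      funext a
      have : ¬ Finsupp.single i D ≤ small a := by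
        rw [Finsupp.single_le_iff, not_le]
        exact (a i).2
      simp [φ, hc, coeff_mul_monomial', this]
  have hfin : (MvPolynomial σ ℝ ⧸ I) ≃ₗ[ℝ] ((σ → Fin D) → ℝ) :=
    (Submodule.Quotient.restrictScalarsEquiv ℝ I).symm ≪≫ₗ
      (Submodule.quotEquivOfEq _ _ hker.symm ≪≫ₗ φ.quotKerEquivOfSurjective hφ)
  have : Module.Finite ℝ (MvPolynomial σ ℝ ⧸ I) := Module.Finite.equiv hfin.symm
  obtain ⟨g⟩ := exists_algHom_real_of_odd_finrank (MvPolynomial σ ℝ ⧸ I) (by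
    rw [hfin.finrank_eq]
    simpa using hD.pow)
  let ψ := g.comp (Ideal.Quotient.mkₐ ℝ I)
  refine ⟨ψ ∘ X, fun i => ?_⟩
  rw [← coe_aeval_eq_eval, RingHom.coe_coe, ← aeval_unique ψ]
  have : Ideal.Quotient.mkₐ ℝ I (F i) = 0 :=
    Ideal.Quotient.eq_zero_iff_mem.mpr (Ideal.subset_span ⟨i, rfl⟩)
  simp only [ψ, AlgHom.comp_apply, this, map_zero]

/-- A real polynomial system of degree at most `D`, with `D` odd, becomes solvable after arbitrarily
small perturbations by the powers `X i ^ D`. -/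
theorem exists_gt_exists_eval_add_eq_zero {D : ℕ} (hD : Odd D) (f : σ → MvPolynomial σ ℝ)
    (hf : ∀ i, (f i).totalDegree ≤ D) (r : ℝ) :
    ∃ s > r, ∃ x : σ → ℝ, ∀ i, x i ^ D + s * eval x (f i) = 0 := by
  obtain ⟨s, hs, hr⟩ := ((countable_setOf_not_bijective D f hf).dense_compl ℝ).exists_gt r
  rw [Set.mem_compl_iff, Set.mem_ofPred_eq, not_not] at hs
  obtain ⟨x, hx⟩ := exists_eval_eq_zero_of_bijective hD _ hs
  exact ⟨s, hr, x, fun i => by simpa using hx i⟩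
end

theorem totalDegree_aeval_le {σ τ R : Type*} [CommSemiring R] {D : ℕ}
    {p : MvPolynomial σ R} (hp : p.totalDegree ≤ D) {g : σ → MvPolynomial τ R}
    (hg : ∀ i, (g i).totalDegree ≤ 1) : (aeval g p).totalDegree ≤ D := by
  rw [aeval_def, eval₂_eq]
  refine totalDegree_finsetSum_le fun m hm => (totalDegree_mul _ _).trans ?_
  rw [algebraMap_eq, totalDegree_C, zero_add]
  refine ((totalDegree_finsetProd _ _).trans (Finset.sum_le_sum fun i _ => ?_)).trans
    ((le_totalDegree hm).trans hp)
  exact (totalDegree_pow _ _).trans (mul_le_of_le_one_right' (hg i))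

theorem MvPolynomial.IsHomogeneous.eval_smul {σ R : Type*} [CommSemiring R] {D : ℕ}
    {p : MvPolynomial σ R} (hp : p.IsHomogeneous D) (c : R) (x : σ → R) :
    eval (c • x) p = c ^ D * eval x p := by
  rw [eval_eq, eval_eq, Finset.mul_sum]
  refine Finset.sum_congr rfl fun m hm => ?_
  simp only [Pi.smul_apply, smul_eq_mul, mul_pow, Finset.prod_mul_distrib,
    Finset.prod_pow_eq_pow_sum]
  rw [hp.degree_eq_sum_deg_support hm]
  ring

/-- On the unit sphere, the odd part of a polynomial agrees with a form of odd degree. -/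
theorem exists_isHomogeneous_eval_eq_odd_part {σ : Type*} [Fintype σ] {D : ℕ} (hD : Odd D)
    (p : MvPolynomial σ ℝ) (hp : p.totalDegree ≤ D) :
    ∃ P : MvPolynomial σ ℝ, P.IsHomogeneous D ∧
      ∀ y : σ → ℝ, ∑ i, y i ^ 2 = 1 → eval y P = (eval y p - eval (-y) p) / 2 := by
  have hsum : p = ∑ k ∈ Finset.range (D + 1), homogeneousComponent k p := by
    conv_lhs => rw [← sum_homogeneousComponent p]
    refine Finset.sum_subset (Finset.range_mono (by omega)) fun k _ hk => ?_
    exact homogeneousComponent_eq_zero _ _ (by simpa using hk)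
  refine ⟨∑ k ∈ Finset.range (D + 1) with Odd k,
    homogeneousComponent k p * (∑ i, X i ^ 2) ^ ((D - k) / 2), ?_, fun y hy => ?_⟩
  · refine IsHomogeneous.sum _ _ _ fun k hk => ?_
    rw [Finset.mem_filter, Finset.mem_range] at hk
    have : D = k + 2 * ((D - k) / 2) := by grind
    conv => arg 2; rw [this]
    refine (homogeneousComponent_isHomogeneous k p).mul (IsHomogeneous.pow ?_ _)
    exact IsHomogeneous.sum _ _ _ fun i _ => isHomogeneous_X_pow i 2
  · have hev (z : σ → ℝ) : eval z p =
        ∑ k ∈ Finset.range (D + 1), eval z (homogeneousComponent k p) := by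
      conv_lhs => rw [hsum, map_sum]
    rw [hev, hev, ← Finset.sum_sub_distrib, Finset.sum_div, Finset.sum_filter, map_sum]
    refine Finset.sum_congr rfl fun k _ => ?_
    rw [← neg_one_smul ℝ y, (homogeneousComponent_isHomogeneous k p).eval_smul]
    split_ifs with hk
    · simp [hk.neg_one_pow, hy]
    · simp [(Nat.not_odd_iff_even.mp hk).neg_one_pow]

theorem exists_mvPolynomial_near_of_continuous {ι : Type*} [Fintype ι]
    (g : C(Metric.sphere (0 : EuclideanSpace ℝ ι) 1, ℝ)) {η : ℝ} (hη : 0 < η) :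
    ∃ p : MvPolynomial ι ℝ, ∀ y : Metric.sphere (0 : EuclideanSpace ℝ ι) 1,
      |eval y.1.ofLp p - g y| < η := by
  let x (i : ι) : C(Metric.sphere (0 : EuclideanSpace ℝ ι) 1, ℝ) :=
    ⟨fun y => y.1 i, by fun_prop⟩
  have hsep : (aeval (R := ℝ) x).range.SeparatesPoints := by
    intro y z hyz
    obtain ⟨i, hi⟩ : ∃ i, y.1 i ≠ z.1 i := by
      by_contra! h
      exact hyz (Subtype.ext (PiLp.ext h))
    exact ⟨x i, ⟨x i, ⟨X i, by simp⟩, rfl⟩, hi⟩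
  obtain ⟨⟨_, p, rfl⟩, hp⟩ :=
    ContinuousMap.exists_mem_subalgebra_near_continuousMap_of_separatesPoints _ hsep g η hη
  refine ⟨p, fun y => ?_⟩
  have := (ContinuousMap.norm_coe_le_norm _ y).trans_lt hp
  have hev : aeval x p y = eval y.1.ofLp p := by
    clear this hp
    induction p using MvPolynomial.induction_on with
    | C a => simp
    | add p q hp hq => simp [hp, hq]
    | mul_X p i hp => simp [hp, x]
  simpa [hev] using this

/-- **Borsuk–Ulam theorem for the ball**: if `f : ℝ^d → ℝ^d` is continuous on the closed
unit ball and odd on the boundary sphere, then `f` has a zero in the closed unit ball. -/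
theorem borsuk_ulam_ball (d : ℕ) (hd : 1 ≤ d)
    (f : EuclideanSpace ℝ (Fin d) → EuclideanSpace ℝ (Fin d))
    (hf : ContinuousOn f (Metric.closedBall 0 1))
    (hodd : ∀ x : EuclideanSpace ℝ (Fin d), ‖x‖ = 1 → f (-x) = -f x) :
    ∃ x ∈ Metric.closedBall (0 : EuclideanSpace ℝ (Fin d)) 1, f x = 0 := by
  by_contra! hne
  obtain ⟨x₀, hx₀, hmin⟩ := (isCompact_closedBall (0 : EuclideanSpace ℝ (Fin d)) 1).exists_isMinOn
    ⟨0, by simp⟩ (f := fun x => ‖(f x).ofLp‖) (by fun_prop)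
  set η := ‖(f x₀).ofLp‖ / 3 with hη_def
  have hη : 0 < η := by
    have : (f x₀).ofLp ≠ 0 := by simpa using hne x₀ hx₀
    positivity
  -- the odd extension of `f` to the sphere of dimension `d`, whose hemispheres project to the ball
  let t (y : EuclideanSpace ℝ (Fin (d + 1))) : EuclideanSpace ℝ (Fin d) :=
    WithLp.toLp 2 fun i => y i.succ
  have ht : Continuous t := by fun_prop
  have hnorm (y : EuclideanSpace ℝ (Fin (d + 1))) : ‖y‖ ^ 2 = y 0 ^ 2 + ‖t y‖ ^ 2 := by
    simp [EuclideanSpace.norm_sq_eq, Fin.sum_univ_succ, t]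
  have hball (y : Metric.sphere (0 : EuclideanSpace ℝ (Fin (d + 1))) 1) :
      t y ∈ Metric.closedBall (0 : EuclideanSpace ℝ (Fin d)) 1 := by
    have h1 := hnorm y.1
    rw [norm_eq_of_mem_sphere y] at h1
    rw [mem_closedBall_zero_iff]
    nlinarith [norm_nonneg (t y.1), sq_nonneg (y.1 0)]
  let g (y : Metric.sphere (0 : EuclideanSpace ℝ (Fin (d + 1))) 1) : EuclideanSpace ℝ (Fin d) :=
    if 0 ≤ y.1 0 then f (t y.1) else -f (-t y.1)
  have hg : Continuous g := by
    refine Continuous.if_le ?_ ?_ continuous_const (by fun_prop) fun y hy => ?_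
    · exact hf.comp_continuous (by fun_prop) hball
    · exact (hf.comp_continuous (f := fun y : Metric.sphere _ 1 => -t y.1) (by fun_prop)
        fun y => by simpa using hball y).neg
    · have h1 := hnorm y.1
      rw [norm_eq_of_mem_sphere y, ← hy] at h1
      rw [hodd _ (by nlinarith [norm_nonneg (t y.1)]), neg_neg]
  choose p hp using fun i : Fin d => exists_mvPolynomial_near_of_continuous
    ⟨fun y => g y i, by fun_prop⟩ hη
  let D := 2 * (Finset.univ.sup fun i => (p i).totalDegree) + 1
  have hD : Odd D := ⟨_, rfl⟩
  have hpD (i : Fin d) : (p i).totalDegree ≤ D := by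
    have := Finset.le_sup (f := fun i => (p i).totalDegree) (Finset.mem_univ i)
    grind
  choose P hP hPp using fun i => exists_isHomogeneous_eval_eq_odd_part hD (p i) (hpD i)
  have hPg (y : Metric.sphere (0 : EuclideanSpace ℝ (Fin (d + 1))) 1) (hy : 0 < y.1 0) (i : Fin d) :
      |eval y.1.ofLp (P i) - f (t y.1) i| < η := by
    have h1 : ∑ i, y.1 i ^ 2 = 1 := by
      have := EuclideanSpace.norm_sq_eq y.1
      rw [norm_eq_of_mem_sphere y] at this
      simpa using this.symm
    have ha := hp i y
    have hb := hp i (-y)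
    have hgy : g y = f (t y.1) := if_pos hy.le
    have htn : t (-y.1) = -t y.1 := by ext; simp [t]
    have hgn : g (-y) = -f (t y.1) := by
      have hy' : ¬ 0 ≤ (-y.1) 0 := by simpa using hy
      change (if 0 ≤ (-y.1) 0 then f (t (-y.1)) else -f (-t (-y.1))) = _
      rw [if_neg hy', htn, neg_neg]
    simp only [ContinuousMap.coe_mk, hgy, hgn] at ha hb
    rw [hPp i _ h1]
    simp only [abs_lt] at *
    simp at hb
    constructor <;> linarith
  obtain ⟨s, hs, x, hx⟩ := exists_gt_exists_eval_add_eq_zero hD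
    (fun i => aeval (Fin.cons 1 X : Fin (d + 1) → MvPolynomial (Fin d) ℝ) (P i))
    (fun i => totalDegree_aeval_le (hP i).totalDegree_le fun j => by
      cases j using Fin.cases <;> simp) η⁻¹
  let z : EuclideanSpace ℝ (Fin (d + 1)) := WithLp.toLp 2 (Fin.cons 1 x)
  have hz : z ≠ 0 := fun h => by simpa [z] using congrArg (fun v => v.ofLp 0) h
  let y : Metric.sphere (0 : EuclideanSpace ℝ (Fin (d + 1))) 1 :=
    ⟨‖z‖⁻¹ • z, by simp [norm_smul, hz]⟩
  have hy0 : 0 < y.1 0 := by simpa [y, z] using hz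
  have hsmall (i : Fin d) : |eval y.1.ofLp (P i)| ≤ η := by
    have hzx : eval z.ofLp (P i) =
        eval x (aeval (Fin.cons 1 X : Fin (d + 1) → MvPolynomial (Fin d) ℝ) (P i)) := by
      rw [← coe_aeval_eq_eval x, RingHom.coe_coe, comp_aeval_apply, ← coe_aeval_eq_eval,
        RingHom.coe_coe]
      congr 2
      funext j
      cases j using Fin.cases <;> simp [z]
    have h1 : s * eval y.1.ofLp (P i) = -(y.1 i.succ) ^ D := by
      have : y.1.ofLp = ‖z‖⁻¹ • z.ofLp := rfl
      rw [this, (hP i).eval_smul, hzx]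
      simp only [Pi.smul_apply, smul_eq_mul, mul_pow]
      have : z.ofLp i.succ = x i := by simp [z]
      rw [this]
      linear_combination (‖z‖⁻¹) ^ D * hx i
    have h2 : |y.1 i.succ| ≤ 1 := by
      have := PiLp.norm_apply_le y.1 i.succ
      rwa [norm_eq_of_mem_sphere y] at this
    have h3 : |s * eval y.1.ofLp (P i)| ≤ 1 := by
      rw [h1, abs_neg, abs_pow]
      exact pow_le_one₀ (abs_nonneg _) h2
    rw [abs_mul, abs_of_pos ((inv_pos.mpr hη).trans hs)] at h3
    have h4 := (mul_le_mul_of_nonneg_right hs.le (abs_nonneg _)).trans h3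
    rwa [inv_mul_le_one₀ hη] at h4
  have hle : ‖(f (t y.1)).ofLp‖ ≤ 2 * η := by
    refine (pi_norm_le_iff_of_nonneg (by positivity)).mpr fun i => ?_
    have h1 := hPg y hy0 i
    have h2 := hsmall i
    rw [Real.norm_eq_abs]
    rw [abs_lt] at h1
    rw [abs_le] at h2 ⊢
    constructor <;> linarith
  have hge : ‖(f x₀).ofLp‖ ≤ ‖(f (t y.1)).ofLp‖ := hmin (hball y)
  linarith
end

section
/- Let d ≥ 1 and let G be a nontrivial finite group equipped with (i) a continuous free action on the unit sphere subtype ↥(Metric.sphere (0 : EuclideanSpace ℝ (Fin d)) 1), and (ii) a continuous action on EuclideanSpace ℝ (Fin d) which fixes the origin (g • 0 = 0 for all g) and is free on nonzero vectors (for g ≠ 1 and x ≠ 0 one has g • x ≠ x), i.e. a semifree action with unique fixed point 0. If f : EuclideanSpace ℝ (Fin d) → EuclideanSpace ℝ (Fin d) is continuous on the closed unit ball Metric.closedBall 0 1 and is equivariant on the boundary, i.e. f(↑(g • x)) = g • f(↑x) for every g ∈ G and every point x of the unit sphere subtype, then there exists x ∈ Metric.closedBall 0 1 with f(x) = 0.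 -/
namespace ListChain

open Finsupp

variable {R : Type*} [CommRing R]

section Chains

variable {X Y : Type*}

/-- Prepend a vertex to every list of a chain. -/
noncomputable def cone (x : X) : (List X →₀ R) →ₗ[R] (List X →₀ R) :=
  lmapDomain R R (List.cons x)

/-- The augmented boundary of a single list. -/
noncomputable def bdryList : List X → (List X →₀ R)
  | [] => 0
  | x :: l => single l 1 - cone x (bdryList l)

/-- The boundary operator of the augmented complex of ordered chains. -/
noncomputable def bdry : (List X →₀ R) →ₗ[R] (List X →₀ R) :=
  linearCombination R bdryList

/-- The map on chains induced by a map of vertices. -/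
noncomputable def push (f : X → Y) : (List X →₀ R) →ₗ[R] (List Y →₀ R) :=
  lmapDomain R R (List.map f)

/-- The chains all of whose lists satisfy `P`. -/
noncomputable def carried (R : Type*) [CommRing R] {X : Type*} (P : List X → Prop) :
    Submodule R (List X →₀ R) :=
  supported R R {l | P l}

@[simp] lemma cone_single (x : X) (l : List X) (r : R) :
    cone x (single l r) = single (x :: l) r := by
  simp [cone, lmapDomain_apply, mapDomain_single]

@[simp] lemma push_single (f : X → Y) (l : List X) (r : R) :
    push f (single l r) = single (l.map f) r := by
  simp [push, lmapDomain_apply, mapDomain_single]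

@[simp] lemma bdry_single (l : List X) (r : R) : bdry (single l r) = r • bdryList l := by
  simp [bdry]

lemma bdry_cone (x : X) (c : List X →₀ R) : bdry (cone x c) = c - cone x (bdry c) := by
  induction c using Finsupp.induction_linear with
  | zero => simp
  | add f g hf hg => simp only [map_add, hf, hg]; abel
  | single l r => simp [bdryList, smul_sub]

lemma bdry_bdryList (l : List X) : bdry (bdryList l : List X →₀ R) = 0 := by
  induction l with
  | nil => simp [bdryList]
  | cons x l ih => simp [bdryList, bdry_cone, ih]

lemma bdry_bdry (c : List X →₀ R) : bdry (bdry c) = 0 := by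
  induction c using Finsupp.induction_linear with
  | zero => simp
  | add f g hf hg => simp only [map_add, hf, hg, add_zero]
  | single l r => simp [bdry_bdryList]

lemma push_cone (f : X → Y) (x : X) (c : List X →₀ R) :
    push f (cone x c) = cone (f x) (push f c) := by
  induction c using Finsupp.induction_linear with
  | zero => simp
  | add g h hg hh => simp only [map_add, hg, hh]
  | single l r => simp

lemma bdryList_map (f : X → Y) (l : List X) :
    (bdryList (l.map f) : List Y →₀ R) = push f (bdryList l) := by
  induction l with
  | nil => simp [bdryList]
  | cons x l ih => simp [bdryList, push_cone, ih]

lemma bdry_push (f : X → Y) (c : List X →₀ R) : bdry (push f c) = push f (bdry c) := by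
  induction c using Finsupp.induction_linear with
  | zero => simp
  | add g h hg hh => simp only [map_add, hg, hh]
  | single l r => simp [bdryList_map]

lemma push_push {Z : Type*} (f : X → Y) (g : Y → Z) (c : List X →₀ R) :
    push g (push f c) = push (g ∘ f) c := by
  induction c using Finsupp.induction_linear with
  | zero => simp
  | add u v hu hv => simp only [map_add, hu, hv]
  | single l r => simp

lemma push_id (c : List X →₀ R) : push id c = c := by
  induction c using Finsupp.induction_linear with
  | zero => simp
  | add u v hu hv => simp only [map_add, hu, hv]
  | single l r => simp

lemma single_mem_carried {P : List X → Prop} {l : List X} (h : P l) (r : R) :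
    single l r ∈ carried R P :=
  single_mem_supported R r h

lemma prop_of_mem_carried {P : List X → Prop} {c : List X →₀ R} (h : c ∈ carried R P)
    {l : List X} (hl : l ∈ c.support) : P l :=
  (mem_supported R c).1 h hl

lemma carried_mono {P Q : List X → Prop} (h : ∀ l, P l → Q l) : carried R P ≤ carried R Q :=
  supported_mono h

lemma mem_carried_and {P Q : List X → Prop} {c : List X →₀ R} (hP : c ∈ carried R P)
    (hQ : c ∈ carried R Q) : c ∈ carried R (fun l => P l ∧ Q l) :=
  (mem_supported R c).2 fun _ hl => ⟨prop_of_mem_carried hP hl, prop_of_mem_carried hQ hl⟩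

/-- A linear map sends carried chains to a submodule if it does so on lists. -/
lemma map_mem_of_carried {M : Type*} [AddCommGroup M] [Module R M] {P : List X → Prop}
    (T : (List X →₀ R) →ₗ[R] M) (N : Submodule R M)
    (h : ∀ l, P l → T (single l 1) ∈ N) {c : List X →₀ R} (hc : c ∈ carried R P) :
    T c ∈ N := by
  have : carried R P ≤ N.comap T := by
    rw [carried, supported_eq_span_single, Submodule.span_le]
    rintro _ ⟨l, hl, rfl⟩
    exact h l hl
  exact this hc

/-- Two linear maps agreeing on the lists satisfying `P` agree on the chains carried by `P`. -/
lemma eq_of_carried {M : Type*} [AddCommGroup M] [Module R M] {P : List X → Prop}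
    (S T : (List X →₀ R) →ₗ[R] M) (h : ∀ l, P l → S (single l 1) = T (single l 1))
    {c : List X →₀ R} (hc : c ∈ carried R P) : S c = T c := by
  have := map_mem_of_carried (S - T) ⊥ (fun l hl => by simp [h l hl]) hc
  simpa [sub_eq_zero] using this

lemma cone_mem_carried {P Q : List X → Prop} {x : X} (h : ∀ l, P l → Q (x :: l))
    {c : List X →₀ R} (hc : c ∈ carried R P) : cone x c ∈ carried R Q :=
  map_mem_of_carried _ _ (fun l hl => by simpa using single_mem_carried (h l hl) 1) hc

lemma push_mem_carried {P : List X → Prop} {Q : List Y → Prop} {f : X → Y}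
    (h : ∀ l, P l → Q (l.map f)) {c : List X →₀ R} (hc : c ∈ carried R P) :
    push f c ∈ carried R Q :=
  map_mem_of_carried _ _ (fun l hl => by simpa using single_mem_carried (h l hl) 1) hc

lemma bdryList_mem (l : List X) :
    (bdryList l : List X →₀ R) ∈
      carried R (fun l' => l'.length + 1 = l.length ∧ ∀ x ∈ l', x ∈ l) := by
  induction l with
  | nil => simp [bdryList]
  | cons x l ih =>
    refine Submodule.sub_mem _
      (single_mem_carried ⟨by simp, fun y hy => List.mem_cons_of_mem _ hy⟩ 1)
      (cone_mem_carried ?_ ih)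
    · rintro l' ⟨h1, h2⟩
      refine ⟨by simp [h1], ?_⟩
      intro y hy
      rcases List.mem_cons.1 hy with rfl | hy
      · simp
      · exact List.mem_cons_of_mem _ (h2 y hy)

lemma bdry_mem_carried {P Q : List X → Prop}
    (h : ∀ l l', P l → l'.length + 1 = l.length → (∀ x ∈ l', x ∈ l) → Q l')
    {c : List X →₀ R} (hc : c ∈ carried R P) : bdry c ∈ carried R Q :=
  map_mem_of_carried _ _ (fun l hl => by
    simpa using carried_mono (fun l' hl' => h l l' hl hl'.1 hl'.2) (bdryList_mem l)) hc

/-- The prism operator between two maps of vertices, on a single list. -/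
noncomputable def prismList (f g : X → Y) : List X → (List Y →₀ R)
  | [] => 0
  | x :: l => single (f x :: g x :: l.map g) 1 - cone (f x) (prismList f g l)

/-- The prism operator between two maps of vertices. -/
noncomputable def prism (f g : X → Y) : (List X →₀ R) →ₗ[R] (List Y →₀ R) :=
  linearCombination R (prismList f g)

@[simp] lemma prism_single (f g : X → Y) (l : List X) (r : R) :
    prism f g (single l r) = r • prismList f g l := by
  simp [prism]

lemma prism_cone (f g : X → Y) (x : X) (c : List X →₀ R) :
    prism f g (cone x c) = cone (f x) (cone (g x) (push g c)) - cone (f x) (prism f g c) := by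
  induction c using Finsupp.induction_linear with
  | zero => simp
  | add u v hu hv => simp only [map_add, hu, hv]; abel
  | single l r => simp [prismList, smul_sub]

lemma bdry_prismList (f g : X → Y) (l : List X) :
    bdry (prismList f g l : List Y →₀ R) + prism f g (bdryList l) =
      single (l.map g) 1 - single (l.map f) 1 := by
  induction l with
  | nil => simp [prismList, bdryList]
  | cons x l ih =>
    have ih' := eq_sub_of_add_eq ih
    simp only [prismList, bdryList, map_sub, bdry_single, bdry_cone, one_smul, prism_single,
      prism_cone, ih', cone_single, bdryList_map, List.map_cons]
    abel

lemma bdry_prism (f g : X → Y) (c : List X →₀ R) :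
    bdry (prism f g c) + prism f g (bdry c) = push g c - push f c := by
  induction c using Finsupp.induction_linear with
  | zero => simp
  | add u v hu hv =>
    simp only [map_add]
    rw [add_sub_add_comm, ← hu, ← hv]; abel
  | single l r =>
    have := congrArg (fun z => r • z) (bdry_prismList (R := R) f g l)
    simpa [smul_sub] using this

lemma prismList_mem (f g : X → Y) (l : List X) :
    (prismList f g l : List Y →₀ R) ∈ carried R (fun l' => l'.length = l.length + 1 ∧
      ∀ y ∈ l', ∃ x ∈ l, y = f x ∨ y = g x) := by
  induction l with
  | nil => simp [prismList]
  | cons x l ih =>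
    refine Submodule.sub_mem _ (single_mem_carried ?_ 1) (cone_mem_carried ?_ ih)
    · refine ⟨by simp, fun y hy => ?_⟩
      simp only [List.mem_cons, List.mem_map] at hy
      rcases hy with rfl | rfl | ⟨z, hz, rfl⟩
      · exact ⟨x, by simp⟩
      · exact ⟨x, by simp⟩
      · exact ⟨z, by simp [hz]⟩
    · rintro l' ⟨h1, h2⟩
      refine ⟨by simp [h1], ?_⟩
      intro y hy
      rcases List.mem_cons.1 hy with rfl | hy
      · exact ⟨x, by simp⟩
      · obtain ⟨z, hz, h⟩ := h2 y hy
        exact ⟨z, List.mem_cons_of_mem _ hz, h⟩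

lemma prism_mem_carried {P : List X → Prop} {Q : List Y → Prop} {f g : X → Y}
    (h : ∀ l l', P l → l'.length = l.length + 1 → (∀ y ∈ l', ∃ x ∈ l, y = f x ∨ y = g x) → Q l')
    {c : List X →₀ R} (hc : c ∈ carried R P) : prism f g c ∈ carried R Q :=
  map_mem_of_carried _ _ (fun l hl => by
    simpa using carried_mono (fun l' hl' => h l l' hl hl'.1 hl'.2) (prismList_mem f g l)) hc

/-- Lists of signed indices with indices in `s` and no antipodal pair: the ordered simplices of
the boundary of the cross-polytope on `s`. -/
def CrossSimplex {ι : Type*} (s : Finset ι) (l : List (ι × Bool)) : Prop :=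
  (∀ v ∈ l, v.1 ∈ s) ∧ ∀ i, ¬ ((i, true) ∈ l ∧ (i, false) ∈ l)

/-- The boundary of the cross-polytope on `s` has reduced homology only in chains of lists of
length `s.card`. -/
lemma exists_bdry_eq_crossSimplex {ι : Type*} [DecidableEq ι] (s : Finset ι) :
    ∀ (n : ℕ), n ≠ s.card → ∀ z ∈ carried R (fun l => l.length = n ∧ CrossSimplex s l),
      bdry z = 0 → ∃ y ∈ carried R (fun l => l.length = n + 1 ∧ CrossSimplex s l), bdry y = z := by
  classical
  induction s using Finset.induction_on with
  | empty =>
    intro n hn z hz _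
    have : z = 0 := by
      have h0 : carried R (fun l : List (ι × Bool) => l.length = n ∧ CrossSimplex ∅ l) ≤ ⊥ := by
        rw [carried, supported_eq_span_single, Submodule.span_le]
        rintro _ ⟨l, ⟨hl, hl', -⟩, rfl⟩
        cases l with
        | nil => simp at hl hn; omega
        | cons v l => simpa using hl' v (by simp)
      simpa using h0 hz
    exact ⟨0, Submodule.zero_mem _, by simp [this]⟩
  | insert i s hi ih =>
    intro n hn z hz hbz
    have cone_ok : ∀ (b : Bool) (c : List (ι × Bool) →₀ R),
        c ∈ carried R (fun l => l.length = n ∧ CrossSimplex (insert i s) l ∧ (i, !b) ∉ l) →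
        cone (i, b) c ∈ carried R (fun l => l.length = n + 1 ∧ CrossSimplex (insert i s) l) := by
      intro b c hc
      refine cone_mem_carried ?_ hc
      rintro l ⟨h1, ⟨h2, h3⟩, h4⟩
      refine ⟨by simp [h1], ?_, ?_⟩
      · intro v hv
        rcases List.mem_cons.1 hv with rfl | hv
        · simp
        · exact h2 v hv
      · intro j hj
        have := h3 j
        cases b <;> simp only [List.mem_cons, Prod.mk.injEq] at hj <;> simp at h4 hj <;> grind
    cases n with
    | zero =>
      refine ⟨cone (i, true) z, cone_ok _ _ (carried_mono ?_ hz), by simp [bdry_cone, hbz]⟩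
      rintro l ⟨h1, h2⟩
      refine ⟨h1, h2, ?_⟩
      have := List.length_eq_zero_iff.1 h1
      simp [this]
    | succ k =>
      set zp := z.filter (fun l => (i, true) ∈ l) with hzp
      set zm := z.filter (fun l => ¬ (i, true) ∈ l) with hzm
      have hsum : zp + zm = z := filter_add_filter_not z _
      have hzp' : zp ∈ carried R (fun l => l.length = k + 1 ∧ CrossSimplex (insert i s) l ∧
          (i, true) ∈ l ∧ (i, false) ∉ l) := by
        refine (mem_supported R _).2 fun l hl => ?_
        rw [Finset.mem_coe, hzp, support_filter, Finset.mem_filter] at hl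
        obtain ⟨h1, h2⟩ := prop_of_mem_carried hz hl.1
        exact ⟨h1, h2, hl.2, fun h => h2.2 i ⟨hl.2, h⟩⟩
      have hzm' : zm ∈ carried R (fun l => l.length = k + 1 ∧ CrossSimplex (insert i s) l ∧
          (i, true) ∉ l) := by
        refine (mem_supported R _).2 fun l hl => ?_
        rw [Finset.mem_coe, hzm, support_filter, Finset.mem_filter] at hl
        obtain ⟨h1, h2⟩ := prop_of_mem_carried hz hl.1
        exact ⟨h1, h2, hl.2⟩
      have hb1 : bdry zp ∈ carried R (fun l => l.length = k ∧ CrossSimplex (insert i s) l ∧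
          (i, false) ∉ l) := by
        refine bdry_mem_carried ?_ hzp'
        rintro l l' ⟨h1, ⟨h2, h3⟩, h4, h5⟩ h6 h7
        exact ⟨by omega, ⟨fun v hv => h2 v (h7 v hv), fun j hj => h3 j ⟨h7 _ hj.1, h7 _ hj.2⟩⟩,
          fun h => h5 (h7 _ h)⟩
      have hb2 : bdry zp ∈ carried R (fun l => (i, true) ∉ l) := by
        have : bdry zp = - bdry zm := by
          rw [eq_neg_iff_add_eq_zero, ← map_add, hsum, hbz]
        rw [this]
        refine Submodule.neg_mem _ (bdry_mem_carried ?_ hzm')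
        rintro l l' ⟨h1, h2, h3⟩ h6 h7 h
        exact h3 (h7 _ h)
      obtain ⟨w, hw, hbw⟩ := ih k (by rw [Finset.card_insert_of_notMem hi] at hn; omega) (bdry zp)
        (carried_mono (by
          rintro l ⟨⟨h1, ⟨h2, h3⟩, h4⟩, h5⟩
          refine ⟨h1, fun v hv => ?_, h3⟩
          rcases Finset.mem_insert.1 (h2 v hv) with h | h
          · obtain ⟨a, b⟩ := v
            simp only at h
            subst h
            cases b
            · exact absurd hv h4
            · exact absurd hv h5
          · exact h) (mem_carried_and hb1 hb2)) (bdry_bdry _)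
      have hw' : ∀ b, w ∈ carried R (fun l => l.length = k + 1 ∧ CrossSimplex (insert i s) l ∧
          (i, !b) ∉ l) := by
        intro b
        refine carried_mono ?_ hw
        rintro l ⟨h1, h2, h3⟩
        exact ⟨h1, ⟨fun v hv => Finset.mem_insert_of_mem (h2 v hv), h3⟩, fun h => hi (h2 _ h)⟩
      refine ⟨cone (i, true) (zp - w) + cone (i, false) (zm + w), Submodule.add_mem _
        (cone_ok _ _ (Submodule.sub_mem _ (carried_mono ?_ hzp') (hw' _)))
        (cone_ok _ _ (Submodule.add_mem _ (carried_mono ?_ hzm') (hw' _))), ?_⟩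
      · rintro l ⟨h1, h2, h3, h4⟩; exact ⟨h1, h2, h4⟩
      · rintro l ⟨h1, h2, h3⟩; exact ⟨h1, h2, h3⟩
      · have h1 : bdry zm + bdry w = 0 := by rw [hbw, ← map_add, add_comm, hsum, hbz]
        have h2 : bdry zm = - bdry zp := by rw [← hbw]; exact eq_neg_of_add_eq_zero_left h1
        simp only [map_add, bdry_cone, map_sub, hbw, h2, map_neg, ← hsum]
        abel

end Chains

section Subdivision

variable {E : Type*} [NormedAddCommGroup E] [NormedSpace ℝ E]

/-- The barycentre of a list of points. -/
noncomputable def barycentre (l : List E) : E := (l.length : ℝ)⁻¹ • l.sum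

lemma barycentre_mem {l : List E} (hl : l ≠ []) {V : Set E} (hV : Convex ℝ V)
    (h : ∀ x ∈ l, x ∈ V) : barycentre l ∈ V := by
  have hpos : (0 : ℝ) < l.length := by exact_mod_cast List.length_pos_iff.2 hl
  have hsum : l.sum = ∑ i : Fin l.length, l[i] := by
    rw [← List.sum_ofFn]; simp
  rw [barycentre, hsum, Finset.smul_sum]
  refine hV.sum_mem (fun _ _ => by positivity) ?_ (fun i _ => h _ (by simp))
  simp [hpos.ne']

lemma dist_barycentre_le {l : List E} {K : ℕ} (hK : l.length ≤ K) {D : ℝ} (hD : 0 ≤ D)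
    (h : ∀ x ∈ l, ∀ y ∈ l, dist x y ≤ D) {v : E} (hv : v ∈ l) :
    dist (barycentre l) v ≤ (1 - (K : ℝ)⁻¹) * D := by
  have hpos : (0 : ℝ) < l.length := by
    exact_mod_cast List.length_pos_iff.2 (List.ne_nil_of_mem hv)
  obtain ⟨j, hj, rfl⟩ := List.getElem_of_mem hv
  have hsum : l.sum = ∑ i : Fin l.length, l[i] := by
    rw [← List.sum_ofFn]; simp
  have h1 : barycentre l - l[j] = (l.length : ℝ)⁻¹ • ∑ i : Fin l.length, (l[i] - l[j]) := by
    rw [barycentre, Finset.sum_sub_distrib, ← hsum, smul_sub]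
    simp [← Nat.cast_smul_eq_nsmul ℝ, smul_smul, hpos.ne']
  have h2 : ‖∑ i : Fin l.length, (l[i] - l[j])‖ ≤ (l.length - 1) * D := by
    rw [← Finset.add_sum_erase _ _ (Finset.mem_univ (⟨j, hj⟩ : Fin l.length))]
    have h3 := norm_sum_le_of_le (Finset.univ.erase (⟨j, hj⟩ : Fin l.length))
      (f := fun i => l[i] - l[j]) (n := fun _ => D) (fun i _ => by
        rw [← dist_eq_norm]; exact h _ (by simp) _ hv)
    have h4 : ((Finset.univ.erase (⟨j, hj⟩ : Fin l.length)).card : ℝ) = l.length - 1 := by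
      rw [Finset.card_erase_of_mem (Finset.mem_univ _)]
      simp [Nat.cast_sub (Nat.one_le_of_lt (lt_of_le_of_lt (Nat.zero_le j) hj))]
    rw [Finset.sum_const, nsmul_eq_mul, h4] at h3
    rwa [show l[(⟨j, hj⟩ : Fin l.length)] - l[j] = 0 from sub_self _, zero_add]
  have h5 : (K : ℝ)⁻¹ ≤ (l.length : ℝ)⁻¹ := by gcongr
  calc dist (barycentre l) l[j] = (l.length : ℝ)⁻¹ * ‖∑ i : Fin l.length, (l[i] - l[j])‖ := by
        rw [dist_eq_norm, h1, norm_smul]; simp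
    _ ≤ (l.length : ℝ)⁻¹ * ((l.length - 1) * D) := by gcongr
    _ = (1 - (l.length : ℝ)⁻¹) * D := by field_simp
    _ ≤ _ := by gcongr

/-- Barycentric subdivision of chains of lists of length `k`. -/
noncomputable def sd : ℕ → (List E →₀ R) →ₗ[R] (List E →₀ R)
  | 0 => LinearMap.id
  | k + 1 => linearCombination R (fun l => cone (barycentre l) (sd k (bdryList l)))

/-- The homotopy between the identity and barycentric subdivision, on lists of length `k`. -/
noncomputable def sdHomotopy : ℕ → (List E →₀ R) →ₗ[R] (List E →₀ R)
  | 0 => 0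
  | k + 1 => linearCombination R
      (fun l => cone (barycentre l) (single l 1 - sdHomotopy k (bdryList l)))

lemma bdryList_mem_length {X : Type*} {k : ℕ} {l : List X} (hl : l.length = k + 1) :
    (bdryList l : List X →₀ R) ∈ carried R (fun l' => l'.length = k) :=
  carried_mono (fun _ h => by omega) (bdryList_mem l)

lemma bdry_sd (k : ℕ) : ∀ c ∈ carried R (fun l : List E => l.length = k + 1),
    bdry (sd (k + 1) c) = sd k (bdry c) := by
  induction k with
  | zero =>
    intro c hc
    refine eq_of_carried (bdry ∘ₗ sd 1) (sd 0 ∘ₗ bdry) (fun l _ => ?_) hc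
    simp [sd, bdry_cone, bdry_bdryList]
  | succ k ih =>
    intro c hc
    refine eq_of_carried (bdry ∘ₗ sd (k + 2)) (sd (k + 1) ∘ₗ bdry) (fun l hl => ?_) hc
    have := ih _ (bdryList_mem_length hl)
    rw [bdry_bdryList, map_zero] at this
    rw [LinearMap.comp_apply, LinearMap.comp_apply, bdry_single, one_smul, sd,
      linearCombination_single, one_smul, bdry_cone, this, map_zero, sub_zero]

lemma bdry_sdHomotopy_add (k : ℕ) : ∀ c ∈ carried R (fun l : List E => l.length = k + 1),
    bdry (sdHomotopy (k + 1) c) + sdHomotopy k (bdry c) = c - sd (k + 1) c := by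
  induction k with
  | zero =>
    intro c hc
    refine eq_of_carried (bdry ∘ₗ sdHomotopy 1 + sdHomotopy 0 ∘ₗ bdry) (LinearMap.id - sd 1)
      (fun l _ => ?_) hc
    simp [sd, sdHomotopy, bdryList]
  | succ k ih =>
    intro c hc
    refine eq_of_carried (bdry ∘ₗ sdHomotopy (k + 2) + sdHomotopy (k + 1) ∘ₗ bdry)
      (LinearMap.id - sd (k + 2)) (fun l hl => ?_) hc
    have := ih _ (bdryList_mem_length hl)
    rw [bdry_bdryList, map_zero, add_zero] at this
    simp only [LinearMap.add_apply, LinearMap.sub_apply, LinearMap.comp_apply, LinearMap.id_apply,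
      bdry_single, one_smul]
    rw [sd, sdHomotopy, linearCombination_single, linearCombination_single, one_smul, one_smul,
      bdry_cone, map_sub, this, bdry_single, one_smul, sub_sub_cancel]
    abel

lemma bdry_sdHomotopy (k : ℕ) {c : List E →₀ R} (hc : c ∈ carried R (fun l => l.length = k))
    (hb : bdry c = 0) : bdry (sdHomotopy k c) = c - sd k c := by
  cases k with
  | zero => simp [sd, sdHomotopy]
  | succ k => simpa [hb] using bdry_sdHomotopy_add k c hc

lemma sd_single_mem {K : ℕ} {D : ℝ} (hD : 0 ≤ D) {V : Set E} (hV : Convex ℝ V) (k : ℕ) :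
    ∀ l : List E, l.length = k → k ≤ K → (∀ x ∈ l, ∀ y ∈ l, dist x y ≤ D) → (∀ x ∈ l, x ∈ V) →
    sd k (single l (1 : R)) ∈ carried R (fun l' : List E => l'.length = k ∧
      (∀ x ∈ l', ∀ y ∈ l', dist x y ≤ (1 - (K : ℝ)⁻¹) * D) ∧ ∀ x ∈ l', x ∈ V) := by
  induction k generalizing V with
  | zero =>
    intro l hl _ _ _
    obtain rfl := List.length_eq_zero_iff.1 hl
    simpa [sd] using single_mem_carried (by simp) 1
  | succ k ih =>
    intro l hl hk hd hlV
    have hne : l ≠ [] := by rintro rfl; simp at hl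
    set V' := V ∩ Metric.closedBall (barycentre l) ((1 - (K : ℝ)⁻¹) * D) with hV'
    have hcV' : Convex ℝ V' := hV.inter (convex_closedBall _ _)
    have hlV' : ∀ x ∈ l, x ∈ V' := fun x hx => ⟨hlV x hx, by
      rw [Metric.mem_closedBall, dist_comm]
      exact dist_barycentre_le (by omega) hD hd hx⟩
    have h1 : sd k (bdryList l) ∈ carried R (fun l' : List E => l'.length = k ∧
      (∀ x ∈ l', ∀ y ∈ l', dist x y ≤ (1 - (K : ℝ)⁻¹) * D) ∧ ∀ x ∈ l', x ∈ V') := by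
      refine map_mem_of_carried _ _ (fun l' hl' => ?_) (bdryList_mem l)
      exact ih hcV' l' (by omega) (by omega)
        (fun x hx y hy => hd x (hl'.2 x hx) y (hl'.2 y hy)) (fun x hx => hlV' x (hl'.2 x hx))
    rw [sd, linearCombination_single, one_smul]
    refine cone_mem_carried ?_ h1
    rintro l' ⟨h2, h3, h4⟩
    have hq : 0 ≤ (1 - (K : ℝ)⁻¹) * D := by
      have : (K : ℝ)⁻¹ ≤ 1 := inv_le_one_of_one_le₀ (by exact_mod_cast (by omega : 1 ≤ K))
      have : 0 ≤ 1 - (K : ℝ)⁻¹ := by linarith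
      positivity
    refine ⟨by simp [h2], fun x hx y hy => ?_, fun x hx => ?_⟩
    · rcases List.mem_cons.1 hx with rfl | hx <;> rcases List.mem_cons.1 hy with rfl | hy
      · simpa using hq
      · rw [dist_comm]; exact (h4 y hy).2
      · exact (h4 x hx).2
      · exact h3 x hx y hy
    · rcases List.mem_cons.1 hx with rfl | hx
      · exact barycentre_mem hne hV hlV
      · exact (h4 x hx).1

lemma sdHomotopy_single_mem {V : Set E} (hV : Convex ℝ V) (k : ℕ) :
    ∀ l : List E, l.length = k → (∀ x ∈ l, x ∈ V) →
    sdHomotopy k (single l (1 : R)) ∈ carried R (fun l' : List E => l'.length = k + 1 ∧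
      ∀ x ∈ l', x ∈ V) := by
  induction k with
  | zero => intro l _ _; simp [sdHomotopy]
  | succ k ih =>
    intro l hl hlV
    have hne : l ≠ [] := by rintro rfl; simp at hl
    rw [sdHomotopy, linearCombination_single, one_smul]
    refine cone_mem_carried (P := fun l' : List E => l'.length = k + 1 ∧ ∀ x ∈ l', x ∈ V) ?_
      (Submodule.sub_mem _ (single_mem_carried ⟨hl, hlV⟩ 1)
        (map_mem_of_carried _ _ (fun l' hl' => ?_) (bdryList_mem l)))
    · rintro l' ⟨h1, h2⟩
      refine ⟨by simp [h1], fun x hx => ?_⟩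
      rcases List.mem_cons.1 hx with rfl | hx
      · exact barycentre_mem hne hV hlV
      · exact h2 x hx
    · exact ih l' (by omega) (fun x hx => hlV x (hl'.2 x hx))

end Subdivision

/-- A list is small for a predicate on sets if it is contained in a set satisfying it. -/
def Small {X : Type*} (U : Set X → Prop) (l : List X) : Prop :=
  ∃ s, U s ∧ ∀ x ∈ l, x ∈ s

/-- Every point of `Ω` has a neighbourhood satisfying `U`. -/
def IsNhdCover {X : Type*} [TopologicalSpace X] (U : Set X → Prop) (Ω : Set X) : Prop :=
  ∀ x ∈ Ω, ∃ s ∈ nhds x, U s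

section Filling

variable {E : Type*} [NormedAddCommGroup E] [NormedSpace ℝ E]

/-- The boundary of a chain can be filled by arbitrarily fine chains, up to chains as small as
the boundary itself. -/
lemma exists_fine_filling (U : Set E → Prop) (hU : ∀ s, U s → Convex ℝ s) (n : ℕ)
    {y : List E →₀ R} (hy : y ∈ carried R (fun l => l.length = n + 1))
    (hby : bdry y ∈ carried R (Small U)) {D : ℝ} (hD : 0 ≤ D)
    (hdiam : ∀ l ∈ y.support, ∀ a ∈ l, ∀ b ∈ l, dist a b ≤ D) (j : ℕ) :
    ∃ u w : List E →₀ R,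
      u ∈ carried R (fun l => l.length = n + 1 ∧
        (∀ a ∈ l, ∀ b ∈ l, dist a b ≤ (1 - ((n + 1 : ℕ) : ℝ)⁻¹) ^ j * D) ∧
        ∃ l₀ ∈ y.support, ∀ a ∈ l, a ∈ convexHull ℝ {b | b ∈ l₀}) ∧
      w ∈ carried R (fun l => l.length = n + 1 ∧ Small U l) ∧
      bdry u ∈ carried R (Small U) ∧ bdry (u + w) = bdry y := by
  induction j with
  | zero =>
    refine ⟨y, 0, (mem_supported R _).2 fun l hl => ?_, Submodule.zero_mem _, hby, by simp⟩
    exact ⟨prop_of_mem_carried hy hl, by simpa using hdiam l hl,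
      l, hl, fun a ha => subset_convexHull ℝ _ ha⟩
  | succ j ih =>
    obtain ⟨u, w, hu, hw, hbu, huw⟩ := ih
    have hul : u ∈ carried R (fun l => l.length = n + 1) := carried_mono (fun l h => h.1) hu
    have hbul : bdry u ∈ carried R (fun l => l.length = n) :=
      bdry_mem_carried (fun l l' h1 h2 _ => by omega) hul
    have hq : (0 : ℝ) ≤ 1 - ((n + 1 : ℕ) : ℝ)⁻¹ := by
      have : (((n + 1 : ℕ) : ℝ))⁻¹ ≤ 1 :=
        inv_le_one_of_one_le₀ (by exact_mod_cast (by omega : 1 ≤ n + 1))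
      linarith
    refine ⟨sd (n + 1) u, w + sdHomotopy n (bdry u), ?_, Submodule.add_mem _ hw ?_, ?_, ?_⟩
    · refine map_mem_of_carried _ _ (fun l hl => ?_) hu
      obtain ⟨h1, h2, l₀, h3, h4⟩ := hl
      refine carried_mono ?_ (sd_single_mem (K := n + 1) (by positivity) (convex_convexHull ℝ _)
        (n + 1) l h1 le_rfl h2 h4)
      rintro l' ⟨h5, h6, h7⟩
      exact ⟨h5, fun a ha b hb => by rw [pow_succ', mul_assoc]; exact h6 a ha b hb, l₀, h3, h7⟩
    · refine map_mem_of_carried _ _ (fun l hl => ?_) (mem_carried_and hbul hbu)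
      obtain ⟨h1, s, hs, h2⟩ := hl
      exact carried_mono (fun l' h => ⟨h.1, s, hs, h.2⟩) (sdHomotopy_single_mem (hU s hs) n l h1 h2)
    · rw [bdry_sd n u hul]
      refine map_mem_of_carried _ _ (fun l hl => ?_) (mem_carried_and hbul hbu)
      obtain ⟨h1, s, hs, h2⟩ := hl
      obtain ⟨D', hD'⟩ : ∃ D' : ℝ, ∀ a ∈ l, ∀ b ∈ l, dist a b ≤ D' := by
        obtain ⟨C, hC⟩ := Metric.isBounded_iff.1 (List.finite_toSet l).isBounded
        exact ⟨C, fun a ha b hb => hC ha hb⟩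
      exact carried_mono (fun l' h => ⟨s, hs, h.2.2⟩) (sd_single_mem (K := n)
        (le_max_right D' 0) (hU s hs) n l h1 le_rfl
        (fun a ha b hb => (hD' a ha b hb).trans (le_max_left _ _)) h2)
    · have := bdry_sdHomotopy n hbul (bdry_bdry u)
      rw [map_add, map_add, bdry_sd n u hul, this, ← huw, map_add]
      abel

/-- If a small cycle bounds a chain whose simplices lie in `Ω`, then its image under a map
defined on `Ω` bounds a chain that is small for a prescribed cover. -/
lemma exists_small_filling {X : Type*} {Ω : Set E} {h : E → X}
    (W : Set X → Prop) (V : Set E → Prop) (hV : ∀ s, V s → Convex ℝ s)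
    (hVW : ∀ s, V s → ∃ t, W t ∧ Set.MapsTo h s t) (hcov : IsNhdCover V Ω) (n : ℕ)
    {y : List E →₀ R} (hy : y ∈ carried R (fun l => l.length = n + 1 ∧
      convexHull ℝ {b | b ∈ l} ⊆ Ω)) (hby : bdry y ∈ carried R (Small V)) :
    ∃ y' ∈ carried R (fun l : List X => l.length = n + 1 ∧ Small W l),
      bdry y' = push h (bdry y) := by
  classical
  set K : Set E := ⋃ l ∈ y.support, convexHull ℝ {b | b ∈ l} with hK
  have hKc : IsCompact K := y.support.isCompact_biUnion fun l _ =>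
    (List.finite_toSet l).isCompact_convexHull ℝ
  have hKΩ : K ⊆ Ω := Set.iUnion₂_subset fun l hl => (prop_of_mem_carried hy hl).2
  choose! s hs hVs using hcov
  obtain ⟨δ, hδ, hδ'⟩ := lebesgue_number_lemma_of_metric (c := fun x : K => interior (s x)) hKc
    (fun x => isOpen_interior)
    (fun x hx => Set.mem_iUnion.2 ⟨⟨x, hx⟩, mem_interior_iff_mem_nhds.2 (hs x (hKΩ hx))⟩)
  obtain ⟨D, hD, hdiam⟩ : ∃ D : ℝ, 0 ≤ D ∧
      ∀ l ∈ y.support, ∀ a ∈ l, ∀ b ∈ l, dist a b ≤ D := by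
    obtain ⟨C, hC⟩ := Metric.isBounded_iff.1 hKc.isBounded
    refine ⟨max C 0, le_max_right _ _, fun l hl a ha b hb => le_max_of_le_left (hC ?_ ?_)⟩ <;>
    exact Set.mem_biUnion hl (subset_convexHull ℝ _ (by assumption))
  have hq1 : (1 - ((n + 1 : ℕ) : ℝ)⁻¹) < 1 := by
    have : (0 : ℝ) < ((n + 1 : ℕ) : ℝ)⁻¹ := by positivity
    linarith
  have hq0 : (0 : ℝ) ≤ 1 - ((n + 1 : ℕ) : ℝ)⁻¹ := by
    have : (((n + 1 : ℕ) : ℝ))⁻¹ ≤ 1 :=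
      inv_le_one_of_one_le₀ (by exact_mod_cast (by omega : 1 ≤ n + 1))
    linarith
  obtain ⟨j, hj⟩ : ∃ j : ℕ, (1 - ((n + 1 : ℕ) : ℝ)⁻¹) ^ j * D < δ := by
    have := (tendsto_pow_atTop_nhds_zero_of_lt_one hq0 hq1).mul_const D
    rw [zero_mul] at this
    exact (this.eventually_lt_const hδ).exists
  obtain ⟨u, w, hu, hw, -, huw⟩ := exists_fine_filling V hV n
    (carried_mono (fun l h => h.1) hy) hby hD hdiam j
  refine ⟨push h (u + w), push_mem_carried ?_ (Submodule.add_mem _ (carried_mono ?_ hu) hw),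
    by rw [bdry_push, huw]⟩
  · rintro l ⟨h1, t, ht, h2⟩
    obtain ⟨t', ht', hm⟩ := hVW t ht
    refine ⟨by simpa using h1, t', ht', fun x hx => ?_⟩
    obtain ⟨a, ha, rfl⟩ := List.mem_map.1 hx
    exact hm (h2 a ha)
  · rintro l ⟨h1, h2, l₀, hl₀, h3⟩
    refine ⟨h1, ?_⟩
    obtain ⟨a, l', rfl⟩ := List.exists_cons_of_length_eq_add_one h1
    have haK : a ∈ K := Set.mem_biUnion hl₀ (h3 a (by simp))
    obtain ⟨i, hi⟩ := hδ' a haK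
    refine ⟨s i, hVs i (hKΩ i.2), fun x hx => interior_subset (hi ?_)⟩
    rw [Metric.mem_ball]
    exact (h2 x hx a (by simp)).trans_lt hj

end Filling

/-- Sufficiently small cycles of lists of length `n` in `X` bound, after applying `F`, arbitrarily
small chains. -/
def Fillable (R : Type*) [CommRing R] {X Y : Type*} [TopologicalSpace X] [TopologicalSpace Y]
    (F : X → Y) (n : ℕ) : Prop :=
  ∀ U : Set Y → Prop, IsNhdCover U Set.univ → ∃ V : Set X → Prop, IsNhdCover V Set.univ ∧
    ∀ z ∈ carried R (fun l => l.length = n ∧ Small V l), bdry z = 0 →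
      ∃ y ∈ carried R (fun l => l.length = n + 1 ∧ Small U l), bdry y = push F z

lemma fillable_of_fill {X Y E : Type*} [TopologicalSpace X] [TopologicalSpace Y]
    [NormedAddCommGroup E] [NormedSpace ℝ E] {Ω : Set E} (hΩ : IsOpen Ω)
    {e : X → E} (he : Continuous e) (heΩ : ∀ x, e x ∈ Ω) {h : E → Y} (hh : ContinuousOn h Ω)
    {good : Set E → Prop} (hgood : IsNhdCover good Ω)
    (hanti : ∀ s t, s ⊆ t → good t → good s) (n : ℕ)
    (hfill : ∀ z ∈ carried R (fun l : List E => l.length = n ∧ Small good l), bdry z = 0 →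
      ∃ y ∈ carried R (fun l => l.length = n + 1 ∧ convexHull ℝ {b | b ∈ l} ⊆ Ω), bdry y = z) :
    Fillable R (h ∘ e) n := by
  intro U hU
  set V : Set E → Prop := fun s => Convex ℝ s ∧ good s ∧ ∃ t, U t ∧ Set.MapsTo h s t with hV
  have hVcov : IsNhdCover V Ω := by
    intro x hx
    obtain ⟨s, hs, hsg⟩ := hgood x hx
    obtain ⟨t, ht, htU⟩ := hU (h x) (Set.mem_univ _)
    have h1 : h ⁻¹' t ∈ nhds x := (hh.continuousAt (hΩ.mem_nhds hx)) ht
    obtain ⟨r, hr, hb⟩ := Metric.mem_nhds_iff.1 (Filter.inter_mem hs h1)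
    exact ⟨Metric.ball x r, Metric.ball_mem_nhds x hr, convex_ball x r,
      hanti _ s (fun y hy => (hb hy).1) hsg, t, htU, fun y hy => (hb hy).2⟩
  refine ⟨fun s => ∃ t, V t ∧ Set.MapsTo e s t, fun x _ => ?_, fun z hz hbz => ?_⟩
  · obtain ⟨t, ht, htV⟩ := hVcov (e x) (heΩ x)
    exact ⟨e ⁻¹' t, he.continuousAt ht, t, htV, fun _ h => h⟩
  · have hez : push e z ∈ carried R (fun l : List E => l.length = n ∧ Small V l) := by
      refine push_mem_carried ?_ hz
      rintro l ⟨h1, s, ⟨t, ht, hst⟩, h2⟩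
      refine ⟨by simpa using h1, t, ht, fun x hx => ?_⟩
      obtain ⟨a, ha, rfl⟩ := List.mem_map.1 hx
      exact hst (h2 a ha)
    obtain ⟨y, hy, hby⟩ := hfill (push e z)
      (carried_mono (fun l hl => ⟨hl.1, hl.2.imp fun s hs => ⟨hs.1.2.1, hs.2⟩⟩) hez)
      (by rw [bdry_push, hbz, map_zero])
    obtain ⟨y', hy', hby'⟩ := exists_small_filling (R := R) (h := h) U V (fun s hs => hs.1)
      (fun s hs => hs.2.2) hVcov n hy (by rw [hby]; exact carried_mono (fun l hl => hl.2) hez)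
    exact ⟨y', hy', by rw [hby', hby, push_push]⟩

/-- Maps factoring through a normed space are fillable in every degree. -/
lemma fillable_of_factor {X Y E : Type*} [TopologicalSpace X] [TopologicalSpace Y]
    [NormedAddCommGroup E] [NormedSpace ℝ E] {e : X → E} (he : Continuous e) {h : E → Y}
    (hh : Continuous h) (n : ℕ) : Fillable R (h ∘ e) n := by
  refine fillable_of_fill (good := fun _ => True) isOpen_univ he (fun _ => Set.mem_univ _)
    hh.continuousOn (fun _ _ => ⟨Set.univ, Filter.univ_mem, trivial⟩) (fun _ _ _ _ => trivial) n
    fun z hz hbz => ⟨cone 0 z, cone_mem_carried ?_ hz, by simp [bdry_cone, hbz]⟩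
  rintro l ⟨h1, -⟩
  exact ⟨by simp [h1], Set.subset_univ _⟩

section Euclidean

variable {d : ℕ}

/-- The vertices of the cross-polytope. -/
noncomputable def crossVertex (v : Fin d × Bool) : EuclideanSpace ℝ (Fin d) :=
  EuclideanSpace.single v.1 (if v.2 then 1 else -1)

/-- The linear functional with the given coefficients. -/
noncomputable def functional (σ : Fin d → ℝ) : EuclideanSpace ℝ (Fin d) →ₗ[ℝ] ℝ :=
  ∑ i, σ i • (EuclideanSpace.proj (𝕜 := ℝ) i : EuclideanSpace ℝ (Fin d) →L[ℝ] ℝ).toLinearMap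

lemma functional_apply (σ : Fin d → ℝ) (x : EuclideanSpace ℝ (Fin d)) :
    functional σ x = ∑ i, σ i * x i := by
  simp [functional]

lemma functional_crossVertex (σ : Fin d → ℝ) (v : Fin d × Bool) :
    functional σ (crossVertex v) = σ v.1 * (if v.2 then 1 else -1) := by
  rw [functional_apply, Finset.sum_eq_single v.1]
  · simp [crossVertex]
  · intro j _ hj; simp [crossVertex, hj]
  · simp

/-- The signed index of a largest coordinate. -/
lemma exists_signed_max_coord (hd : 1 ≤ d) :
    ∃ κ : EuclideanSpace ℝ (Fin d) → Fin d × Bool, ∀ x, (∀ j, |x j| ≤ |x (κ x).1|) ∧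
      ((κ x).2 = true ↔ 0 < x (κ x).1) := by
  classical
  have : Nonempty (Fin d) := ⟨⟨0, hd⟩⟩
  have h : ∀ x : EuclideanSpace ℝ (Fin d), ∃ v : Fin d × Bool, (∀ j, |x j| ≤ |x v.1|) ∧
      (v.2 = true ↔ 0 < x v.1) := by
    intro x
    obtain ⟨i, hi⟩ := Finite.exists_max (fun j => |x j|)
    exact ⟨(i, decide (0 < x i)), hi, by simp⟩
  choose κ hκ using h
  exact ⟨κ, hκ⟩

lemma isNhdCover_halfSpace {κ : EuclideanSpace ℝ (Fin d) → Fin d × Bool}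
    (hκ : ∀ x, (∀ j, |x j| ≤ |x (κ x).1|) ∧ ((κ x).2 = true ↔ 0 < x (κ x).1)) :
    IsNhdCover (fun s : Set (EuclideanSpace ℝ (Fin d)) => ∃ f : EuclideanSpace ℝ (Fin d) →ₗ[ℝ] ℝ,
      ∀ x ∈ s, 0 < f x ∧ 0 < f (crossVertex (κ x))) {0}ᶜ := by
  intro x₀ hx₀
  set M := |x₀ (κ x₀).1| with hM
  have hMpos : 0 < M := by
    by_contra hcon
    refine hx₀ (PiLp.ext fun j => ?_)
    have := (hκ x₀).1 j
    exact abs_nonpos_iff.1 (by linarith)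
  set σ : Fin d → ℝ := fun i => if M / 2 < x₀ i then 1 else if x₀ i < - (M / 2) then -1 else 0
    with hσ
  refine ⟨Metric.ball x₀ (M / 4), Metric.ball_mem_nhds _ (by positivity), functional σ,
    fun x hx => ?_⟩
  have hclose : ∀ j, |x j - x₀ j| < M / 4 := fun j => by
    have h1 := PiLp.norm_apply_le (x - x₀) j
    rw [Metric.mem_ball, dist_eq_norm] at hx
    simpa using h1.trans_lt hx
  have hnn : ∀ i, 0 ≤ σ i * x i := by
    intro i
    have := abs_lt.1 (hclose i)
    simp only [hσ]
    split_ifs <;> nlinarith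
  constructor
  · rw [functional_apply]
    refine Finset.sum_pos' (fun i _ => hnn i) ⟨(κ x₀).1, Finset.mem_univ _, ?_⟩
    have := abs_lt.1 (hclose (κ x₀).1)
    simp only [hσ]
    rcases abs_cases (x₀ (κ x₀).1) with h | h
    · rw [if_pos (by linarith)]; linarith
    · rw [if_neg (by linarith), if_pos (by linarith)]; linarith
  · rw [functional_crossVertex]
    have h1 := (hκ x).1 (κ x₀).1
    have h2 := abs_lt.1 (hclose (κ x₀).1)
    have h3 := abs_lt.1 (hclose (κ x).1)
    have h4 : 3 * M / 4 < |x (κ x).1| := by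
      have : M - |x (κ x₀).1| ≤ |x₀ (κ x₀).1 - x (κ x₀).1| := abs_sub_abs_le_abs_sub _ _
      rw [abs_sub_comm] at this
      linarith [hclose (κ x₀).1]
    simp only [hσ]
    rcases abs_cases (x (κ x).1) with h | h
    · rw [if_pos (by linarith), if_pos ((hκ x).2.2 (by linarith))]; norm_num
    · rw [if_neg (by linarith), if_pos (by linarith),
        if_neg (fun h5 => by have := (hκ x).2.1 h5; linarith)]; norm_num

lemma convexHull_subset_of_functional {l : List (EuclideanSpace ℝ (Fin d))}
    (f : EuclideanSpace ℝ (Fin d) →ₗ[ℝ] ℝ) (h : ∀ x ∈ l, 0 < f x) :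
    convexHull ℝ {b | b ∈ l} ⊆ {0}ᶜ := by
  have h1 : convexHull ℝ {b | b ∈ l} ⊆ {x | 0 < f x} :=
    convexHull_min h (convex_halfSpace_gt f.isLinear 0)
  intro x hx hx0
  have := h1 hx
  rw [Set.mem_singleton_iff.1 hx0] at this
  simp at this

lemma exists_functional_of_crossSimplex {s : Finset (Fin d)} {l : List (Fin d × Bool)}
    (h : CrossSimplex s l) :
    ∃ f : EuclideanSpace ℝ (Fin d) →ₗ[ℝ] ℝ, ∀ v ∈ l, 0 < f (crossVertex v) := by
  classical
  refine ⟨functional fun i => if (i, true) ∈ l then 1 else -1, ?_⟩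
  rintro ⟨i, b⟩ hv
  rw [functional_crossVertex]
  cases b
  · have : (i, true) ∉ l := fun h' => h.2 i ⟨h', hv⟩
    simp [this]
  · simp [hv]

/-- Maps factoring through the punctured space `ℝ^d ∖ 0` are fillable for lists of length
different from `d`. -/
lemma fillable_of_factor_punctured (hd : 1 ≤ d) {X Y : Type*} [TopologicalSpace X]
    [TopologicalSpace Y] {e : X → EuclideanSpace ℝ (Fin d)} (he : Continuous e)
    (he0 : ∀ x, e x ≠ 0) {h : EuclideanSpace ℝ (Fin d) → Y} (hh : ContinuousOn h {0}ᶜ)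
    {n : ℕ} (hn : n ≠ d) : Fillable R (h ∘ e) n := by
  obtain ⟨κ, hκ⟩ := exists_signed_max_coord hd
  refine fillable_of_fill isOpen_compl_singleton he he0 hh (isNhdCover_halfSpace hκ)
    (fun s t hst ⟨f, hf⟩ => ⟨f, fun x hx => hf x (hst hx)⟩) n fun z hz hbz => ?_
  have hκz : push κ z ∈ carried R (fun l => l.length = n ∧ CrossSimplex Finset.univ l) := by
    refine push_mem_carried ?_ hz
    rintro l ⟨h1, s, ⟨f, hf⟩, h2⟩
    refine ⟨by simpa using h1, by simp, fun i ⟨hp, hm⟩ => ?_⟩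
    obtain ⟨a, ha, hai⟩ := List.mem_map.1 hp
    obtain ⟨b, hb, hbi⟩ := List.mem_map.1 hm
    have h3 := (hf a (h2 a ha)).2
    have h4 := (hf b (h2 b hb)).2
    rw [hai] at h3
    rw [hbi] at h4
    have h5 : crossVertex (i, true) = - crossVertex (i, false) := by
      simp [crossVertex, ← PiLp.single_neg]
    rw [h5, map_neg] at h3
    linarith
  obtain ⟨y₀, hy₀, hby₀⟩ := exists_bdry_eq_crossSimplex Finset.univ n (by simpa using hn)
    (push κ z) hκz (by rw [bdry_push, hbz, map_zero])
  refine ⟨push crossVertex y₀ - prism id (crossVertex ∘ κ) z, Submodule.sub_mem _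
    (push_mem_carried ?_ hy₀) (prism_mem_carried ?_ hz), ?_⟩
  · rintro l ⟨h1, h2⟩
    obtain ⟨f, hf⟩ := exists_functional_of_crossSimplex h2
    refine ⟨by simpa using h1, convexHull_subset_of_functional f fun x hx => ?_⟩
    obtain ⟨v, hv, rfl⟩ := List.mem_map.1 hx
    exact hf v hv
  · rintro l l' ⟨h1, s, ⟨f, hf⟩, h2⟩ h3 h4
    refine ⟨by omega, convexHull_subset_of_functional f fun y hy => ?_⟩
    obtain ⟨x, hx, h5 | h5⟩ := h4 y hy
    · exact h5 ▸ (hf x (h2 x hx)).1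
    · exact h5 ▸ (hf x (h2 x hx)).2
  · have := bdry_prism (R := R) id (crossVertex ∘ κ) z
    rw [hbz, map_zero, add_zero, push_id] at this
    rw [map_sub, this, bdry_push, hby₀, push_push]
    abel

end Euclidean

/-- The operators of the periodic resolution of a cyclic group of order `N` with generator acting
by `b`: the difference `b - 1` in even degrees, the norm in odd degrees. -/
noncomputable def cyclicOp {X : Type*} (b : X → X) (N k : ℕ) :
    (List X →₀ R) →ₗ[R] (List X →₀ R) :=
  if Even k then push b - LinearMap.id else ∑ i ∈ Finset.range N, push b^[i]

section CyclicOp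

variable {X Y : Type*} {b : X → X} {N : ℕ}

lemma cyclicOp_add_two (k : ℕ) :
    (cyclicOp b N (k + 2) : (List X →₀ R) →ₗ[R] _) = cyclicOp b N k := by
  simp [cyclicOp, Nat.even_add]

lemma bdry_cyclicOp (k : ℕ) (c : List X →₀ R) :
    bdry (cyclicOp b N k c) = cyclicOp b N k (bdry c) := by
  by_cases hk : Even k <;> simp [cyclicOp, hk, bdry_push, LinearMap.sum_apply]

lemma cyclicOp_succ_cyclicOp (hb : b^[N] = id) (k : ℕ) (c : List X →₀ R) :
    cyclicOp b N (k + 1) (cyclicOp b N k c) = 0 := by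
  have h1 : ∀ i, push b^[i] (push b c) = push b^[i + 1] c := fun i => by
    rw [push_push, Function.iterate_succ]
  have h2 : ∀ i, push b (push b^[i] c) = push b^[i + 1] c := fun i => by
    rw [push_push, Function.iterate_succ']
  have h3 := Finset.sum_range_sub (fun i => push (R := R) b^[i] c) N
  rw [hb, Function.iterate_zero, sub_self] at h3
  by_cases hk : Even k
  · simpa [cyclicOp, hk, Nat.even_add_one, LinearMap.sum_apply, h1] using h3
  · simpa [cyclicOp, hk, Nat.even_add_one, LinearMap.sum_apply, h2] using h3

lemma push_cyclicOp {a : Y → Y} {F : X → Y} (hF : F ∘ b = a ∘ F) (k : ℕ) (c : List X →₀ R) :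
    push F (cyclicOp b N k c) = cyclicOp a N k (push F c) := by
  have h : ∀ i, F ∘ b^[i] = a^[i] ∘ F := fun i =>
    (Function.Semiconj.iterate_right (fun x => congrFun hF x) i).comp_eq
  by_cases hk : Even k <;> simp [cyclicOp, hk, push_push, hF, h]

lemma cyclicOp_mem_carried {P Q : List X → Prop} (hN : 1 < N)
    (h : ∀ l, P l → ∀ i < N, Q (l.map b^[i])) (k : ℕ) {c : List X →₀ R} (hc : c ∈ carried R P) :
    cyclicOp b N k c ∈ carried R Q := by
  have h1 : ∀ i < N, push b^[i] c ∈ carried R Q := fun i hi =>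
    push_mem_carried (fun l hl => h l hl i hi) hc
  by_cases hk : Even k
  · simp only [cyclicOp, hk, if_true, LinearMap.sub_apply, LinearMap.id_apply]
    refine Submodule.sub_mem _ (h1 1 hN) ?_
    simpa [push_id] using h1 0 (by omega)
  · simp only [cyclicOp, hk, if_false, LinearMap.sum_apply]
    exact Submodule.sum_mem _ fun i hi => h1 i (Finset.mem_range.1 hi)

end CyclicOp

/-- `Tower b N k c` says that `c` is the top chain of a map from the `k`-skeleton of the periodic
resolution of a cyclic group to the ordered chains of `X`. -/
def Tower {X : Type*} (b : X → X) (N : ℕ) : ℕ → (List X →₀ R) → Prop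
  | 0, c => c ∈ carried R (fun l => l.length = 1) ∧ bdry c = single [] 1
  | k + 1, c => c ∈ carried R (fun l => l.length = k + 2) ∧
      ∃ c', Tower b N k c' ∧ bdry c = cyclicOp b N k c'

section Tower

variable {X Y : Type*} {b : X → X} {N : ℕ}

lemma Tower.mem_carried {k : ℕ} {c : List X →₀ R} (h : Tower b N k c) :
    c ∈ carried R (fun l => l.length = k + 1) := by
  cases k <;> exact h.1

lemma Tower.bdry_cyclicOp_eq_zero (hb : b^[N] = id) {k : ℕ} {c : List X →₀ R}
    (h : Tower b N k c) : bdry (cyclicOp b N k c) = 0 := by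
  rw [bdry_cyclicOp]
  cases k with
  | zero => simp [h.2, cyclicOp]
  | succ k =>
    obtain ⟨-, c', -, hc'⟩ := h
    rw [hc', cyclicOp_succ_cyclicOp hb]

lemma Tower.push {a : Y → Y} {F : X → Y} (hF : F ∘ b = a ∘ F) {k : ℕ} :
    ∀ {c : List X →₀ R}, Tower b N k c → Tower a N k (push F c) := by
  induction k with
  | zero =>
    intro c h
    exact ⟨push_mem_carried (by simp) h.1, by simp [bdry_push, h.2]⟩
  | succ k ih =>
    rintro c ⟨h1, c', h2, h3⟩
    exact ⟨push_mem_carried (by simp) h1, _, ih h2, by rw [bdry_push, h3, push_cyclicOp hF]⟩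

/-- Arbitrarily small towers exist in degree `k`. -/
def HasSmallTowers (R : Type*) [CommRing R] {X : Type*} [TopologicalSpace X] (b : X → X)
    (N k : ℕ) : Prop :=
  ∀ U : Set X → Prop, IsNhdCover U Set.univ →
    ∃ c : List X →₀ R, Tower b N k c ∧ c ∈ carried R (Small U)

variable [TopologicalSpace X] [TopologicalSpace Y]

lemma hasSmallTowers_zero [Nonempty X] : HasSmallTowers R b N 0 := by
  intro U hU
  obtain ⟨x⟩ := ‹Nonempty X›
  obtain ⟨s, hs, hUs⟩ := hU x (Set.mem_univ x)
  exact ⟨single [x] 1,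
    ⟨single_mem_carried (P := fun l => l.length = 1) rfl 1, by simp [bdryList]⟩,
    single_mem_carried (P := Small U) ⟨s, hUs, by simpa using mem_of_mem_nhds hs⟩ 1⟩

lemma HasSmallTowers.succ {a : Y → Y} {F : X → Y} (hb : Continuous b) (hbN : b^[N] = id)
    (hN : 1 < N) (hF : F ∘ b = a ∘ F) {k : ℕ} (h : HasSmallTowers R b N k)
    (hfill : Fillable R F (k + 1)) : HasSmallTowers R a N (k + 1) := by
  intro U hU
  obtain ⟨V, hV, hVU⟩ := hfill U hU
  obtain ⟨c, hc, hcW⟩ := h (fun s => ∀ i < N, ∃ t, V t ∧ Set.MapsTo b^[i] s t) (by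
    intro x _
    choose s hs hVs using fun i : ℕ => hV (b^[i] x) (Set.mem_univ _)
    refine ⟨⋂ i ∈ Finset.range N, b^[i] ⁻¹' s i, ?_, fun i hi => ⟨s i, hVs i, fun y hy => ?_⟩⟩
    · exact (Filter.biInter_finset_mem _).2 fun i _ => (hb.iterate i).continuousAt (hs i)
    · exact Set.mem_iInter₂.1 hy i (Finset.mem_range.2 hi))
  obtain ⟨y, hy, hby⟩ := hVU (cyclicOp b N k c)
    (cyclicOp_mem_carried hN (fun l hl i hi => by
      obtain ⟨h1, s, hs, h2⟩ := hl
      obtain ⟨t, ht, hst⟩ := hs i hi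
      refine ⟨by simpa using h1, t, ht, fun x hx => ?_⟩
      obtain ⟨z, hz, rfl⟩ := List.mem_map.1 hx
      exact hst (h2 z hz)) k (mem_carried_and hc.mem_carried hcW))
    (hc.bdry_cyclicOp_eq_zero hbN)
  exact ⟨y, ⟨carried_mono (fun l hl => hl.1) hy, _, hc.push hF, by rw [hby, push_cyclicOp hF]⟩,
    carried_mono (fun l hl => hl.2) hy⟩

end Tower

section Cap

variable {X : Type*}

/-- Cap product of a list with a `2`-cochain. -/
noncomputable def capList (β : X → X → X → R) : List X → (List X →₀ R)
  | x :: y :: z :: l => single (z :: l) (β x y z)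
  | _ => 0

/-- Cap product of a chain with a `2`-cochain. -/
noncomputable def cap (β : X → X → X → R) : (List X →₀ R) →ₗ[R] (List X →₀ R) :=
  linearCombination R (capList β)

lemma cap_cone (β : X → X → X → R) (x y z : X) (c : List X →₀ R) :
    cap β (cone x (cone y (cone z c))) = β x y z • cone z c := by
  induction c using Finsupp.induction_linear with
  | zero => simp
  | add u v hu hv => simp only [map_add, hu, hv, smul_add]
  | single l r => simp [cap, capList, mul_comm]

lemma cap_push (β : X → X → X → R) (f : X → X) (hf : ∀ x y z, β (f x) (f y) (f z) = β x y z)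
    (c : List X →₀ R) : cap β (push f c) = push f (cap β c) := by
  induction c using Finsupp.induction_linear with
  | zero => simp
  | add u v hu hv => simp only [map_add, hu, hv]
  | single l r =>
    rcases l with _ | ⟨x, _ | ⟨y, _ | ⟨z, l⟩⟩⟩
    · simp [cap, capList]
    · simp [cap, capList]
    · simp [cap, capList]
    · simp only [cap, push_single, linearCombination_single, List.map_cons, capList, map_smul, hf]

lemma cap_cyclicOp (β : X → X → X → R) (b : X → X)
    (hb : ∀ x y z, β (b x) (b y) (b z) = β x y z) (N k : ℕ) (c : List X →₀ R) :
    cap β (cyclicOp b N k c) = cyclicOp b N k (cap β c) := by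
  have h : ∀ i x y z, β (b^[i] x) (b^[i] y) (b^[i] z) = β x y z := by
    intro i
    induction i with
    | zero => simp
    | succ i ih => intro x y z; simp only [Function.iterate_succ, Function.comp_apply, ih, hb]
  by_cases hk : Even k
  · simp [cyclicOp, hk, cap_push β b hb]
  · simp [cyclicOp, hk, fun i => cap_push β b^[i] (h i)]

lemma bdry_cap (β : X → X → X → R)
    (hβ : ∀ x y z t, β y z t - β x z t + β x y t - β x y z = 0) {c : List X →₀ R}
    (hc : c ∈ carried R (fun l => 4 ≤ l.length)) : bdry (cap β c) = cap β (bdry c) := by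
  refine eq_of_carried (bdry ∘ₗ cap β) (cap β ∘ₗ bdry) (fun l hl => ?_) hc
  rcases l with _ | ⟨x, _ | ⟨y, _ | ⟨z, _ | ⟨t, l⟩⟩⟩⟩ <;> simp at hl
  have e1 : ∀ (p q r : X) (l : List X), cap β (single (p :: q :: r :: l) 1) =
      β p q r • single (r :: l) 1 := fun p q r l => by simp [cap, capList]
  have h2 : (single (x :: y :: z :: t :: l) 1 : List X →₀ R) =
      cone x (cone y (cone z (single (t :: l) 1))) := by simp
  have h3 : bdryList (x :: y :: z :: t :: l) = single (y :: z :: t :: l) (1 : R) -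
      single (x :: z :: t :: l) 1 + single (x :: y :: t :: l) 1 -
      cone x (cone y (cone z (bdryList (t :: l)))) := by
    simp only [bdryList, map_sub, cone_single]; abel
  rw [LinearMap.comp_apply, LinearMap.comp_apply, bdry_single, one_smul, h3, h2, cap_cone,
    map_sub, map_add, map_sub, e1, e1, e1, cap_cone, map_smul, bdry_cone, bdry_single, one_smul]
  rw [show β x y z = β y z t - β x z t + β x y t by linear_combination -hβ x y z t]
  module

end Cap

section WrapCochain

lemma iterate_equivariant {X : Type*} {N : ℕ} {b : X → X} {φ : X → ZMod N}
    (hφ : ∀ x, φ (b x) = φ x + 1) (i : ℕ) (x : X) :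
    φ (b^[i] x) = φ x + i := by
  induction i generalizing x with
  | zero => simp
  | succ i ih => rw [Function.iterate_succ_apply, ih, hφ]; push_cast; ring

variable {N : ℕ} [NeZero N]

/-- The carry of two residues: `1` if the value decreases, `0` otherwise. -/
def carry (a b : ZMod N) : ℤ := if b.val < a.val then 1 else 0

lemma mul_carry (a b : ZMod N) :
    (N : ℤ) * carry a b = ((b - a).val : ℤ) - b.val + a.val := by
  have h : b = a + (b - a) := by ring
  unfold carry
  have ha := ZMod.val_lt a
  have hb := ZMod.val_lt (b - a)
  rcases lt_or_ge (a.val + (b - a).val) N with h1 | h1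
  · have h2 := ZMod.val_add_of_lt h1
    rw [← h] at h2
    rw [if_neg (by omega)]
    omega
  · have h2 := ZMod.val_add_val_of_le h1
    rw [← h] at h2
    rw [if_pos (by omega)]
    omega

lemma carry_cocycle_add_one (a b c : ZMod N) :
    carry (b + 1) (c + 1) - carry (a + 1) (c + 1) + carry (a + 1) (b + 1) =
      carry b c - carry a c + carry a b := by
  have hN : (N : ℤ) ≠ 0 := by exact_mod_cast NeZero.ne N
  refine mul_left_cancel₀ hN ?_
  simp only [mul_add, mul_sub, mul_carry, add_sub_add_right_eq_sub]
  ring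

lemma sum_range_add_eq {M : Type*} [AddCommMonoid M] (g : ZMod N → M) (a : ZMod N) :
    ∑ i ∈ Finset.range N, g (a + i) = ∑ j, g j := by
  rw [← Equiv.sum_comp (Equiv.addLeft a)]
  refine Finset.sum_nbij' (fun i => (i : ZMod N)) ZMod.val (by simp)
    (fun j _ => Finset.mem_range.2 (ZMod.val_lt j)) ?_ ?_ (by simp)
  · intro i hi; exact ZMod.val_cast_of_lt (Finset.mem_range.1 hi)
  · simp

lemma sum_carry (a b : ZMod N) :
    ∑ i ∈ Finset.range N, carry (a + (i : ZMod N)) (b + (i : ZMod N)) = ((b - a).val : ℤ) := by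
  have hN : (N : ℤ) ≠ 0 := by exact_mod_cast NeZero.ne N
  refine mul_left_cancel₀ hN ?_
  rw [Finset.mul_sum]
  simp only [mul_carry, add_sub_add_right_eq_sub, Finset.sum_add_distrib, Finset.sum_sub_distrib]
  rw [sum_range_add_eq (fun j => (j.val : ℤ)), sum_range_add_eq (fun j => (j.val : ℤ))]
  simp

variable {X : Type*}

/-- The `2`-cocycle obtained from a function to `ZMod N` through carries. -/
def carryCocycle (φ : X → ZMod N) (x y z : X) : ZMod N :=
  ((carry (φ y) (φ z) - carry (φ x) (φ z) + carry (φ x) (φ y) : ℤ) : ZMod N)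

/-- The functional on chains of lists of length one given by a function. -/
noncomputable def evalOne (f : X → R) : (List X →₀ R) →ₗ[R] R :=
  linearCombination R fun | [x] => f x | _ => 0

/-- The functional on chains of lists of length two given by a function. -/
noncomputable def evalTwo (f : X → X → R) : (List X →₀ R) →ₗ[R] R :=
  linearCombination R fun | [x, y] => f x y | _ => 0

variable {b : X → X} {φ : X → ZMod N}

lemma bdry_cap_carryCocycle_of_tower_two (hφ : ∀ x, φ (b x) = φ x + 1) {c : List X →₀ ZMod N}
    (hc : Tower b N 2 c) : bdry (cap (carryCocycle φ) c) = single [] 1 := by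
  obtain ⟨h2, c₁, ⟨h1, c₀, ⟨h0, hb0⟩, hb1⟩, hb2⟩ := hc
  set w : X → X → ZMod N := fun x y => (carry (φ x) (φ y) : ZMod N)
  have e2 : bdry (cap (carryCocycle φ) c) = evalTwo w (bdry c) • single [] 1 := by
    refine eq_of_carried (bdry ∘ₗ cap (carryCocycle φ))
      ((LinearMap.toSpanSingleton _ _ (single [] 1)) ∘ₗ evalTwo w ∘ₗ bdry) (fun l hl => ?_) h2
    obtain ⟨x, y, z, rfl⟩ := List.length_eq_three.1 hl
    simp [cap, capList, evalTwo, bdryList, carryCocycle, w, sub_sub_eq_add_sub, add_sub_right_comm]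
  have e1 : evalTwo w (cyclicOp b N 1 c₁) = evalOne φ (bdry c₁) := by
    refine eq_of_carried (evalTwo w ∘ₗ cyclicOp b N 1) (evalOne φ ∘ₗ bdry) (fun l hl => ?_) h1
    obtain ⟨x, y, rfl⟩ := List.length_eq_two.1 hl
    have := congrArg (Int.cast (R := ZMod N)) (sum_carry (φ x) (φ y))
    simpa [evalTwo, evalOne, cyclicOp, bdryList, w, iterate_equivariant hφ, LinearMap.sum_apply]
      using this
  have e0 : evalOne φ (cyclicOp b N 0 c₀) • (single [] 1 : List X →₀ ZMod N) = bdry c₀ := by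
    refine eq_of_carried ((LinearMap.toSpanSingleton _ _ (single [] 1)) ∘ₗ evalOne φ ∘ₗ
      cyclicOp b N 0) bdry (fun l hl => ?_) h0
    obtain ⟨x, rfl⟩ := List.length_eq_one_iff.1 hl
    simp [evalOne, cyclicOp, bdryList, hφ]
  rw [e2, hb2, e1, hb1, e0, hb0]

lemma carryCocycle_equivariant (hφ : ∀ x, φ (b x) = φ x + 1) (x y z : X) :
    carryCocycle φ (b x) (b y) (b z) = carryCocycle φ x y z := by
  simp only [carryCocycle, hφ, carry_cocycle_add_one]

lemma cap_mem_length (β : X → X → X → R) (k : ℕ) {c : List X →₀ R}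
    (hc : c ∈ carried R (fun l => l.length = k + 2 + 1)) :
    cap β c ∈ carried R (fun l => l.length = k + 1) := by
  refine map_mem_of_carried _ _ (fun l hl => ?_) hc
  rcases l with _ | ⟨x, _ | ⟨y, _ | ⟨z, l⟩⟩⟩ <;> simp at hl
  simpa [cap, capList] using single_mem_carried (by simpa using hl) _

lemma Tower.cap (hφ : ∀ x, φ (b x) = φ x + 1) (k : ℕ) : ∀ {c : List X →₀ ZMod N},
    Tower b N (k + 2) c → Tower b N k (cap (carryCocycle φ) c) := by
  induction k with
  | zero =>
    intro c hc
    exact ⟨cap_mem_length _ 0 hc.mem_carried, bdry_cap_carryCocycle_of_tower_two hφ hc⟩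
  | succ k ih =>
    intro c hc
    have hlen := hc.mem_carried
    obtain ⟨-, c', h2, h3⟩ := hc
    refine ⟨cap_mem_length _ (k + 1) hlen, _, ih h2, ?_⟩
    rw [bdry_cap _ _ (carried_mono (fun l hl => by omega) hlen), h3,
      cap_cyclicOp _ _ (carryCocycle_equivariant hφ), cyclicOp_add_two]
    intro x y z t
    simp only [carryCocycle]
    push_cast
    ring

/-- There is no tower of degree `2 m` all of whose lists are constant for one of `m` given
equivariant functions. -/
lemma not_tower_of_locally_constant (hN : 1 < N) (Φ : List (X → ZMod N)) :
    (∀ φ ∈ Φ, ∀ x, φ (b x) = φ x + 1) → ∀ c : List X →₀ ZMod N,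
      c ∈ carried (ZMod N) (fun l => ∃ φ ∈ Φ, ∀ x ∈ l, ∀ y ∈ l, φ x = φ y) →
      ¬ Tower b N (2 * Φ.length) c := by
  have : Fact (1 < N) := ⟨hN⟩
  induction Φ with
  | nil =>
    intro _ c hc hT
    have h0 : c = 0 := by
      simpa using eq_of_carried LinearMap.id 0 (fun l hl => absurd hl (by simp)) hc
    have h1 : (0 : List X →₀ ZMod N) = single [] 1 := by
      simpa [h0] using (show bdry c = single [] 1 from hT.2)
    exact one_ne_zero (single_eq_zero.1 h1.symm)
  | cons φ Φ ih =>
    intro hΦ c hc hT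
    refine ih (fun ψ hψ => hΦ ψ (List.mem_cons_of_mem _ hψ)) (ListChain.cap (carryCocycle φ) c) ?_
      (Tower.cap (hΦ φ (by simp)) _ hT)
    refine map_mem_of_carried _ _ (fun l hl => ?_) hc
    obtain ⟨ψ, hψ, h⟩ := hl
    rcases l with _ | ⟨x, _ | ⟨y, _ | ⟨z, l⟩⟩⟩
    · simp [ListChain.cap, capList]
    · simp [ListChain.cap, capList]
    · simp [ListChain.cap, capList]
    rcases List.mem_cons.1 hψ with rfl | hψ
    · have h1 : ψ x = ψ y := h x (by simp) y (by simp)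
      have h2 : ψ y = ψ z := h y (by simp) z (by simp)
      simp [ListChain.cap, capList, carryCocycle, carry, h1, h2]
    · rw [ListChain.cap, linearCombination_single, one_smul, capList]
      exact single_mem_carried ⟨ψ, hψ, fun u hu v hv => h u (List.mem_cons_of_mem _
        (List.mem_cons_of_mem _ hu)) v (List.mem_cons_of_mem _ (List.mem_cons_of_mem _ hv))⟩ _

end WrapCochain

open Filter Topology

open Polynomial in
lemma card_le_of_sum_mul_pow_eq_zero {d : ℕ} {v : EuclideanSpace ℝ (Fin d)} (hv : v ≠ 0)
    (s : Finset ℕ) (hs : ∀ t ∈ s, ∑ i : Fin d, v i * (t : ℝ) ^ (i : ℕ) = 0) : s.card ≤ d := by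
  set p : ℝ[X] := ∑ i : Fin d, monomial (i : ℕ) (v i)
  have hp : p ≠ 0 := by
    contrapose! hv
    ext i
    have := congrArg (fun q : ℝ[X] => q.coeff (i : ℕ)) hv
    simpa [p, finsetSum_coeff, coeff_monomial, Fin.val_inj] using this
  have hdeg : p.natDegree ≤ d := natDegree_sum_le_of_forall_le _ _ fun i _ =>
    (natDegree_monomial_le _).trans i.2.le
  calc s.card = (s.map Nat.castEmbedding : Finset ℝ).card := (Finset.card_map _).symm
    _ ≤ p.natDegree := by
      refine card_le_degree_of_subset_roots fun x hx => ?_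
      obtain ⟨t, ht, rfl⟩ := Finset.mem_map.1 hx
      rw [mem_roots hp, IsRoot.def]
      simpa [p, eval_finsetSum] using hs t ht
    _ ≤ d := hdeg

lemma exists_separating_moment {d N : ℕ} {w : ℕ → EuclideanSpace ℝ (Fin d)}
    (hw : ∀ i < N, ∀ j < N, w i = w j → i = j) :
    ∃ t < N * N * d + 1, ∀ i < N, ∀ j < N,
      ∑ k : Fin d, w i k * (t : ℝ) ^ (k : ℕ) = ∑ k : Fin d, w j k * (t : ℝ) ^ (k : ℕ) → i = j := by
  classical
  by_contra! h
  set bad : ℕ × ℕ → Finset ℕ := fun q => (Finset.range (N * N * d + 1)).filter fun t =>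
    q.1 ≠ q.2 ∧ ∑ k : Fin d, w q.1 k * (t : ℝ) ^ (k : ℕ) = ∑ k : Fin d, w q.2 k * (t : ℝ) ^ (k : ℕ)
  have hsub : Finset.range (N * N * d + 1) ⊆
      (Finset.range N ×ˢ Finset.range N).biUnion bad := by
    intro t ht
    obtain ⟨i, hi, j, hj, h1, h2⟩ := h t (Finset.mem_range.1 ht)
    exact Finset.mem_biUnion.2 ⟨(i, j), by simp [hi, hj], by simp_all [bad]⟩
  have hcard := (Finset.card_le_card hsub).trans
    (Finset.card_biUnion_le_card_mul _ bad d fun q hq => ?_)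
  · simp at hcard
  · obtain ⟨h1, h2⟩ := Finset.mem_product.1 hq
    by_cases hne : q.1 = q.2
    · simp [bad, hne]
    refine card_le_of_sum_mul_pow_eq_zero (v := w q.1 - w q.2) (fun h => hne
      (hw _ (Finset.mem_range.1 h1) _ (Finset.mem_range.1 h2) (sub_eq_zero.1 h))) _ fun t ht => ?_
    have := (Finset.mem_filter.1 ht).2.2
    simp only [PiLp.sub_apply, sub_mul, Finset.sum_sub_distrib, this, sub_self]

section EquivariantFunctions

variable {Y : Type*} {N : ℕ} [NeZero N] {b : Y → Y}

lemma iterate_val_apply (hbN : b^[N] = id) (j : ZMod N) (y : Y) :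
    b^[j.val] (b y) = b^[(j + 1).val] y := by
  have hper : Function.IsPeriodicPt b N y := congrFun hbN y
  have h : (j + 1).val = (j.val + 1) % N := by
    rw [← ZMod.val_natCast]
    simp
  rw [h, hper.iterate_mod_apply, Function.iterate_succ_apply]

/-- A continuous real function `θ` yields an equivariant function to `ZMod N`, locally constant
wherever `θ` separates the points of the orbit. -/
lemma exists_equivariant_of_continuous [TopologicalSpace Y] (hb : Continuous b)
    (hbN : b^[N] = id) (hfree : ∀ y, ∀ i < N, ∀ j < N, b^[i] y = b^[j] y → i = j)
    {θ : Y → ℝ} (hθ : Continuous θ) :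
    ∃ φ : Y → ZMod N, (∀ y, φ (b y) = φ y + 1) ∧
      ∀ y, (∀ i < N, ∀ j < N, θ (b^[i] y) = θ (b^[j] y) → i = j) →
        ∀ᶠ z in 𝓝 y, φ z = φ y := by
  obtain ⟨_, -⟩ := exists_wellFoundedLT Y
  set key : Y → ℝ ×ₗ Y := fun y => toLex (θ y, y)
  have hex : ∀ y, ∃ k : ZMod N, ∀ j : ZMod N, key (b^[k.val] y) ≤ key (b^[j.val] y) := fun y => by
    obtain ⟨k, -, hk⟩ := Finset.exists_min_image Finset.univ
      (fun k : ZMod N => key (b^[k.val] y)) ⟨0, Finset.mem_univ _⟩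
    exact ⟨k, fun j => hk j (Finset.mem_univ j)⟩
  choose m hm using hex
  have huniq : ∀ y k, (∀ j : ZMod N, key (b^[k.val] y) ≤ key (b^[j.val] y)) → m y = k := by
    intro y k hk
    have h : key (b^[(m y).val] y) = key (b^[k.val] y) := le_antisymm (hm y k) (hk _)
    have h' : b^[(m y).val] y = b^[k.val] y := congrArg (fun p => (ofLex p).2) h
    exact ZMod.val_injective N (hfree y _ (ZMod.val_lt _) _ (ZMod.val_lt _) h')
  refine ⟨fun y => - m y, fun y => ?_, fun y hy => ?_⟩
  · have h : m (b y) = m y - 1 := huniq _ _ fun j => by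
      rw [iterate_val_apply hbN, iterate_val_apply hbN, sub_add_cancel]
      exact hm y _
    simp only [h]; ring
  · have hev : ∀ j : ZMod N, ∀ᶠ z in 𝓝 y, key (b^[(m y).val] z) ≤ key (b^[j.val] z) := by
      intro j
      by_cases hj : j = m y
      · simp [hj]
      have hle : θ (b^[(m y).val] y) ≤ θ (b^[j.val] y) := Prod.Lex.monotone_fst_ofLex (hm y j)
      have hlt : θ (b^[(m y).val] y) < θ (b^[j.val] y) := lt_of_le_of_ne hle fun h =>
        hj (ZMod.val_injective N (hy _ (ZMod.val_lt _) _ (ZMod.val_lt _) h)).symm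
      filter_upwards [((hθ.comp (hb.iterate _)).continuousAt).eventually_lt
        (hθ.comp (hb.iterate _)).continuousAt hlt] with z hz
      exact (Prod.Lex.toLex_lt_toLex.2 (Or.inl hz)).le
    filter_upwards [eventually_all.2 hev] with z hz
    rw [huniq z _ hz]

/-- A space embedded in `ℝ^d` with a free action of a cyclic group of order `N` admits finitely
many equivariant functions to `ZMod N`, one of which is locally constant at any given point. -/
lemma exists_equivariant_functions [TopologicalSpace Y] {d : ℕ} {e : Y → EuclideanSpace ℝ (Fin d)}
    (he : Continuous e) (hinj : Function.Injective e) (hb : Continuous b)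
    (hbN : b^[N] = id) (hfree : ∀ y, ∀ i < N, ∀ j < N, b^[i] y = b^[j] y → i = j) :
    ∃ Φ : List (Y → ZMod N), d ≤ Φ.length ∧ (∀ φ ∈ Φ, ∀ y, φ (b y) = φ y + 1) ∧
      ∀ y, ∃ φ ∈ Φ, ∀ᶠ z in 𝓝 y, φ z = φ y := by
  choose φ hφ hloc using fun t : ℕ => exists_equivariant_of_continuous hb hbN hfree
    (θ := fun y => ∑ k : Fin d, e y k * (t : ℝ) ^ (k : ℕ)) (by fun_prop)
  refine ⟨(List.range (N * N * d + 1)).map φ, ?_, ?_, fun y => ?_⟩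
  · have := Nat.pos_of_neZero (N * N)
    rw [List.length_map, List.length_range]
    nlinarith
  · simpa using fun t _ => hφ t
  · obtain ⟨t, ht, h⟩ := exists_separating_moment (w := fun i => e (b^[i] y))
      fun i hi j hj hij => hfree y i hi j hj (hinj hij)
    exact ⟨φ t, List.mem_map.2 ⟨t, List.mem_range.2 ht, rfl⟩, hloc t y h⟩

end EquivariantFunctions

section Sphere

variable {d N : ℕ}

lemma hasSmallTowers_sphere (hd : 1 ≤ d)
    {a : Metric.sphere (0 : EuclideanSpace ℝ (Fin d)) 1 → Metric.sphere _ 1}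
    (ha : Continuous a) (haN : a^[N] = id) (hN : 1 < N) {k : ℕ} (hk : k < d) :
    HasSmallTowers R a N k := by
  have hne : Nonempty (Metric.sphere (0 : EuclideanSpace ℝ (Fin d)) 1) :=
    ⟨⟨EuclideanSpace.single ⟨0, hd⟩ 1, by simp⟩⟩
  induction k with
  | zero => exact hasSmallTowers_zero
  | succ k ih =>
    classical
    set ρ : EuclideanSpace ℝ (Fin d) → Metric.sphere (0 : EuclideanSpace ℝ (Fin d)) 1 :=
      fun x => if hx : x ≠ 0 then ⟨‖x‖⁻¹ • x, by simp [norm_smul, hx]⟩ else hne.some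
    have hρ : ContinuousOn ρ {0}ᶜ := by
      rw [IsInducing.subtypeVal.continuousOn_iff]
      refine ContinuousOn.congr (f := fun x => ‖x‖⁻¹ • x) ?_ fun x hx => ?_
      · exact (continuousOn_id.norm.inv₀ fun x hx => norm_ne_zero_iff.2 hx).smul continuousOn_id
      · have hx' : x ≠ 0 := hx
        simp [ρ, hx']
    have hne0 : ∀ x : Metric.sphere (0 : EuclideanSpace ℝ (Fin d)) 1, x.1 ≠ 0 := fun x =>
      ne_zero_of_mem_unit_sphere x
    have hid : ρ ∘ Subtype.val = id := by
      funext x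
      simp [ρ, hne0 x]
    have hfill := fillable_of_factor_punctured (R := R) hd continuous_subtype_val hne0 hρ hk.ne
    rw [hid] at hfill
    exact (ih (by omega)).succ (F := id) ha haN hN rfl hfill

lemma HasSmallTowers.of_le (hd : 1 ≤ d)
    {b : {x : EuclideanSpace ℝ (Fin d) // x ≠ 0} → {x : EuclideanSpace ℝ (Fin d) // x ≠ 0}}
    (hb : Continuous b) (hbN : b^[N] = id) (hN : 1 < N) (h : HasSmallTowers R b N d) {k : ℕ}
    (hk : d ≤ k) : HasSmallTowers R b N k := by
  induction k, hk using Nat.le_induction with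
  | base => exact h
  | succ k hk ih =>
    classical
    by_cases hne : Nonempty {x : EuclideanSpace ℝ (Fin d) // x ≠ 0}
    swap
    · exact absurd ⟨EuclideanSpace.single ⟨0, hd⟩ 1, by simp⟩ hne
    set ρ : EuclideanSpace ℝ (Fin d) → {x : EuclideanSpace ℝ (Fin d) // x ≠ 0} :=
      fun x => if hx : x ≠ 0 then ⟨x, hx⟩ else hne.some
    have hρ : ContinuousOn ρ {0}ᶜ := by
      rw [(IsEmbedding.subtypeVal (p := fun x : EuclideanSpace ℝ (Fin d) => x ≠
        0)).isInducing.continuousOn_iff]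
      refine continuousOn_id.congr fun x hx => ?_
      have hx' : x ≠ 0 := hx
      simp [ρ, hx']
    have hid : ρ ∘ Subtype.val = id := by
      funext x
      simp [ρ, x.2]
    have hfill := fillable_of_factor_punctured (R := R) (n := k + 1) hd continuous_subtype_val
      (fun x : {x : EuclideanSpace ℝ (Fin d) // x ≠ 0} => x.2) hρ (by omega)
    rw [hid] at hfill
    exact ih.succ (F := id) hb hbN hN rfl hfill

/-- An equivariant map from the sphere to the punctured space, with respect to an action of a
cyclic group that is free on the target, does not extend to the whole space. -/
theorem not_equivariant_of_extends (hd : 1 ≤ d) (hN : 1 < N)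
    {a : Metric.sphere (0 : EuclideanSpace ℝ (Fin d)) 1 → Metric.sphere _ 1}
    (ha : Continuous a) (haN : a^[N] = id)
    {b : {x : EuclideanSpace ℝ (Fin d) // x ≠ 0} → {x : EuclideanSpace ℝ (Fin d) // x ≠ 0}}
    (hb : Continuous b) (hbN : b^[N] = id)
    (hfree : ∀ y, ∀ i < N, ∀ j < N, b^[i] y = b^[j] y → i = j)
    {h : EuclideanSpace ℝ (Fin d) → {x : EuclideanSpace ℝ (Fin d) // x ≠ 0}} (hh : Continuous h) :
    (h ∘ Subtype.val) ∘ a ≠ b ∘ (h ∘ Subtype.val) := by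
  intro heq
  have : NeZero N := ⟨by omega⟩
  obtain ⟨Φ, hlen, hΦ, hloc⟩ := exists_equivariant_functions continuous_subtype_val
    Subtype.val_injective hb hbN hfree
  obtain ⟨n, rfl⟩ : ∃ n, d = n + 1 := ⟨d - 1, by omega⟩
  have hT := ((hasSmallTowers_sphere (R := ZMod N) hd ha haN hN n.lt_succ_self).succ ha haN hN heq
    (fillable_of_factor continuous_subtype_val hh _)).of_le hd hb hbN hN
    (k := 2 * Φ.length) (by omega)
  obtain ⟨c, hc, hcU⟩ := hT (fun s => ∃ φ ∈ Φ, ∀ x ∈ s, ∀ y ∈ s, φ x = φ y) fun y _ => by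
    obtain ⟨φ, hφ, hev⟩ := hloc y
    exact ⟨_, hev, φ, hφ, fun x hx z hz => Eq.trans hx (Eq.symm hz)⟩
  refine not_tower_of_locally_constant hN Φ hΦ c (carried_mono (fun l hl => ?_) hcU) hc
  obtain ⟨s, ⟨φ, hφ, hs⟩, hl⟩ := hl
  exact ⟨φ, hφ, fun x hx y hy => hs x (hl x hx) y (hl y hy)⟩

end Sphere

end ListChain

/-- `G`-Borsuk–Ulam theorem for the ball: let `G` be a nontrivial finite group acting
continuously and freely on the unit sphere of `ℝ^d`, and acting continuously on `ℝ^d`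
semifreely with unique fixed point the origin. If `f : ℝ^d → ℝ^d` is continuous on the
closed unit ball and `G`-equivariant on the boundary sphere, then `f` has a zero in the
closed unit ball. -/
theorem zero_of_G_equivariant_on_sphere (d : ℕ) (hd : 1 ≤ d)
    (G : Type*) [Group G] [Finite G] [Nontrivial G] [TopologicalSpace G]
    [MulAction G (Metric.sphere (0 : EuclideanSpace ℝ (Fin d)) 1)]
    [ContinuousSMul G (Metric.sphere (0 : EuclideanSpace ℝ (Fin d)) 1)]
    [MulAction G (EuclideanSpace ℝ (Fin d))]
    [ContinuousSMul G (EuclideanSpace ℝ (Fin d))]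
    (hfree_sphere : ∀ g : G, g ≠ 1 →
      ∀ x : (Metric.sphere (0 : EuclideanSpace ℝ (Fin d)) 1), g • x ≠ x)
    (hfix : ∀ g : G, g • (0 : EuclideanSpace ℝ (Fin d)) = 0)
    (hsemifree : ∀ g : G, g ≠ 1 → ∀ x : EuclideanSpace ℝ (Fin d), x ≠ 0 → g • x ≠ x)
    (f : EuclideanSpace ℝ (Fin d) → EuclideanSpace ℝ (Fin d))
    (hf : ContinuousOn f (Metric.closedBall 0 1))
    (hequiv : ∀ (g : G) (x : (Metric.sphere (0 : EuclideanSpace ℝ (Fin d)) 1)),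
      f ↑(g • x) = g • f ↑x) :
    ∃ x ∈ Metric.closedBall (0 : EuclideanSpace ℝ (Fin d)) 1, f x = 0 := by
  by_contra! hf0
  obtain ⟨g, hg⟩ := exists_ne (1 : G)
  have hN : 1 < orderOf g := by
    have h0 := orderOf_pos g
    have h1 := orderOf_eq_one_iff.not.2 hg
    omega
  set r : EuclideanSpace ℝ (Fin d) → EuclideanSpace ℝ (Fin d) := fun x => (max 1 ‖x‖)⁻¹ • x
  have hpos : ∀ x : EuclideanSpace ℝ (Fin d), 0 < max 1 ‖x‖ := fun x =>
    lt_max_of_lt_left one_pos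
  have hr : Continuous r :=
    ((continuous_const.max continuous_norm).inv₀ fun x => (hpos x).ne').smul continuous_id
  have hrmem : ∀ x, r x ∈ Metric.closedBall (0 : EuclideanSpace ℝ (Fin d)) 1 := fun x => by
    rw [mem_closedBall_zero_iff, norm_smul, norm_inv, Real.norm_of_nonneg (hpos x).le,
      inv_mul_le_one₀ (hpos x)]
    exact le_max_right _ _
  have hrS : ∀ x : Metric.sphere (0 : EuclideanSpace ℝ (Fin d)) 1, r x = x := fun x => by
    simp [r, norm_eq_of_mem_sphere x]
  have hne : ∀ x : EuclideanSpace ℝ (Fin d), x ≠ 0 → g • x ≠ 0 := fun x hx h => hx <| by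
    rw [← inv_smul_smul g x, h, hfix]
  set a : Metric.sphere (0 : EuclideanSpace ℝ (Fin d)) 1 → Metric.sphere _ 1 := fun x => g • x
  set b : {x : EuclideanSpace ℝ (Fin d) // x ≠ 0} → {x : EuclideanSpace ℝ (Fin d) // x ≠ 0} :=
    fun x => ⟨g • x.1, hne x.1 x.2⟩
  have hbi : ∀ i x, (b^[i] x).1 = g ^ i • x.1 := by
    intro i
    induction i with
    | zero => simp
    | succ i ih => intro x; rw [Function.iterate_succ_apply, ih, pow_succ, mul_smul]
  refine ListChain.not_equivariant_of_extends (a := a) (b := b)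
    (h := fun x => ⟨f (r x), hf0 _ (hrmem x)⟩) hd hN (continuous_const_smul g) ?_
    (((continuous_const_smul g).comp continuous_subtype_val).subtype_mk _) ?_ ?_
    ((hf.comp_continuous hr hrmem).subtype_mk _) ?_
  · funext x
    simp only [a, smul_iterate, pow_orderOf_eq_one, one_smul, id]
  · funext x
    exact Subtype.ext (by rw [hbi, pow_orderOf_eq_one, one_smul, id])
  · intro y
    have key : ∀ i j, i ≤ j → j < orderOf g → b^[i] y = b^[j] y → i = j := by
      intro i j hij hj h
      by_contra hne'
      have h1 : g ^ i • y.1 = g ^ j • y.1 := by rw [← hbi, ← hbi, h]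
      have h2 : g ^ (j - i) ≠ 1 := pow_ne_one_of_lt_orderOf (by omega) (by omega)
      refine hsemifree _ h2 y.1 y.2 (MulAction.injective (g ^ i) ?_)
      change g ^ i • g ^ (j - i) • y.1 = g ^ i • y.1
      rw [← mul_smul, ← pow_add, Nat.add_sub_cancel' hij, h1]
    intro i hi j hj h
    rcases le_total i j with hij | hij
    · exact key i j hij hj h
    · exact (key j i hij hi h.symm).symm
  · funext x
    exact Subtype.ext (by simp only [Function.comp_apply, hrS, a, b, hequiv])
end

section
/- Let n ≥ 1, let q ≥ 2 be a natural number, and let ζ = Complex.exp(2 * π * I / q). If f : EuclideanSpace ℂ (Fin n) → EuclideanSpace ℂ (Fin n) is continuous on the closed unit ball Metric.closedBall 0 1 and satisfies f(ζ • x) = ζ • f(x) for every x with ‖x‖ = 1, then there exists x with ‖x‖ ≤ 1 and f(x) = 0. -/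
open Complex

section

open MeasureTheory Module
open scoped ContDiff

section

variable {E : Type*} [NormedAddCommGroup E] [NormedSpace ℝ E] [FiniteDimensional ℝ E]

/-- The determinant with respect to a basis, as a continuous alternating map. -/
noncomputable def Module.Basis.continuousDet {ι : Type*} [Fintype ι] [DecidableEq ι]
    (b : Basis ι ℝ E) : E [⋀^ι]→L[ℝ] ℝ :=
  { b.det with
    cont := by
      change Continuous fun v : ι → E => b.det v
      simp only [Basis.det_apply]
      refine Continuous.matrix_det (continuous_matrix fun i j => ?_)
      exact ((b.coord i).continuous_of_finiteDimensional).comp (continuous_apply j) }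

theorem Module.Basis.continuousDet_comp {ι : Type*} [Fintype ι] [DecidableEq ι]
    (b : Basis ι ℝ E) (A : E →L[ℝ] E) : b.continuousDet (fun i => A (b i)) = A.det := by
  change b.det (A.toLinearMap ∘ b) = _
  rw [b.det_comp, b.det_self, mul_one]

variable [MeasurableSpace E] [BorelSpace E] (μ : Measure E) [μ.IsAddHaarMeasure]

theorem integral_fderiv_apply_eq_zero {a : E → ℝ} (ha : ContDiff ℝ 1 a)
    (hs : HasCompactSupport a) (v : E) : ∫ x, fderiv ℝ a x v ∂μ = 0 := by
  have h1 : Integrable (fun x => fderiv ℝ a x v) μ :=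
    ((ha.continuous_fderiv one_ne_zero).clm_apply continuous_const).integrable_of_hasCompactSupport
      (hs.fderiv_apply ℝ v)
  have := integral_mul_fderiv_eq_neg_fderiv_mul_of_integrable (μ := μ) (f := fun _ : E => (1 : ℝ))
    (g := a) (v := v) (by simp) (by simpa using h1)
    (by simpa using ha.continuous.integrable_of_hasCompactSupport hs) (by simp)
    (fun x _ => ha.differentiable one_ne_zero x)
  simpa using this

/-- Homotopy invariance of the integral of the pullback of a compactly supported top form. -/
theorem integral_comp_mul_det_fderiv_eq_of_homotopy {Φ : ℝ × E → E} (hΦ : ContDiff ℝ 2 Φ)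
    {φ : E → ℝ} (hφ : ContDiff ℝ 1 φ) {R : ℝ} (hR : ∀ t x, R ≤ ‖x‖ → φ (Φ (t, x)) = 0) :
    ∫ x, φ (Φ (0, x)) * (fderiv ℝ (fun y => Φ (0, y)) x).det ∂μ =
      ∫ x, φ (Φ (1, x)) * (fderiv ℝ (fun y => Φ (1, y)) x).det ∂μ := by
  set b := finBasis ℝ E
  have hΦd : Differentiable ℝ Φ := hΦ.differentiable two_ne_zero
  have hΦ' : ContDiff ℝ 1 (fderiv ℝ Φ) := hΦ.fderiv_right (by norm_num)
  let η : E → E [⋀^Fin (finrank ℝ E)]→L[ℝ] ℝ := fun y => φ y • b.continuousDet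
  have hη : ContDiff ℝ 1 η := hφ.smul contDiff_const
  let W : ℝ × E → (ℝ × E) [⋀^Fin (finrank ℝ E)]→L[ℝ] ℝ :=
    fun p => (η (Φ p)).compContinuousLinearMap (fderiv ℝ Φ p)
  have hWd : Differentiable ℝ W := fun p =>
    ((hη.differentiable one_ne_zero).comp hΦd p).continuousAlternatingMapCompContinuousLinearMap
      (hΦ'.differentiable one_ne_zero p)
  have hWv : ∀ v, ContDiff ℝ 1 fun p => W p v := fun v =>
    (hφ.comp (hΦ.of_le one_le_two)).mul
      (b.continuousDet.toContinuousMultilinearMap.contDiff.comp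
        (contDiff_pi.2 fun i => hΦ'.clm_apply contDiff_const))
  have hW0 : ∀ v t x, R ≤ ‖x‖ → W (t, x) v = 0 := fun v t x hx => by
    change φ (Φ (t, x)) * _ = 0
    rw [hR t x hx, zero_mul]
  have hWx : ∀ v t, HasCompactSupport fun x => W (t, x) v := fun v t =>
    HasCompactSupport.intro (isCompact_closedBall (0 : E) R) fun x hx => hW0 v t x (by
      simpa using (not_le.1 (by simpa using hx)).le)
  let V : Fin (finrank ℝ E + 1) → ℝ × E := Fin.cons (1, 0) fun j => (0, b j)
  have hclosed : ∀ p, ∑ i, (-1 : ℤ) ^ i.val • fderiv ℝ (W · (i.removeNth V)) p (V i) = 0 := by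
    intro p
    rw [← extDeriv_apply (hWd p), extDeriv_pullback (hη.differentiable one_ne_zero _)
      (hΦ.contDiffAt (x := p)) (by simp)]
    refine AlternatingMap.map_linearDependent
      (extDeriv η (Φ p)).toAlternatingMap _ fun hli => ?_
    simpa using hli.fintype_card_le_finrank
  have hdet : ∀ t x, W (t, x) ((0 : Fin (finrank ℝ E + 1)).removeNth V) =
      φ (Φ (t, x)) * (fderiv ℝ (fun y => Φ (t, y)) x).det := by
    intro t x
    change φ (Φ (t, x)) * b.continuousDet (fun j => fderiv ℝ Φ (t, x) (0, b j)) = _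
    rw [← b.continuousDet_comp]
    congr 2
    ext j
    have := (hΦd (t, x)).hasFDerivAt.comp x (hasFDerivAt_prodMk_right t x)
    erw [this.fderiv]
    simp
  have htime : ∀ t x, HasDerivAt (fun s => W (s, x) ((0 : Fin (finrank ℝ E + 1)).removeNth V))
      (fderiv ℝ (W · ((0 : Fin (finrank ℝ E + 1)).removeNth V)) (t, x) (1, 0)) t := fun t x =>
    HasFDerivAt.comp_hasDerivAt (f := fun s : ℝ => (s, x)) t
      ((hWv _).differentiable one_ne_zero (t, x)).hasFDerivAt
      ((hasDerivAt_id t).prodMk (hasDerivAt_const t x))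
  have hspace : ∀ v t (w : E), ∫ x, fderiv ℝ (W · v) (t, x) (0, w) ∂μ = 0 := by
    intro v t w
    refine Eq.trans (integral_congr_ae (.of_forall fun x => ?_)) (integral_fderiv_apply_eq_zero μ
      ((hWv v).comp (contDiff_const.prodMk contDiff_id : ContDiff ℝ 1 fun x : E => (t, x)))
      (hWx v t) w)
    have := ((hWv v).differentiable one_ne_zero (t, x)).hasFDerivAt.comp x
      (hasFDerivAt_prodMk_right t x)
    change _ = fderiv ℝ ((W · v) ∘ Prod.mk t) x w
    simp [this.fderiv]
  set u : ℝ → E → ℝ :=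
    fun t x => fderiv ℝ (W · ((0 : Fin (finrank ℝ E + 1)).removeNth V)) (t, x) (1, 0) with hu
  have huc : Continuous (Function.uncurry u) :=
    ((hWv _).continuous_fderiv one_ne_zero).clm_apply continuous_const
  have hderiv0 : ∀ v w t x, R < ‖x‖ → fderiv ℝ (W · v) (t, x) w = 0 := by
    intro v w t x hx
    have : (W · v) =ᶠ[nhds (t, x)] fun _ => 0 := by
      filter_upwards [(isOpen_lt continuous_const (continuous_norm.comp continuous_snd)).mem_nhds
        (show (t, x) ∈ {p : ℝ × E | R < ‖p.2‖} from hx)] with p hp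
      exact hW0 v p.1 p.2 (le_of_lt hp)
    rw [this.fderiv_eq]
    simp
  have hu_int : ∀ t, ∫ x, u t x ∂μ = 0 := by
    intro t
    have hsum : ∀ x, u t x = - ∑ j : Fin (finrank ℝ E), (-1 : ℝ) ^ (j.succ : ℕ) *
        fderiv ℝ (W · (j.succ.removeNth V)) (t, x) (0, b j) := by
      intro x
      have := hclosed (t, x)
      rw [Fin.sum_univ_succ] at this
      simpa [V, u] using eq_neg_of_add_eq_zero_left this
    simp_rw [hsum]
    rw [integral_neg, integral_finsetSum]
    · simp only [integral_const_mul, hspace, mul_zero, Finset.sum_const_zero, neg_zero]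
    · intro j _
      refine Integrable.const_mul ?_ _
      refine Continuous.integrable_of_hasCompactSupport ?_ ?_
      · exact (((hWv _).continuous_fderiv one_ne_zero).comp (by fun_prop)).clm_apply
          continuous_const
      · exact HasCompactSupport.intro (isCompact_closedBall (0 : E) R) fun x hx =>
          hderiv0 _ _ t x (by simpa using hx)
  have hswap : ∫ t in (0 : ℝ)..1, ∫ x, u t x ∂μ = ∫ x, (∫ t in (0 : ℝ)..1, u t x) ∂μ := by
    refine intervalIntegral_integral_swap ?_
    have hK : IntegrableOn (Function.uncurry u) (Set.Icc (0 : ℝ) 1 ×ˢ Metric.closedBall (0 : E) R)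
        (volume.prod μ) :=
      huc.continuousOn.integrableOn_compact (isCompact_Icc.prod (isCompact_closedBall 0 R))
    rw [← Measure.restrict_univ (μ := μ), Measure.prod_restrict]
    refine IntegrableOn.of_forall_sdiff_eq_zero (s := Set.Ioc (0 : ℝ) 1 ×ˢ Metric.closedBall 0 R)
      (hK.mono_set (Set.prod_mono_left Set.Ioc_subset_Icc_self)) ?_ ?_
    · exact measurableSet_uIoc.prod MeasurableSet.univ
    · rintro ⟨t, x⟩ hx
      refine hderiv0 _ _ t x ?_
      simp only [Set.mem_sdiff, Set.mem_prod, Set.mem_univ, and_true, zero_le_one, Set.uIoc_of_le,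
        Metric.mem_closedBall, dist_zero_right, not_and, not_le] at hx
      exact hx.2 hx.1
  have hftc : ∀ x, ∫ t in (0 : ℝ)..1, u t x =
      W (1, x) ((0 : Fin (finrank ℝ E + 1)).removeNth V) -
        W (0, x) ((0 : Fin (finrank ℝ E + 1)).removeNth V) := fun x =>
    intervalIntegral.integral_eq_sub_of_hasDerivAt (fun t _ => htime t x)
      ((huc.comp (by fun_prop : Continuous fun t : ℝ => (t, x))).intervalIntegrable _ _)
  simp_rw [hu_int, hftc] at hswap
  rw [integral_sub, intervalIntegral.integral_zero] at hswap
  · simp_rw [hdet] at hswap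
    linarith
  all_goals
    exact ((hWv _).continuous.comp (by fun_prop)).integrable_of_hasCompactSupport (hWx _ _)

end

section

variable {E : Type*} [NormedAddCommGroup E] [NormedSpace ℝ E]

theorem ContDiff.continuous_det_fderiv {g : E → E} (hg : ContDiff ℝ 1 g) :
    Continuous fun x => (fderiv ℝ g x).det :=
  ContinuousLinearMap.continuous_det.comp (hg.continuous_fderiv one_ne_zero)

variable [FiniteDimensional ℝ E]

theorem ContDiff.exists_isOpen_injOn {g : E → E} (hg : ContDiff ℝ 1 g) {z : E}
    (hz : (fderiv ℝ g z).det ≠ 0) : ∃ U, IsOpen U ∧ z ∈ U ∧ Set.InjOn g U ∧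
      (∀ x ∈ U, SignType.sign (fderiv ℝ g x).det = SignType.sign (fderiv ℝ g z).det) ∧
      ∀ V ⊆ U, IsOpen V → IsOpen (g '' V) := by
  have hd : HasFDerivAt g
      (((fderiv ℝ g z).toContinuousLinearEquivOfDetNeZero hz : E ≃L[ℝ] E) : E →L[ℝ] E) z := by
    simpa using (hg.differentiable one_ne_zero z).hasFDerivAt
  let e := hg.contDiffAt.toOpenPartialHomeomorph g hd one_ne_zero
  have hsign : ∀ᶠ x in nhds z,
      SignType.sign (fderiv ℝ g x).det = SignType.sign (fderiv ℝ g z).det := by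
    have hc := hg.continuous_det_fderiv
    rcases hz.lt_or_gt with h | h
    · filter_upwards [hc.continuousAt.eventually_lt continuousAt_const h] with x hx
      rw [sign_neg hx, sign_neg h]
    · filter_upwards [continuousAt_const.eventually_lt hc.continuousAt h] with x hx
      rw [sign_pos hx, sign_pos h]
  obtain ⟨V, hV, hVo, hzV⟩ := eventually_nhds_iff.1 hsign
  refine ⟨e.source ∩ V, e.open_source.inter hVo,
    ⟨hg.contDiffAt.mem_toOpenPartialHomeomorph_source hd one_ne_zero, hzV⟩,
    e.injOn.mono Set.inter_subset_left, fun x hx => hV x hx.2, fun W hW hWo => ?_⟩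
  exact e.isOpen_image_of_subset_source hWo (hW.trans Set.inter_subset_left)

theorem ContDiff.finite_zeros {g : E → E} (hg : ContDiff ℝ 1 g)
    (hreg : ∀ x, g x = 0 → (fderiv ℝ g x).det ≠ 0) {R : ℝ} (hR : ∀ x, R ≤ ‖x‖ → g x ≠ 0) :
    {x | g x = 0}.Finite := by
  choose! U hUo hzU hinj _ _ using fun z (hz : g z = 0) => hg.exists_isOpen_injOn (hreg z hz)
  have hcpt : IsCompact {x | g x = 0} := by
    refine (isCompact_closedBall (0 : E) R).of_isClosed_subset
      (isClosed_eq hg.continuous continuous_const) fun x hx => ?_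
    by_contra h
    exact hR x (not_le.1 (by simpa using h)).le hx
  obtain ⟨t, ht, hcov⟩ := hcpt.elim_nhds_subcover U fun z hz => (hUo z hz).mem_nhds (hzU z hz)
  refine t.finite_toSet.subset fun x hx => ?_
  obtain ⟨z, hz, hxz⟩ := Set.mem_iUnion₂.1 (hcov hx)
  have : x = z := hinj z (ht z hz) hxz (hzU z (ht z hz)) ((show g x = 0 from hx).trans (ht z hz).symm)
  exact this ▸ hz

variable [MeasurableSpace E] [BorelSpace E] (μ : Measure E) [μ.IsAddHaarMeasure]

/-- The analytic degree of a map with nondegenerate zeros is the sum of the signs of its Jacobian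
determinants at the zeros. -/
theorem ContDiff.exists_integral_comp_mul_det_fderiv_eq {g : E → E} (hg : ContDiff ℝ 1 g)
    {Z : Finset E} (hZ : ∀ x, x ∈ Z ↔ g x = 0)
    (hreg : ∀ x, g x = 0 → (fderiv ℝ g x).det ≠ 0) {R c : ℝ} (hc : 0 < c)
    (hR : ∀ x, R ≤ ‖x‖ → c ≤ ‖g x‖) :
    ∃ δ > 0, ∀ φ : E → ℝ, Continuous φ → (∀ y, δ ≤ ‖y‖ → φ y = 0) →
      ∫ x, φ (g x) * (fderiv ℝ g x).det ∂μ =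
        (∑ z ∈ Z, (SignType.sign (fderiv ℝ g z).det : ℝ)) * ∫ y, φ y ∂μ := by
  choose! U₀ hUo₀ hzU₀ hinj₀ hsign₀ himg₀ using
    fun z (hz : g z = 0) => hg.exists_isOpen_injOn (hreg z hz)
  obtain ⟨T, hT, hdisj⟩ := Z.finite_toSet.t2_separation
  set U : E → Set E := fun z => U₀ z ∩ T z with hU
  have hUo : ∀ z ∈ Z, IsOpen (U z) := fun z hz => (hUo₀ z ((hZ z).1 hz)).inter (hT z).2
  have hzU : ∀ z ∈ Z, z ∈ U z := fun z hz => ⟨hzU₀ z ((hZ z).1 hz), (hT z).1⟩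
  have hUd : (Z : Set E).PairwiseDisjoint U := hdisj.mono fun z => Set.inter_subset_right
  have himg : ∀ z ∈ Z, g '' U z ∈ nhds 0 := fun z hz =>
    (himg₀ z ((hZ z).1 hz) _ Set.inter_subset_left (hUo z hz)).mem_nhds
      ⟨z, hzU z hz, (hZ z).1 hz⟩
  have hball : ∀ᶠ δ in nhdsWithin (0 : ℝ) (Set.Ioi 0), ∀ z ∈ Z, Metric.ball 0 δ ⊆ g '' U z := by
    rw [Filter.eventually_all_finset]
    intro z hz
    obtain ⟨r, hr, hrU⟩ := Metric.mem_nhds_iff.1 (himg z hz)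
    filter_upwards [Ioo_mem_nhdsGT hr] with δ hδ
    exact (Metric.ball_subset_ball hδ.2.le).trans hrU
  have hfar : ∀ᶠ δ in nhdsWithin (0 : ℝ) (Set.Ioi 0), ∀ x, ‖g x‖ < δ → x ∈ ⋃ z ∈ Z, U z := by
    have hK : IsCompact (Metric.closedBall (0 : E) R \ ⋃ z ∈ Z, U z) :=
      (isCompact_closedBall 0 R).diff (isOpen_biUnion hUo)
    obtain ⟨m, hm, hmK⟩ : ∃ m > 0, ∀ x ∈ Metric.closedBall (0 : E) R \ ⋃ z ∈ Z, U z,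
        m ≤ ‖g x‖ := by
      refine hK.exists_forall_le' (a := 0) hg.continuous.norm.continuousOn fun x hx => ?_
      refine norm_pos_iff.2 fun h0 => hx.2 ?_
      exact Set.mem_biUnion ((hZ x).2 h0) (hzU x ((hZ x).2 h0))
    filter_upwards [Ioo_mem_nhdsGT (lt_min hm hc)] with δ hδ x hx
    by_contra hxU
    have hδ' := lt_min_iff.1 hδ.2
    by_cases hxR : ‖x‖ ≤ R
    · exact absurd (hmK x ⟨by simpa using hxR, hxU⟩) (by linarith)
    · exact absurd (hR x (not_le.1 hxR).le) (by linarith)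
  obtain ⟨δ, ⟨hδU, hδfar⟩, hδ, hδc⟩ := ((hball.and hfar).and (Ioo_mem_nhdsGT hc)).exists
  refine ⟨δ, hδ, fun φ hφ hφ0 => ?_⟩
  have hint : Integrable (fun x => φ (g x) * (fderiv ℝ g x).det) μ := by
    refine Continuous.integrable_of_hasCompactSupport
      ((hφ.comp hg.continuous).mul hg.continuous_det_fderiv) ?_
    refine HasCompactSupport.intro (isCompact_closedBall (0 : E) R) fun x hx => ?_
    rw [hφ0 _ (hδc.le.trans (hR x (not_le.1 (by simpa using hx)).le)), zero_mul]
  rw [← setIntegral_eq_integral_of_forall_compl_eq_zero (s := ⋃ z ∈ Z, U z),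
    integral_biUnion_finset Z (fun z hz => (hUo z hz).measurableSet) hUd
      fun z _ => hint.integrableOn, Finset.sum_mul]
  · refine Finset.sum_congr rfl fun z hz => ?_
    have hz0 := (hZ z).1 hz
    have := integral_image_eq_integral_abs_det_fderiv_smul μ (hUo z hz).measurableSet
      (fun x _ => (hg.differentiable one_ne_zero x).hasFDerivAt.hasFDerivWithinAt)
      ((hinj₀ z hz0).mono Set.inter_subset_left) φ
    rw [setIntegral_eq_integral_of_forall_compl_eq_zero] at this
    · rw [this, ← integral_const_mul]
      refine setIntegral_congr_fun (hUo z hz).measurableSet fun x hx => ?_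
      rw [← hsign₀ z hz0 x hx.1, smul_eq_mul, ← mul_assoc, sign_mul_abs, mul_comm]
    · intro y hy
      by_contra h
      exact hy (hδU z hz (by simpa using lt_of_not_ge fun h' => h (hφ0 y h')))
  · intro x hx
    rw [hφ0, zero_mul]
    exact le_of_not_gt fun h => hx (hδfar x h)

end

section

/-- A bounded smooth map `ℂ → ℂ` commuting with rotations, vanishing only at `0`, where its
derivative vanishes too. -/
noncomputable def flatRadial (z : ℂ) : ℂ := (‖z‖ ^ 2 / (1 + ‖z‖ ^ 2) ^ 2) • z

theorem contDiff_flatRadial_coeff :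
    ContDiff ℝ ∞ fun z : ℂ => ‖z‖ ^ 2 / (1 + ‖z‖ ^ 2) ^ 2 :=
  (contDiff_norm_sq ℝ).div ((contDiff_const.add (contDiff_norm_sq ℝ)).pow 2)
    fun z => by positivity

theorem contDiff_flatRadial : ContDiff ℝ ∞ flatRadial :=
  contDiff_flatRadial_coeff.smul contDiff_id

theorem flatRadial_eq_zero {z : ℂ} : flatRadial z = 0 ↔ z = 0 := by
  have h : (1 + ‖z‖ ^ 2) ^ 2 ≠ 0 := by positivity
  rw [flatRadial, smul_eq_zero, div_eq_zero_iff, or_iff_left h, sq_eq_zero_iff, norm_eq_zero,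
    or_self]

theorem norm_flatRadial_le (z : ℂ) : ‖flatRadial z‖ ≤ 1 := by
  have h0 := norm_nonneg z
  rw [flatRadial, norm_smul, Real.norm_of_nonneg (by positivity), div_mul_eq_mul_div,
    div_le_one (by positivity)]
  nlinarith [sq_nonneg (‖z‖ ^ 2 - ‖z‖), sq_nonneg (‖z‖), sq_nonneg (‖z‖ ^ 2 - 1)]

theorem flatRadial_mul {u : ℂ} (hu : ‖u‖ = 1) (z : ℂ) : flatRadial (u * z) = u * flatRadial z := by
  simp only [flatRadial, norm_mul, hu, one_mul, mul_smul_comm]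

theorem hasFDerivAt_flatRadial_zero : HasFDerivAt flatRadial (0 : ℂ →L[ℝ] ℂ) 0 := by
  have := (contDiff_flatRadial_coeff.differentiable (by simp) 0).hasFDerivAt.smul
    (hasFDerivAt_id (𝕜 := ℝ) (0 : ℂ))
  exact this.congr_fderiv (by ext; simp)

variable {E : Type*} [NormedAddCommGroup E] [NormedSpace ℝ E] [FiniteDimensional ℝ E]
  [NormedSpace ℂ E] [IsScalarTower ℝ ℂ E]

theorem exists_small_sub_smul_regular {G : E → E} (hG : Differentiable ℝ G) {ψ : E → ℂ}
    (hψ : Differentiable ℝ ψ) {ε : ℝ} (hε : 0 < ε) :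
    ∃ y : E, ‖y‖ < ε ∧ ∀ x, ψ x ≠ 0 → G x - ψ x • y = 0 →
      (fderiv ℝ (fun x => G x - ψ x • y) x).det ≠ 0 := by
  borelize E
  set K : E → E := fun x => (ψ x)⁻¹ • G x
  have hK : ∀ x, ψ x ≠ 0 → DifferentiableAt ℝ K x := fun x hx => ((hψ x).inv hx).smul (hG x)
  set S : Set E := {x | ψ x ≠ 0 ∧ (fderiv ℝ K x).det = 0}
  have hS : (Measure.addHaar : Measure E) (K '' S) = 0 :=
    addHaar_image_eq_zero_of_det_fderivWithin_eq_zero _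
      (fun x hx => (hK x hx.1).hasFDerivAt.hasFDerivWithinAt) fun x hx => hx.2
  obtain ⟨y, hyε, hyS⟩ : ∃ y ∈ Metric.ball (0 : E) ε, y ∉ K '' S := by
    by_contra! h
    exact (Metric.measure_ball_pos Measure.addHaar (0 : E) hε).ne' (measure_mono_null h hS)
  refine ⟨y, by simpa using hyε, fun x hx h0 hdet => hyS ⟨x, ⟨hx, ?_⟩, ?_⟩⟩
  all_goals
    have hKy : K x = y := by
      rw [sub_eq_zero] at h0
      simp [K, h0, smul_smul, hx]
  · have hev : (fun x => G x - ψ x • y) =ᶠ[nhds x] fun x => ψ x • (K x - y) := by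
      filter_upwards [hψ.continuous.continuousAt.eventually_ne hx] with x' hx'
      simp [K, smul_sub, smul_smul, hx']
    have hd := (hψ x).hasFDerivAt.smul ((hK x hx).hasFDerivAt.sub_const y)
    rw [hKy, sub_self] at hd
    have hd' : fderiv ℝ (fun x => G x - ψ x • y) x = ψ x • fderiv ℝ K x := by
      rw [hev.fderiv_eq]
      refine hd.fderiv.trans ?_
      ext; simp
    rw [hd'] at hdet
    have hdet' : LinearMap.det ((DistribSMul.toLinearMap ℝ E (ψ x)) ∘ₗ
      (fderiv ℝ K x).toLinearMap) = 0 := hdet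
    rw [LinearMap.det_comp] at hdet'
    refine (mul_eq_zero.1 hdet').resolve_left fun h => ?_
    have hinv : (DistribSMul.toLinearMap ℝ E (ψ x)) ∘ₗ (DistribSMul.toLinearMap ℝ E (ψ x)⁻¹) =
        LinearMap.id := by
      ext v; simp [smul_smul, hx]
    have := congrArg LinearMap.det hinv
    rw [LinearMap.det_comp, h, zero_mul, LinearMap.det_id] at this
    exact zero_ne_one this
  · exact hKy

theorem exists_small_sub_sum_smul_regular {ι : Type*} {G : E → E} (hG : Differentiable ℝ G)
    {ψ : ι → E → ℂ} (hψ : ∀ k, Differentiable ℝ (ψ k))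
    (hψ0 : ∀ k x, ψ k x = 0 → fderiv ℝ (ψ k) x = 0) {ε : ℝ} (hε : 0 < ε) (s : Finset ι) :
    ∃ y : ι → E, (∀ k, ‖y k‖ < ε) ∧ ∀ x, (∃ k ∈ s, ψ k x ≠ 0) →
      G x - ∑ k ∈ s, ψ k x • y k = 0 →
      (fderiv ℝ (fun x => G x - ∑ k ∈ s, ψ k x • y k) x).det ≠ 0 := by
  classical
  induction s using Finset.induction_on with
  | empty => exact ⟨0, fun _ => by simpa using hε, by simp⟩
  | insert a s ha ih =>
    obtain ⟨y, hy, hreg⟩ := ih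
    set G' : E → E := fun x => G x - ∑ k ∈ s, ψ k x • y k with hG'
    have hG'd : Differentiable ℝ G' :=
      hG.sub (Differentiable.fun_sum fun k _ => (hψ k).smul_const (y k))
    obtain ⟨w, hw, hregw⟩ := exists_small_sub_smul_regular hG'd (hψ a) hε
    have hfun : (fun x => G x - ∑ k ∈ insert a s, ψ k x • Function.update y a w k) =
        fun x => G' x - ψ a x • w := by
      ext1 x
      rw [Finset.sum_insert ha, Function.update_self, Finset.sum_congr rfl fun k hk => by
        rw [Function.update_of_ne (ne_of_mem_of_not_mem hk ha)]]
      exact (sub_sub _ _ _).symm.trans (sub_right_comm _ _ _)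
    refine ⟨Function.update y a w, fun k => ?_, fun x hx h0 => ?_⟩
    · rcases eq_or_ne k a with rfl | hk
      · simpa using hw
      · simpa [hk] using hy k
    · have h0' := (congrFun hfun x).symm.trans h0
      rw [hfun]
      by_cases hax : ψ a x = 0
      · have hd : fderiv ℝ (fun x => G' x - ψ a x • w) x = fderiv ℝ G' x := by
          have := (hG'd x).hasFDerivAt.sub ((hψ a x).hasFDerivAt.smul_const w)
          rw [hψ0 a x hax] at this
          refine this.fderiv.trans ?_
          ext; simp
        rw [hd]
        refine hreg x ?_ (by simpa [hax] using h0')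
        obtain ⟨k, hk, hkx⟩ := hx
        refine ⟨k, (Finset.mem_insert.1 hk).resolve_left ?_, hkx⟩
        rintro rfl
        exact hkx hax
      · exact hregw x hax h0'

end

section

variable {E : Type*} [NormedAddCommGroup E] [NormedSpace ℝ E] [FiniteDimensional ℝ E]

theorem sum_sign_det_fderiv_eq_zero_of_homotopy {f g : E → E} (hf : ContDiff ℝ 2 f)
    (hg : ContDiff ℝ 2 g) {Z : Finset E} (hZ : ∀ x, x ∈ Z ↔ g x = 0)
    (hreg : ∀ x, g x = 0 → (fderiv ℝ g x).det ≠ 0) {R c : ℝ} (hc : 0 < c)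
    (hfc : ∀ x, c ≤ ‖f x‖)
    (hR : ∀ x, R ≤ ‖x‖ → ∀ t ∈ Set.Icc (0 : ℝ) 1, c ≤ ‖f x + t • (g x - f x)‖) :
    ∑ z ∈ Z, (SignType.sign (fderiv ℝ g z).det : ℝ) = 0 := by
  borelize E
  let μ : Measure E := Measure.addHaar
  obtain ⟨δ, hδ, hint⟩ := (hg.of_le one_le_two).exists_integral_comp_mul_det_fderiv_eq μ hZ hreg hc
    fun x hx => by simpa using hR x hx 1 (by simp)
  have hm : 0 < min δ c := lt_min hδ hc
  let φ : ContDiffBump (0 : E) := ⟨min δ c / 2, min δ c, by positivity, by linarith⟩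
  have hφ0 : ∀ y, min δ c ≤ ‖y‖ → φ y = 0 := fun y hy =>
    φ.zero_of_le_dist (by rw [dist_zero_right]; exact hy)
  have hφpos : 0 < ∫ y, φ y ∂μ := φ.integral_pos
  let Φ : ℝ × E → E := fun p => f p.2 + Real.smoothTransition p.1 • (g p.2 - f p.2)
  have hΦ : ContDiff ℝ 2 Φ :=
    (hf.comp contDiff_snd).add ((Real.smoothTransition.contDiff.comp contDiff_fst).smul
      ((hg.comp contDiff_snd).sub (hf.comp contDiff_snd)))
  have hhom := integral_comp_mul_det_fderiv_eq_of_homotopy μ hΦ (φ := φ) φ.contDiff (R := R)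
    fun t x hx => hφ0 _ ((min_le_right _ _).trans (hR x hx _
      ⟨Real.smoothTransition.nonneg t, Real.smoothTransition.le_one t⟩))
  have hΦ0 : (fun y => Φ (0, y)) = f := by ext1 x; simp [Φ, Real.smoothTransition.zero]
  have hΦ1 : (fun y => Φ (1, y)) = g := by ext1 x; simp [Φ, Real.smoothTransition.one]
  rw [hΦ0, hΦ1] at hhom
  simp_rw [fun x => congrFun hΦ0 x, fun x => congrFun hΦ1 x] at hhom
  rw [hint φ φ.continuous fun y hy => hφ0 y ((min_le_left _ _).trans hy)] at hhom
  have hzero : ∀ x, φ (f x) * (fderiv ℝ f x).det = 0 := fun x => by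
    rw [hφ0 _ ((min_le_right _ _).trans (hfc x)), zero_mul]
  simp_rw [hzero, integral_zero] at hhom
  exact (mul_eq_zero.1 hhom.symm).resolve_right hφpos.ne'

end

section

variable {E : Type*} [AddCommGroup E] [Module ℂ E]

theorem Nat.Prime.dvd_card_of_smul_mem {p : ℕ} (hp : p.Prime) {u : ℂ} (hup : u ^ p = 1)
    (hu : u ≠ 1) {S : Finset E} (h0 : (0 : E) ∉ S) (hS : ∀ x ∈ S, u • x ∈ S) : p ∣ S.card := by
  classical
  have := Fact.mk hp
  let f : Function.End S := fun x => ⟨u • x.1, hS x.1 x.2⟩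
  have hiter : ∀ (k : ℕ) (x : S), ((f ^ k) x : E) = u ^ k • x.1 := by
    intro k
    induction k with
    | zero => intro x; rw [pow_zero, pow_zero, one_smul]; rfl
    | succ k ih =>
      intro x
      rw [pow_succ, pow_succ, mul_smul]
      exact ih (f x)
  have hf : f ^ p ^ 1 = 1 := by
    funext x
    refine Subtype.ext ?_
    rw [hiter, pow_one, hup, one_smul]
    rfl
  have hcard := Equiv.Perm.card_fixedPoints_modEq hf
  have : IsEmpty f.fixedPoints := by
    refine ⟨fun ⟨x, hx⟩ => ?_⟩
    have hx' : u • x.1 = x.1 := congrArg Subtype.val hx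
    have : (u - 1) • x.1 = 0 := by rw [sub_smul, one_smul, hx', sub_self]
    have hx0 := (smul_eq_zero.1 this).resolve_left (sub_ne_zero.2 hu)
    exact h0 (hx0 ▸ x.2)
  rw [Fintype.card_eq_zero (α := f.fixedPoints), Fintype.card_coe] at hcard
  exact (Nat.modEq_zero_iff_dvd).1 hcard

end

section

variable {E : Type*} [NormedAddCommGroup E] [NormedSpace ℝ E]
  [NormedSpace ℂ E] [IsScalarTower ℝ ℂ E]

theorem det_fderiv_smul_of_equivariant {g : E → E} (hg : Differentiable ℝ g) {u : ℂ}
    (hu : u ≠ 0) (hequiv : ∀ x, g (u • x) = u • g x) (x : E) :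
    (fderiv ℝ g (u • x)).det = (fderiv ℝ g x).det := by
  let L : E ≃ₗ[ℝ] E := DistribMulAction.toLinearEquiv ℝ E (Units.mk0 u hu)
  let M : E →L[ℝ] E := u • ContinuousLinearMap.id ℝ E
  have h1 : HasFDerivAt (fun x => g (u • x)) ((fderiv ℝ g (u • x)).comp M) x :=
    (hg (u • x)).hasFDerivAt.comp x M.hasFDerivAt
  have h2 : HasFDerivAt (fun x => u • g x) (M.comp (fderiv ℝ g x)) x :=
    M.hasFDerivAt.comp x (hg x).hasFDerivAt
  rw [funext hequiv] at h1
  have h3 := h1.unique h2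
  have h4 : (fderiv ℝ g (u • x)).toLinearMap =
      L.toLinearMap ∘ₗ (fderiv ℝ g x).toLinearMap ∘ₗ L.symm.toLinearMap := by
    ext v
    have := congrArg (fun A : E →L[ℝ] E => A (u⁻¹ • v)) h3
    simpa [M, L, smul_smul, hu, Units.smul_def] using this
  change LinearMap.det _ = LinearMap.det _
  rw [h4, LinearMap.det_conj]

theorem sum_sign_det_fderiv_ne_zero_of_equivariant {g : E → E} (hg : Differentiable ℝ g)
    {p : ℕ} (hp : p.Prime) {u : ℂ} (hup : u ^ p = 1) (hu : u ≠ 1)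
    (hequiv : ∀ x, g (u • x) = u • g x) {Z : Finset E} (hZ : ∀ x, x ∈ Z ↔ g x = 0)
    (hreg : ∀ x, g x = 0 → (fderiv ℝ g x).det ≠ 0) (h0 : 0 < (fderiv ℝ g 0).det) :
    ∑ z ∈ Z, (SignType.sign (fderiv ℝ g z).det : ℝ) ≠ 0 := by
  classical
  have hu0 : u ≠ 0 := by
    rintro rfl
    simp [hp.ne_zero] at hup
  have hg0 : g 0 = 0 := by
    have := hequiv 0
    rw [smul_zero] at this
    have h : (u - 1) • g 0 = 0 := by rw [sub_smul, one_smul, ← this, sub_self]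
    exact (smul_eq_zero.1 h).resolve_left (sub_ne_zero.2 hu)
  have hdet := det_fderiv_smul_of_equivariant hg hu0 hequiv
  have hmem : ∀ x ∈ Z.erase 0, u • x ∈ Z.erase 0 := by
    intro x hx
    rw [Finset.mem_erase, hZ] at hx ⊢
    exact ⟨smul_ne_zero hu0 hx.1, by rw [hequiv, hx.2, smul_zero]⟩
  have hdvd : ∀ (P : ℝ → Prop) [DecidablePred P],
      p ∣ ((Z.erase 0).filter fun z => P (fderiv ℝ g z).det).card := by
    intro P _
    refine hp.dvd_card_of_smul_mem hup hu (by simp) fun x hx => ?_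
    rw [Finset.mem_filter] at hx ⊢
    exact ⟨hmem x hx.1, by rw [hdet]; exact hx.2⟩
  obtain ⟨a, ha⟩ := hdvd fun d => 0 < d
  obtain ⟨b, hb⟩ := hdvd fun d => ¬ 0 < d
  rw [← Finset.add_sum_erase Z _ ((hZ 0).2 hg0), sign_pos h0,
    ← Finset.sum_filter_add_sum_filter_not (Z.erase 0) fun z => 0 < (fderiv ℝ g z).det,
    Finset.sum_congr rfl (g := fun _ => (1 : ℝ)) fun z hz => by
      rw [sign_pos (Finset.mem_filter.1 hz).2]; simp,
    Finset.sum_congr (s₁ := (Z.erase 0).filter fun z => ¬ 0 < (fderiv ℝ g z).det) rfl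
      (g := fun _ => (-1 : ℝ)) fun z hz => by
      have hz' := Finset.mem_filter.1 hz
      rw [sign_neg (lt_of_le_of_ne (not_lt.1 hz'.2)
        (hreg z ((hZ z).1 (Finset.mem_of_mem_erase hz'.1))))]
      simp]
  simp only [Finset.sum_const, ha, hb, SignType.coe_one, nsmul_eq_mul, mul_one, mul_neg]
  intro h
  have hz : (p : ℤ) * (b - a) = 1 := by
    have : ((p * b : ℕ) : ℝ) - ((p * a : ℕ) : ℝ) = 1 := by linarith
    push_cast at this
    have : (p : ℝ) * (b - a) = 1 := by linarith
    exact_mod_cast this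
  have := Int.isUnit_iff.1 (IsUnit.of_mul_eq_one _ hz)
  have := hp.two_le
  omega

end

section

variable {E : Type*} [NormedAddCommGroup E] [NormedSpace ℝ E]

theorem ContinuousOn.continuous_radial_extension {f : E → E}
    (hf : ContinuousOn f (Metric.closedBall 0 1)) :
    Continuous fun x => f ((max 1 ‖x‖)⁻¹ • x) := by
  have hpos : ∀ x : E, 0 < max 1 ‖x‖ := fun x => lt_max_of_lt_left one_pos
  refine hf.comp_continuous
    (((continuous_const.max continuous_norm).inv₀ fun x => (hpos x).ne').smul continuous_id)
    fun x => ?_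
  rw [mem_closedBall_zero_iff, norm_smul, norm_inv, Real.norm_of_nonneg (hpos x).le,
    inv_mul_le_one₀ (hpos x)]
  exact le_max_right _ _

end

section

variable {E : Type*} [NormedAddCommGroup E] [NormedSpace ℝ E] [NormedSpace ℂ E]

/-- The average of `g` over the cyclic group generated by multiplication by `u`. -/
noncomputable def cyclicAverage (p : ℕ) (u : ℂ) (g : E → E) (x : E) : E :=
  (p : ℝ)⁻¹ • ∑ k ∈ Finset.range p, (u ^ k)⁻¹ • g (u ^ k • x)

theorem cyclicAverage_smul {p : ℕ} {u : ℂ} (hup : u ^ p = 1) (hu : u ≠ 0) (g : E → E)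
    (x : E) : cyclicAverage p u g (u • x) = u • cyclicAverage p u g x := by
  let a : ℕ → E := fun k => (u ^ k)⁻¹ • g (u ^ k • x)
  have hshift : ∑ k ∈ Finset.range p, a (k + 1) = ∑ k ∈ Finset.range p, a k := by
    have h := (Finset.sum_range_succ' a p).symm.trans (Finset.sum_range_succ a p)
    have hp : a p = a 0 := by simp [a, hup]
    rw [hp] at h
    exact add_right_cancel h
  have h : cyclicAverage p u g (u • x) = (p : ℝ)⁻¹ • u • ∑ k ∈ Finset.range p, a (k + 1) := by
    rw [cyclicAverage, Finset.smul_sum (r := u)]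
    refine congrArg (fun y : E => (p : ℝ)⁻¹ • y) (Finset.sum_congr rfl fun k _ => ?_)
    simp only [a, smul_smul]
    rw [pow_succ, mul_inv, mul_comm u, mul_assoc, inv_mul_cancel₀ hu, mul_one]
  rw [h, hshift, smul_comm]
  rfl

theorem cyclicAverage_eq_of_forall {p : ℕ} (hp : p ≠ 0) {u : ℂ} (hu : u ≠ 0) {g : E → E} {x y : E}
    (h : ∀ k, g (u ^ k • x) = u ^ k • y) : cyclicAverage p u g x = y := by
  have hu' : ∀ k, u ^ k ≠ 0 := fun k => pow_ne_zero k hu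
  simp only [cyclicAverage, h, smul_smul, inv_mul_cancel₀ (hu' _), one_smul, Finset.sum_const,
    Finset.card_range]
  rw [← Nat.cast_smul_eq_nsmul ℝ, smul_smul, inv_mul_cancel₀ (by exact_mod_cast hp), one_smul]

theorem norm_cyclicAverage_sub_le {p : ℕ} (hp : p ≠ 0) {u : ℂ} (hu : ‖u‖ = 1) {g : E → E}
    {x y : E} {c : ℝ} (h : ∀ k, ‖g (u ^ k • x) - u ^ k • y‖ ≤ c) :
    ‖cyclicAverage p u g x - y‖ ≤ c := by
  have hu0 : ∀ k, u ^ k ≠ 0 := fun k => pow_ne_zero k (norm_ne_zero_iff.1 (by rw [hu]; simp))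
  have hp' : (p : ℝ) ≠ 0 := by exact_mod_cast hp
  have hsub : cyclicAverage p u g x - y =
      (p : ℝ)⁻¹ • ∑ k ∈ Finset.range p, (u ^ k)⁻¹ • (g (u ^ k • x) - u ^ k • y) := by
    simp only [cyclicAverage, smul_sub, smul_smul, inv_mul_cancel₀ (hu0 _), one_smul,
      Finset.sum_sub_distrib, Finset.sum_const, Finset.card_range]
    rw [← Nat.cast_smul_eq_nsmul ℝ, smul_smul, inv_mul_cancel₀ hp', one_smul]
  have hsum : ‖∑ k ∈ Finset.range p, (u ^ k)⁻¹ • (g (u ^ k • x) - u ^ k • y)‖ ≤ p * c := by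
    refine (norm_sum_le_of_le _ fun k _ => ?_).trans_eq
      (by rw [Finset.sum_const, Finset.card_range, nsmul_eq_mul])
    rw [norm_smul, norm_inv, norm_pow, hu, one_pow, inv_one, one_mul]
    exact h k
  rw [hsub, norm_smul, norm_inv, Real.norm_natCast, inv_mul_le_iff₀ (by positivity)]
  exact hsum

theorem contDiff_cyclicAverage {n : WithTop ℕ∞} (p : ℕ) (u : ℂ) {g : E → E}
    (hg : ContDiff ℝ n g) : ContDiff ℝ n (cyclicAverage p u g) :=
  (ContDiff.sum fun _ _ => (hg.comp (contDiff_id.const_smul _)).const_smul _).const_smul _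

variable [IsScalarTower ℝ ℂ E] [FiniteDimensional ℝ E]

/-- A `u`-equivariant map which is the identity near the origin has arbitrarily small equivariant
perturbations all of whose zeros are nondegenerate. -/
theorem exists_equivariant_regular_near {ι : Type*} [Fintype ι] (l : ι → E →L[ℂ] ℂ)
    (hl : ∀ x, (∀ k, l k x = 0) → x = 0) {G : E → E} (hG : ContDiff ℝ 2 G)
    (hG0 : G =ᶠ[nhds 0] id) {u : ℂ} (hu : ‖u‖ = 1) (hequiv : ∀ x, G (u • x) = u • G x)
    {ε : ℝ} (hε : 0 < ε) :
    ∃ H : E → E, ContDiff ℝ 2 H ∧ (∀ x, ‖H x - G x‖ ≤ ε) ∧ (∀ x, H (u • x) = u • H x) ∧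
      (∀ x, H x = 0 → (fderiv ℝ H x).det ≠ 0) ∧ 0 < (fderiv ℝ H 0).det := by
  let ψ : ι → E → ℂ := fun k x => flatRadial (l k x)
  have hψ : ∀ k, ContDiff ℝ 2 (ψ k) := fun k =>
    (contDiff_infty.1 contDiff_flatRadial 2).comp
      ((l k).restrictScalars ℝ).contDiff
  have hψd : ∀ k, Differentiable ℝ (ψ k) := fun k => (hψ k).differentiable two_ne_zero
  have hψ0 : ∀ k x, ψ k x = 0 → fderiv ℝ (ψ k) x = 0 := by
    intro k x hx
    have hlx : l k x = 0 := flatRadial_eq_zero.1 hx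
    have h0 := hasFDerivAt_flatRadial_zero
    rw [← hlx] at h0
    have := h0.comp x ((l k).restrictScalars ℝ).hasFDerivAt
    exact this.fderiv.trans (ContinuousLinearMap.zero_comp _)
  have hε' : 0 < ε / (Fintype.card ι + 1) := by positivity
  obtain ⟨y, hy, hreg⟩ := exists_small_sub_sum_smul_regular (hG.differentiable two_ne_zero) hψd hψ0
    hε' Finset.univ
  have hder0 : fderiv ℝ (fun x => G x - ∑ k, ψ k x • y k) 0 = ContinuousLinearMap.id ℝ E := by
    have hs : HasFDerivAt (fun x => ∑ k, ψ k x • y k) (∑ k, (fderiv ℝ (ψ k) 0).smulRight (y k))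
        (0 : E) :=
      HasFDerivAt.fun_sum fun k _ => (hψd k 0).hasFDerivAt.smul_const (y k)
    have hz : ∀ k, fderiv ℝ (ψ k) 0 = 0 := fun k => hψ0 k 0 (by simp [ψ, flatRadial_eq_zero])
    refine (((hasFDerivAt_id (0 : E)).congr_of_eventuallyEq hG0).sub hs).fderiv.trans ?_
    ext
    simp [hz]
  have hdet0 : (fderiv ℝ (fun x => G x - ∑ k, ψ k x • y k) 0).det = 1 := by
    rw [hder0]
    exact LinearMap.det_id
  refine ⟨fun x => G x - ∑ k, ψ k x • y k,
    hG.sub (ContDiff.sum fun k _ => (hψ k).smul contDiff_const), fun x => ?_, fun x => ?_,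
    fun x hx => ?_, by rw [hdet0]; exact one_pos⟩
  · rw [sub_sub_cancel_left, norm_neg]
    have : ‖∑ k, ψ k x • y k‖ ≤ ∑ _k : ι, ε / (Fintype.card ι + 1) := by
      refine norm_sum_le_of_le _ fun k _ => ?_
      rw [norm_smul]
      exact (mul_le_of_le_one_left (norm_nonneg _) (norm_flatRadial_le _)).trans (hy k).le
    refine this.trans ?_
    rw [Finset.sum_const, Finset.card_univ, nsmul_eq_mul, mul_div_assoc',
      div_le_iff₀ (by positivity)]
    nlinarith
  · have : ∀ k, ψ k (u • x) = u * ψ k x := fun k => by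
      simp only [ψ, map_smul, smul_eq_mul, flatRadial_mul hu]
    simp only [this, hequiv, smul_sub, Finset.smul_sum, smul_smul]
  · rcases eq_or_ne x 0 with rfl | hx0
    · rw [hdet0]
      exact one_ne_zero
    · refine hreg x ?_ hx
      by_contra! h
      exact hx0 (hl x fun k => flatRadial_eq_zero.1 (h k (Finset.mem_univ k)))

/-- A map on the closed unit ball whose restriction to the sphere commutes with a nontrivial `p`-th
root of unity, `p` prime, has a zero. -/
theorem exists_zero_of_prime_root_equivariant {ι : Type*} [Fintype ι] (l : ι → E →L[ℂ] ℂ)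
    (hl : ∀ x, (∀ k, l k x = 0) → x = 0) {p : ℕ} (hp : p.Prime) {u : ℂ} (hup : u ^ p = 1)
    (hu : u ≠ 1) {f : E → E} (hf : ContinuousOn f (Metric.closedBall 0 1))
    (hequiv : ∀ x, ‖x‖ = 1 → f (u • x) = u • f x) : ∃ x, ‖x‖ ≤ 1 ∧ f x = 0 := by
  by_contra! hne
  have hun : ‖u‖ = 1 := Complex.norm_eq_one_of_pow_eq_one hup hp.ne_zero
  have hu0 : u ≠ 0 := norm_ne_zero_iff.1 (by rw [hun]; exact one_ne_zero)
  have hnorm : ∀ k (x : E), ‖u ^ k • x‖ = ‖x‖ := fun k x => by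
    rw [norm_smul, norm_pow, hun, one_pow, one_mul]
  obtain ⟨c, hc, hcf⟩ := (isCompact_closedBall (0 : E) 1).exists_forall_le' (a := 0)
    hf.norm fun x hx => norm_pos_iff.2 (hne x (by simpa using hx))
  let F : E → E := fun x => f ((max 1 ‖x‖)⁻¹ • x)
  have hF : Continuous F := hf.continuous_radial_extension
  have hcF : ∀ x, c ≤ ‖F x‖ := fun x => hcf _ (by
    have hpos : 0 < max 1 ‖x‖ := lt_max_of_lt_left one_pos
    rw [mem_closedBall_zero_iff, norm_smul, norm_inv, Real.norm_of_nonneg hpos.le,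
      inv_mul_le_one₀ hpos]
    exact le_max_right _ _)
  have hFu : ∀ k x, 1 ≤ ‖x‖ → F (u ^ k • x) = u ^ k • F x := by
    intro k x hx
    induction k with
    | zero => simp
    | succ k ih =>
      have h1 : ‖(max 1 ‖x‖)⁻¹ • u ^ k • x‖ = 1 := by
        rw [norm_smul, hnorm, max_eq_right hx, norm_inv, norm_norm,
          inv_mul_cancel₀ (by positivity)]
      rw [pow_succ', mul_smul, mul_smul, ← ih]
      have := hequiv _ h1
      rw [smul_comm u] at this
      simpa only [F, norm_smul, hun, one_mul, hnorm] using this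
  obtain ⟨A, hA, hAF, -⟩ := hF.exists_contDiff_approx 2 (ε := fun _ => c / 4) continuous_const
    fun _ => by positivity
  simp only [dist_eq_norm] at hAF
  let χ : ContDiffBump (0 : E) := ⟨1 / 4, 1 / 2, by norm_num, by norm_num⟩
  let B : E → E := fun x => A x + χ x • (x - A x)
  have hB : ContDiff ℝ 2 B := hA.add (χ.contDiff.smul (contDiff_id.sub hA))
  have hBin : ∀ x, ‖x‖ ≤ 1 / 4 → B x = x := fun x hx => by
    have : χ x = 1 := χ.one_of_mem_closedBall (by rw [mem_closedBall_zero_iff]; exact hx)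
    simp [B, this]
  have hBout : ∀ x, 1 ≤ ‖x‖ → B x = A x := fun x hx => by
    have : χ x = 0 := χ.zero_of_le_dist (by
      rw [dist_zero_right]; exact le_trans (by norm_num [χ]) hx)
    simp [B, this]
  have hG0 : cyclicAverage p u B =ᶠ[nhds 0] id := by
    filter_upwards [Metric.closedBall_mem_nhds (0 : E) (by norm_num : (0 : ℝ) < 1 / 4)] with x hx
    rw [mem_closedBall_zero_iff] at hx
    exact cyclicAverage_eq_of_forall hp.ne_zero hu0 fun k => hBin _ (by rw [hnorm]; exact hx)
  have hGF : ∀ x, 1 ≤ ‖x‖ → ‖cyclicAverage p u B x - F x‖ ≤ c / 4 := fun x hx =>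
    norm_cyclicAverage_sub_le hp.ne_zero hun fun k => by
      rw [hBout _ (by rw [hnorm]; exact hx), ← hFu k x hx]
      exact (hAF _).le
  obtain ⟨H, hH, hHG, hHu, hHreg, hH0⟩ := exists_equivariant_regular_near l hl
    (contDiff_cyclicAverage p u hB) hG0 hun (cyclicAverage_smul hup hu0 B)
    (by positivity : 0 < c / 4)
  have hhom : ∀ x, 1 ≤ ‖x‖ → ∀ t ∈ Set.Icc (0 : ℝ) 1, c / 2 ≤ ‖A x + t • (H x - A x)‖ := by
    intro x hx t ht
    have h1 : A x ∈ Metric.closedBall (F x) (c / 2) := by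
      rw [mem_closedBall_iff_norm]
      linarith [hAF x]
    have h2 : H x ∈ Metric.closedBall (F x) (c / 2) := by
      rw [mem_closedBall_iff_norm]
      have := norm_sub_le_norm_sub_add_norm_sub (H x) (cyclicAverage p u B x) (F x)
      linarith [hHG x, hGF x hx]
    have h3 := (convex_closedBall (F x) (c / 2)).add_smul_sub_mem h1 h2 ht
    rw [mem_closedBall_iff_norm'] at h3
    have := norm_sub_norm_le (F x) (A x + t • (H x - A x))
    linarith [hcF x]
  have hAc : ∀ x, c / 2 ≤ ‖A x‖ := fun x => by
    have := norm_sub_norm_le (F x) (A x)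
    rw [norm_sub_rev] at this
    linarith [hcF x, hAF x]
  have hc2 : 0 < c / 2 := by positivity
  have hfin := (hH.of_le one_le_two).finite_zeros hHreg (R := 1) fun x hx => by
    have := hhom x hx 1 (by simp)
    rw [one_smul, add_sub_cancel] at this
    exact norm_pos_iff.1 (hc2.trans_le this)
  have hZ : ∀ x, x ∈ hfin.toFinset ↔ H x = 0 := fun x => hfin.mem_toFinset
  exact sum_sign_det_fderiv_ne_zero_of_equivariant (hH.differentiable two_ne_zero) hp hup hu hHu hZ
    hHreg hH0 (sum_sign_det_fderiv_eq_zero_of_homotopy hA hH hZ hHreg hc2 hAc hhom)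

end

end

/-- Borsuk–Ulam type theorem for the semifree `ℤ/q`-action on complex `n`-space generated by
multiplication by a primitive `q`-th root of unity `ζ = exp (2πi/q)`: a map continuous on the
closed unit ball and `ζ`-equivariant on the unit sphere has a zero in the closed unit ball. -/
theorem zero_of_zeta_equivariant_on_sphere (n q : ℕ) (hn : 1 ≤ n) (hq : 2 ≤ q)
    (f : EuclideanSpace ℂ (Fin n) → EuclideanSpace ℂ (Fin n))
    (hf : ContinuousOn f (Metric.closedBall 0 1))
    (hequiv : ∀ x : EuclideanSpace ℂ (Fin n), ‖x‖ = 1 →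
      f (Complex.exp (2 * Real.pi * Complex.I / q) • x)
        = Complex.exp (2 * Real.pi * Complex.I / q) • f x) :
    ∃ x : EuclideanSpace ℂ (Fin n), ‖x‖ ≤ 1 ∧ f x = 0 := by
  set ζ := Complex.exp (2 * Real.pi * Complex.I / q)
  have hζ : IsPrimitiveRoot ζ q := Complex.isPrimitiveRoot_exp q (by omega)
  have hζn : ‖ζ‖ = 1 := hζ.norm'_eq_one (by omega)
  have hp : q.minFac.Prime := Nat.minFac_prime (by omega)
  have hu : IsPrimitiveRoot (ζ ^ (q / q.minFac)) q.minFac :=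
    hζ.pow (by omega) (Nat.div_mul_cancel (Nat.minFac_dvd q)).symm
  have hpow : ∀ (k : ℕ) (x : EuclideanSpace ℂ (Fin n)), ‖x‖ = 1 → f (ζ ^ k • x) = ζ ^ k • f x := by
    intro k x hx
    induction k with
    | zero => simp
    | succ k ih =>
      rw [pow_succ', mul_smul, mul_smul, ← ih]
      exact hequiv _ (by rw [norm_smul, norm_pow, hζn, one_pow, one_mul, hx])
  exact exists_zero_of_prime_root_equivariant
    (fun k => (EuclideanSpace.proj k : EuclideanSpace ℂ (Fin n) →L[ℂ] ℂ))
    (fun x hx => by ext k; exact hx k) hp hu.pow_eq_one (hu.ne_one hp.one_lt) hf (hpow _)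
end
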